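/- The set of critical values of the Ginzburg–Landau energy on the disk is finite: the set {E(a,φ) : (a,φ) a GL solution with de Gennes–Neumann boundary conditions} is a finite subset of ℝ. -/

import Mathlib

open MeasureTheory Complex

noncomputable section

/-- Partial derivative in the first coordinate direction. -/
def pd1 {E : Type*} [NormedAddCommGroup E] [NormedSpace ℝ E]
    (f : ℝ × ℝ → E) (x : ℝ × ℝ) : E := fderiv ℝ f x (1, 0)

/-- Partial derivative in the second coordinate direction. -/
def pd2 {E : Type*} [NormedAddCommGroup E] [NormedSpace ℝ E]
    (f : ℝ × ℝ → E) (x : ℝ × ℝ) : E := fderiv ℝ f x (0, 1)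

/-- Covariant derivative `D₁φ = ∂₁φ + i a₁ φ`. -/
def D1 (a1 : ℝ × ℝ → ℝ) (φ : ℝ × ℝ → ℂ) : ℝ × ℝ → ℂ :=
  fun x => pd1 φ x + Complex.I * (a1 x : ℂ) * φ x

/-- Covariant derivative `D₂φ = ∂₂φ + i a₂ φ`. -/
def D2 (a2 : ℝ × ℝ → ℝ) (φ : ℝ × ℝ → ℂ) : ℝ × ℝ → ℂ :=
  fun x => pd2 φ x + Complex.I * (a2 x : ℂ) * φ x

/-- Curvature `F(a) = ∂₁a₂ − ∂₂a₁`. -/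
def curv (a1 a2 : ℝ × ℝ → ℝ) : ℝ × ℝ → ℝ :=
  fun x => pd1 a2 x - pd2 a1 x

/-- The closed unit disk `D̄ ⊆ ℝ²`. -/
def disk : Set (ℝ × ℝ) := { x : ℝ × ℝ | x.1 ^ 2 + x.2 ^ 2 ≤ 1 }

/-- A field pair on the disk: a pair of smooth maps `(a, φ)`. -/
structure DiskPair where
  a1 : ℝ × ℝ → ℝ
  a2 : ℝ × ℝ → ℝ
  φ : ℝ × ℝ → ℂ
  smooth_a1 : ContDiff ℝ (⊤ : ℕ∞) a1
  smooth_a2 : ContDiff ℝ (⊤ : ℕ∞) a2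
  smooth_φ : ContDiff ℝ (⊤ : ℕ∞) φ

/-- The Ginzburg–Landau free energy on the disk. -/
def energyD (α β : ℝ) (F₀ : ℝ × ℝ → ℝ) (P : DiskPair) : ℝ :=
  (1 / 2) * ∫ x in disk,
    ((curv P.a1 P.a2 x - F₀ x) ^ 2 + ‖D1 P.a1 P.φ x‖ ^ 2 + ‖D2 P.a2 P.φ x‖ ^ 2
      - α * ‖P.φ x‖ ^ 2 + (β / 2) * ‖P.φ x‖ ^ 4)

/-- The Ginzburg–Landau equations on the disk with de Gennes–Neumann boundary
conditions. -/
def IsGLSolutionD (α β : ℝ) (F₀ : ℝ × ℝ → ℝ) (P : DiskPair) : Prop :=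
  (∀ x ∈ disk,
      pd2 (fun y => curv P.a1 P.a2 y - F₀ y) x
        + ((starRingEnd ℂ) (P.φ x) * D1 P.a1 P.φ x).im = 0) ∧
  (∀ x ∈ disk,
      -pd1 (fun y => curv P.a1 P.a2 y - F₀ y) x
        + ((starRingEnd ℂ) (P.φ x) * D2 P.a2 P.φ x).im = 0) ∧
  (∀ x ∈ disk,
      -(D1 P.a1 (D1 P.a1 P.φ) x + D2 P.a2 (D2 P.a2 P.φ) x)
        = (α : ℂ) * P.φ x - (β : ℂ) * (‖P.φ x‖ : ℂ) ^ 2 * P.φ x) ∧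
  (∀ x : ℝ × ℝ, x.1 ^ 2 + x.2 ^ 2 = 1 →
      curv P.a1 P.a2 x = F₀ x ∧
      (x.1 : ℂ) * D1 P.a1 P.φ x + (x.2 : ℂ) * D2 P.a2 P.φ x = 0)

/-- The set of energies of all field pairs on the disk. -/
def energySetD (α β : ℝ) (F₀ : ℝ × ℝ → ℝ) : Set ℝ :=
  { t : ℝ | ∃ P : DiskPair, t = energyD α β F₀ P }

/-- `λ₁` on the disk. -/
def lambda1D (F₀ : ℝ × ℝ → ℝ) : ℝ :=
  sInf { t : ℝ | ∃ P : DiskPair,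
    (∀ x ∈ disk, curv P.a1 P.a2 x = F₀ x) ∧
    (∫ x in disk, ‖P.φ x‖ ^ 2) = 1 ∧
    t = ∫ x in disk, (‖D1 P.a1 P.φ x‖ ^ 2 + ‖D2 P.a2 P.φ x‖ ^ 2) }

section

/-! ### Power series evaluated at commuting operators -/

/-- The power series obtained from `p` by letting the coordinates of the argument with respect to
the family `e` take values in a normed algebra `B`. -/
def wordSeries {E σ : Type*} [NormedAddCommGroup E] [NormedSpace ℝ E] [Fintype σ]
    (B : Type*) [NormedRing B] [NormedAlgebra ℝ B]
    (p : FormalMultilinearSeries ℝ E ℝ) (e : σ → E) : FormalMultilinearSeries ℝ (σ → B) B :=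
  fun k => ∑ w : Fin k → σ, p k (e ∘ w) •
    (ContinuousMultilinearMap.mkPiAlgebraFin ℝ k B).compContinuousLinearMap
      (fun i => ContinuousLinearMap.proj (w i))

section wordSeries

variable {E σ B : Type*} [NormedAddCommGroup E] [NormedSpace ℝ E] [Fintype σ]
  [NormedRing B] [NormedAlgebra ℝ B]

theorem wordSeries_apply (p : FormalMultilinearSeries ℝ E ℝ) (e : σ → E) (k : ℕ) (y : σ → B) :
    wordSeries B p e k (fun _ => y) =
      ∑ w : Fin k → σ, p k (e ∘ w) • (List.ofFn fun i => y (w i)).prod := by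
  simp [wordSeries]

theorem wordSeries_radius_pos [NormOneClass B] (p : FormalMultilinearSeries ℝ E ℝ) (e : σ → E)
    (hp : 0 < p.radius) : 0 < (wordSeries B p e).radius := by
  obtain ⟨r, hr0, hr⟩ := ENNReal.lt_iff_exists_nnreal_btwn.1 hp
  obtain ⟨C, hC, hCb⟩ := p.norm_mul_pow_le_of_lt_radius hr
  have hr0' : 0 < r := by exact_mod_cast hr0
  set M : NNReal := 1 + ∑ i : σ, ‖e i‖₊ with hM
  have hM0 : 0 < M := by positivity
  set c : NNReal := 1 + Fintype.card σ with hc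
  have hc0 : 0 < c := by positivity
  have hle : ((r / (c * M) : NNReal) : ENNReal) ≤ (wordSeries B p e).radius := by
    refine FormalMultilinearSeries.le_radius_of_bound _ C fun k => ?_
    have h1 : ‖wordSeries B p e k‖ ≤ (c : ℝ) ^ k * (‖p k‖ * (M : ℝ) ^ k) := by
      rw [wordSeries]
      refine le_trans (norm_sum_le (E := ContinuousMultilinearMap ℝ (fun _ : Fin k => σ → B) B) _ _) ?_
      have h2 : ∀ w ∈ (Finset.univ : Finset (Fin k → σ)), ‖p k (e ∘ w) •
          (ContinuousMultilinearMap.mkPiAlgebraFin ℝ k B).compContinuousLinearMap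
          (fun i => (ContinuousLinearMap.proj (w i) : (σ → B) →L[ℝ] B))‖ ≤ ‖p k‖ * (M : ℝ) ^ k := by
        intro w _
        refine (ContinuousMultilinearMap.opNorm_smul_le _ _).trans ?_
        have h3 : ‖p k (e ∘ w)‖ ≤ ‖p k‖ * (M : ℝ) ^ k := by
          refine ((p k).le_opNorm _).trans ?_
          gcongr
          calc ∏ i, ‖(e ∘ w) i‖ ≤ ∏ _i : Fin k, (M : ℝ) := by
                refine Finset.prod_le_prod (fun _ _ => norm_nonneg _) fun i _ => ?_
                have : ‖e (w i)‖₊ ≤ ∑ i, ‖e i‖₊ :=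
                  Finset.single_le_sum (f := fun i => ‖e i‖₊) (fun _ _ => zero_le) (Finset.mem_univ _)
                have h4 : ‖e (w i)‖₊ ≤ M := this.trans (by rw [hM]; exact le_add_self)
                exact_mod_cast h4
            _ = (M : ℝ) ^ k := by simp
        have h5 : ‖(ContinuousMultilinearMap.mkPiAlgebraFin ℝ k B).compContinuousLinearMap
          (fun i => (ContinuousLinearMap.proj (w i) : (σ → B) →L[ℝ] B))‖ ≤ 1 := by
          refine (ContinuousMultilinearMap.norm_compContinuousLinearMap_le _ _).trans ?_
          rw [ContinuousMultilinearMap.norm_mkPiAlgebraFin, one_mul]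
          refine Finset.prod_le_one (fun _ _ => norm_nonneg _) fun i _ => ?_
          refine ContinuousLinearMap.opNorm_le_bound _ zero_le_one fun y => ?_
          rw [one_mul]
          exact norm_le_pi_norm y (w i)
        calc _ ≤ (‖p k‖ * (M : ℝ) ^ k) * 1 := by gcongr
          _ = _ := mul_one _
      refine (Finset.sum_le_sum h2).trans ?_
      rw [Finset.sum_const, nsmul_eq_mul]
      gcongr
      have : Finset.card (Finset.univ : Finset (Fin k → σ)) = (Fintype.card σ) ^ k := by simp
      rw [this, hc]
      push_cast
      gcongr
      linarith
    have hcM : (0 : ℝ) < c ^ k * M ^ k := by positivity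
    calc ‖wordSeries B p e k‖ * ((r / (c * M) : NNReal) : ℝ) ^ k
        ≤ ((c : ℝ) ^ k * (‖p k‖ * (M : ℝ) ^ k)) * ((r / (c * M) : NNReal) : ℝ) ^ k := by gcongr
      _ = ‖p k‖ * (r : ℝ) ^ k := by
        push_cast
        have : (c : ℝ) ≠ 0 := by positivity
        have : (M : ℝ) ≠ 0 := by positivity
        rw [div_pow, mul_pow]
        field_simp
      _ ≤ C := hCb k
  refine lt_of_lt_of_le ?_ hle
  exact_mod_cast (by positivity : 0 < r / (c * M))

/-- If each `b i` acts on a functional `ψ` by the scalar `x i`, then the `B`-valued power series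
acts on `ψ` by the value of the scalar power series. -/
theorem wordSeries_intertwine {V : Type*} [NormedAddCommGroup V] [NormedSpace ℝ V]
    (p : FormalMultilinearSeries ℝ E ℝ) (e : σ → E) (b : σ → V →L[ℝ] V) (x : σ → ℝ)
    (ψ : V →L[ℝ] ℝ) (h : ∀ i v, ψ (b i v) = x i * ψ v) (k : ℕ) (v : V) :
    ψ (wordSeries (V →L[ℝ] V) p e k (fun _ => b) v) =
      p k (fun _ => ∑ i, x i • e i) * ψ v := by
  have hl : ∀ (l : List σ) (v : V), ψ ((l.map b).prod v) = (l.map x).prod * ψ v := by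
    intro l
    induction l with
    | nil => intro v; simp
    | cons a l ih => intro v; simp [h, ih, mul_assoc]
  have hp : p k (fun _ => ∑ i, x i • e i) = ∑ w : Fin k → σ, (∏ i, x (w i)) * p k (e ∘ w) := by
    classical
    have h1 := (p k).toMultilinearMap.map_sum (fun (_ : Fin k) (i : σ) => x i • e i)
    simp only [ContinuousMultilinearMap.coe_coe] at h1
    rw [h1]
    refine Finset.sum_congr rfl fun w _ => ?_
    have h2 := (p k).map_smul_univ (fun i => x (w i)) (fun i => e (w i))
    rw [h2, smul_eq_mul]
    rfl
  rw [wordSeries_apply, hp, _root_.sum_apply, map_sum, Finset.sum_mul]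
  refine Finset.sum_congr rfl fun w _ => ?_
  have h3 := hl (List.ofFn w) v
  rw [List.map_ofFn, List.map_ofFn] at h3
  rw [_root_.smul_apply, map_smul, smul_eq_mul]
  have h4 : (List.ofFn fun i => b (w i)).prod = (List.ofFn (b ∘ w)).prod := rfl
  rw [h4, h3, List.prod_ofFn]
  simp only [Function.comp]
  ring

end wordSeries

open Topology Filter in
theorem HasFPowerSeriesAt.exists_wordSeries_sum {E σ V : Type*} [NormedAddCommGroup E]
    [NormedSpace ℝ E] [Fintype σ] [NormedAddCommGroup V] [NormedSpace ℝ V] [CompleteSpace V]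
    [Nontrivial V] {h : E → ℝ} {p : FormalMultilinearSeries ℝ E ℝ} (hp : HasFPowerSeriesAt h p 0)
    (e : σ → E) : ∃ ρ : ENNReal, 0 < ρ ∧ ∃ Φ : (σ → V →L[ℝ] V) → V →L[ℝ] V,
      HasFPowerSeriesOnBall Φ (wordSeries (V →L[ℝ] V) p e) 0 ρ ∧
      ∀ (ψ : V →L[ℝ] ℝ) (b : σ → V →L[ℝ] V) (x : σ → ℝ), b ∈ Metric.eball 0 ρ →
        ∑ i, x i • e i ∈ Metric.eball 0 ρ → (∀ i v, ψ (b i v) = x i * ψ v) →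
        ∀ v, ψ (Φ b v) = h (∑ i, x i • e i) * ψ v := by
  obtain ⟨ρ₁, h1⟩ := hp
  have hr : 0 < (wordSeries (V →L[ℝ] V) p e).radius :=
    wordSeries_radius_pos p e (h1.r_pos.trans_le h1.r_le)
  have h2 := (wordSeries (V →L[ℝ] V) p e).hasFPowerSeriesOnBall hr
  refine ⟨min ρ₁ (wordSeries (V →L[ℝ] V) p e).radius, lt_min h1.r_pos hr, _,
    h2.mono (lt_min h1.r_pos hr) (min_le_right _ _), ?_⟩
  intro ψ b x hb hx hψ v
  have h3 := h2.hasSum (Metric.eball_subset_eball (min_le_right _ _) hb)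
  have h4 := h1.hasSum (Metric.eball_subset_eball (min_le_left _ _) hx)
  rw [zero_add] at h3 h4
  have h5 := (ψ.hasSum ((ContinuousLinearMap.apply ℝ V v).hasSum h3))
  have h6 := h4.mul_right (ψ v)
  refine h5.unique ?_
  convert! h6 using 2 with k
  exact wordSeries_intertwine p e b x ψ hψ k v

/-- The right shift of bounded sequences. -/
def shiftRight : (BoundedContinuousFunction ℕ ℝ) →L[ℝ] BoundedContinuousFunction ℕ ℝ :=
  LinearMap.mkContinuous
    { toFun := fun f => BoundedContinuousFunction.ofNormedAddCommGroupDiscrete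
        (fun n => Nat.casesOn n 0 f) ‖f‖ (by
          intro n
          cases n with
          | zero => simp
          | succ n => exact f.norm_coe_le_norm n)
      map_add' := by
        intro f g
        ext n
        cases n <;> simp
      map_smul' := by
        intro c f
        ext n
        cases n <;> simp } 1 (by
    intro f
    rw [one_mul]
    refine (BoundedContinuousFunction.norm_le (norm_nonneg _)).2 fun n => ?_
    cases n with
    | zero => simp
    | succ n => exact f.norm_coe_le_norm n)

/-- The left shift of bounded sequences. -/
def shiftLeft : (BoundedContinuousFunction ℕ ℝ) →L[ℝ] BoundedContinuousFunction ℕ ℝ :=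
  LinearMap.mkContinuous
    { toFun := fun f => BoundedContinuousFunction.ofNormedAddCommGroupDiscrete
        (fun n => f (n + 1)) ‖f‖ (fun n => f.norm_coe_le_norm (n + 1))
      map_add' := by
        intro f g
        ext n
        simp
      map_smul' := by
        intro c f
        ext n
        simp } 1 (by
    intro f
    rw [one_mul]
    exact (BoundedContinuousFunction.norm_le (norm_nonneg _)).2
      fun n => f.norm_coe_le_norm (n + 1))

theorem exists_shifts : ∃ (V : Type) (_ : NormedAddCommGroup V) (_ : NormedSpace ℝ V)
    (_ : CompleteSpace V) (R S : V →L[ℝ] V) (p : V →L[ℝ] ℝ) (v : V),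
    S * R = 1 ∧ p ∘L R = 0 ∧ S v = 0 ∧ p v = 1 ∧ ‖R‖ ≤ 1 ∧ ‖S‖ ≤ 1 := by
  refine ⟨BoundedContinuousFunction ℕ ℝ, inferInstance, inferInstance, inferInstance,
    shiftRight, shiftLeft, BoundedContinuousFunction.evalCLM ℝ 0,
    BoundedContinuousFunction.ofNormedAddCommGroupDiscrete
      (fun n => Nat.casesOn n 1 0) 1 (by rintro (_ | n) <;> simp), ?_, ?_, ?_, ?_, ?_, ?_⟩
  · ext f n; rfl
  · ext f; rfl
  · ext n; rfl
  · rfl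
  · exact LinearMap.mkContinuous_norm_le _ zero_le_one _
  · exact LinearMap.mkContinuous_norm_le _ zero_le_one _

theorem AnalyticAt.clm_apply_vec {E V W : Type*} [NormedAddCommGroup E] [NormedSpace ℝ E]
    [NormedAddCommGroup V] [NormedSpace ℝ V] [NormedAddCommGroup W] [NormedSpace ℝ W]
    {f : E → V →L[ℝ] W} {g : E → V} {x : E} (hf : AnalyticAt ℝ f x) (hg : AnalyticAt ℝ g x) :
    AnalyticAt ℝ (fun y => f y (g y)) x :=
  ((ContinuousLinearMap.id ℝ (V →L[ℝ] W)).analyticAt_bilinear (f x, g x)).comp₂ hf hg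

/-- Evaluation at `t` of a vector considered as a sequence of Taylor coefficients `p (σ ^ n v)`. -/
def resolventEval {V : Type*} [NormedAddCommGroup V] [NormedSpace ℝ V] (p : V →L[ℝ] ℝ)
    (σ : V →L[ℝ] V) (t : ℝ) : V →L[ℝ] ℝ := p ∘L Ring.inverse (1 - t • σ)

section resolventEval

open Topology Filter

variable {V : Type*} [NormedAddCommGroup V] [NormedSpace ℝ V] (p : V →L[ℝ] ℝ) (σ : V →L[ℝ] V)

theorem analyticAt_resolventEval [CompleteSpace V] :
    AnalyticAt ℝ (resolventEval p σ) 0 := by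
  have h1 : AnalyticAt ℝ (Ring.inverse : (V →L[ℝ] V) → (V →L[ℝ] V)) (1 - (0 : ℝ) • σ) := by
    have := analyticAt_inverse (𝕜 := ℝ) (1 : (V →L[ℝ] V)ˣ)
    simpa using this
  have h2 : AnalyticAt ℝ (fun t : ℝ => 1 - t • σ) 0 :=
    analyticAt_const.sub (analyticAt_id.smul analyticAt_const)
  have h3 := AnalyticAt.comp (f := fun t : ℝ => 1 - t • σ) h1 h2
  exact ((ContinuousLinearMap.compL ℝ V V ℝ p).analyticAt _).comp h3

theorem eventually_isUnit_one_sub_smul [CompleteSpace V] :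
    ∀ᶠ t : ℝ in 𝓝 0, IsUnit (1 - t • σ) := by
  have h : Tendsto (fun t : ℝ => 1 - t • σ) (𝓝 0) (𝓝 1) := by
    have : Continuous (fun t : ℝ => 1 - t • σ) := by fun_prop
    simpa using this.tendsto 0
  exact h (Units.isOpen.mem_nhds isUnit_one)

variable {p σ}

theorem resolventEval_apply {t : ℝ} (ht : IsUnit (1 - t • σ)) (v : V) :
    resolventEval p σ t v = p v + t * resolventEval p σ t (σ v) := by
  have h : Ring.inverse (1 - t • σ) * (1 - t • σ) = 1 := Ring.inverse_mul_cancel _ ht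
  have h1 : Ring.inverse (1 - t • σ) v = v + t • Ring.inverse (1 - t • σ) (σ v) := by
    have h2 := DFunLike.congr_fun h v
    simp only [mul_apply_eq_comp, _root_.sub_apply,
      one_apply_eq_self, _root_.smul_apply, map_sub, map_smul] at h2
    rw [eq_add_of_sub_eq h2]
  simp [resolventEval, ContinuousLinearMap.comp_apply, h1]

theorem resolventEval_eq_sum {t : ℝ} (ht : IsUnit (1 - t • σ)) (d : ℕ) (v : V) :
    resolventEval p σ t v = t ^ d * resolventEval p σ t ((σ ^ d) v) +
      ∑ j : Fin d, p ((σ ^ (j : ℕ)) v) * t ^ (j : ℕ) := by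
  induction d with
  | zero => simp
  | succ d ih =>
    rw [ih, Fin.sum_univ_castSucc, resolventEval_apply ht ((σ ^ d) v)]
    simp only [Fin.val_castSucc, Fin.val_last, pow_succ' σ d, mul_apply_eq_comp]
    ring

theorem resolventEval_section {t : ℝ} (ht : IsUnit (1 - t • σ)) {τ : V →L[ℝ] V}
    (h1 : σ * τ = 1) (h2 : p ∘L τ = 0) (v : V) :
    resolventEval p σ t (τ v) = t * resolventEval p σ t v := by
  rw [resolventEval_apply ht]
  have h3 := DFunLike.congr_fun h1 v
  have h4 := DFunLike.congr_fun h2 v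
  simp only [mul_apply_eq_comp, one_apply_eq_self] at h3
  simp only [ContinuousLinearMap.comp_apply, _root_.zero_apply] at h4
  rw [h3, h4, zero_add]

end resolventEval

open Topology Filter in
theorem wordSeries_apply_single {E ι B : Type*} [NormedAddCommGroup E] [NormedSpace ℝ E]
    [Fintype ι] [NormedRing B] [NormedAlgebra ℝ B]
    (p : FormalMultilinearSeries ℝ E ℝ) (e : Option ι → E) (k : ℕ) (b : B) :
    wordSeries B p e k (fun _ i => Option.casesOn i b (fun _ => 0)) =
      p k (fun _ => e none) • b ^ k := by
  classical
  rw [wordSeries_apply, Finset.sum_eq_single (fun _ => none)]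
  · simp [Function.comp_def]
  · intro w _ hw
    obtain ⟨i, hi⟩ := Function.ne_iff.1 hw
    obtain ⟨j, hj⟩ := Option.ne_none_iff_exists'.1 hi
    rw [List.prod_eq_zero, smul_zero]
    rw [List.mem_ofFn]
    exact ⟨i, by simp [hj]⟩
  · simp

open Topology Filter in
theorem weierstrass_division_aux {F : Type*} [NormedAddCommGroup F] [NormedSpace ℝ F]
    [FiniteDimensional ℝ F] {g : F × ℝ → ℝ} {p : FormalMultilinearSeries ℝ (F × ℝ) ℝ}
    (hg : HasFPowerSeriesAt g p 0) (d : ℕ) (hlt : ∀ k < d, p k (fun _ => (0, 1)) = 0)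
    (hd : p d (fun _ => (0, 1)) = 1) {h : F × ℝ → ℝ} (hh : AnalyticAt ℝ h 0) :
    ∃ (q : F × ℝ → ℝ) (r : Fin d → F → ℝ), AnalyticAt ℝ q 0 ∧ (∀ j, AnalyticAt ℝ (r j) 0) ∧
      ∀ᶠ z in 𝓝 (0 : F × ℝ), h z = q z * g z + ∑ j, r j z.1 * z.2 ^ (j : ℕ) := by
  obtain ⟨V, _, _, _, R, S, P, v₀, hSR, hPR, hSv, hPv, hR, hS⟩ := exists_shifts
  have : Nontrivial V := ⟨v₀, 0, fun h0 => by simp [h0] at hPv⟩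
  obtain ⟨p', hp'⟩ := hh
  set n := Module.finrank ℝ F
  set bas := Module.finBasis ℝ F
  set e : Option (Fin n) → F × ℝ := fun i => Option.casesOn i (0, 1) (fun j => (bas j, 0)) with he
  obtain ⟨ρg, hρg, Φg, hΦg, hevg⟩ := hg.exists_wordSeries_sum (V := V) e
  obtain ⟨ρh, hρh, Φh, hΦh, hevh⟩ := hp'.exists_wordSeries_sum (V := V) e
  -- the choice of the weight `r`
  have hO := hΦg.hasFPowerSeriesAt.isBigO_sub_partialSum_pow (d + 1)
  obtain ⟨C, hC⟩ := hO.bound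
  have hsmall : ∃ r : ℝ, 0 < r ∧
      (fun i => Option.casesOn i (r • R) (fun _ => 0) : Option (Fin n) → V →L[ℝ] V) ∈
        Metric.eball (0 : Option (Fin n) → V →L[ℝ] V) ρg ∧
      (fun i => Option.casesOn i (r • R) (fun _ => 0) : Option (Fin n) → V →L[ℝ] V) ∈
        Metric.eball (0 : Option (Fin n) → V →L[ℝ] V) ρh ∧
      ‖Φg (fun i => Option.casesOn i (r • R) (fun _ => 0)) - (r • R) ^ d‖ * r⁻¹ ^ d < 1 := by
    have hlim : Tendsto (fun r : ℝ => (fun i => Option.casesOn i (r • R) (fun _ => 0) :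
        Option (Fin n) → V →L[ℝ] V)) (𝓝 0) (𝓝 0) := by
      rw [tendsto_pi_nhds]
      rintro (_ | i)
      · have : Continuous fun r : ℝ => r • R := by fun_prop
        simpa using this.tendsto 0
      · exact tendsto_const_nhds
    have e1 := hlim (Metric.eball_mem_nhds 0 hρg)
    have e2 := hlim (Metric.eball_mem_nhds 0 hρh)
    have e3 := hlim hC
    have e4 : ∀ᶠ r : ℝ in 𝓝 0, |C| * r < 1 := by
      have : Continuous fun r : ℝ => |C| * r := by fun_prop
      have h := this.tendsto 0
      simp only [mul_zero] at h
      exact h (Iio_mem_nhds zero_lt_one)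
    have e5 : ∀ᶠ r : ℝ in 𝓝[>] 0, 0 < r := self_mem_nhdsWithin
    have e6 : ∀ᶠ r : ℝ in 𝓝[>] 0, _ := Filter.Eventually.filter_mono nhdsWithin_le_nhds
      ((Filter.Eventually.and (f := 𝓝 0) e1 e2).and (Filter.Eventually.and (f := 𝓝 0) e3 e4))
    obtain ⟨r, hr0, ⟨h1, h2⟩, h3, h4⟩ := (e5.and e6).exists
    refine ⟨r, hr0, h1, h2, ?_⟩
    simp only [Set.mem_ofPred_eq, zero_add, FormalMultilinearSeries.partialSum] at h3
    rw [Finset.sum_range_succ] at h3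
    simp only [wordSeries_apply_single] at h3
    have h5 : ∑ x ∈ Finset.range d, p x (fun _ => e none) • (r • R) ^ x = 0 :=
      Finset.sum_eq_zero fun k hk => by
        have := hlt k (Finset.mem_range.1 hk)
        rw [show p k (fun _ => e none) = 0 from this, zero_smul]
    rw [h5, zero_add, show p d (fun _ => e none) = 1 from hd, one_smul] at h3
    have h6 : ‖(fun i => Option.casesOn i (r • R) (fun _ => 0) : Option (Fin n) → V →L[ℝ] V)‖ ≤ r := by
      rw [pi_norm_le_iff_of_nonneg hr0.le]
      rintro (_ | i)
      · simp only [norm_smul, Real.norm_eq_abs, abs_of_pos hr0]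
        exact mul_le_of_le_one_right hr0.le hR
      · simpa using hr0.le
    rw [inv_pow, ← div_eq_mul_inv, div_lt_one (by positivity)]
    refine h3.trans_lt ?_
    calc C * ‖‖(fun i => Option.casesOn i (r • R) (fun _ => 0) :
          Option (Fin n) → V →L[ℝ] V)‖ ^ (d + 1)‖ ≤ |C| * r ^ (d + 1) := by
          rw [norm_pow, norm_norm]
          gcongr
          exact le_abs_self C
      _ = (|C| * r) * r ^ d := by ring
      _ < 1 * r ^ d := by gcongr
      _ = r ^ d := one_mul _
  obtain ⟨r, hr0, hrg, hrh, hr1⟩ := hsmall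
  set τ : V →L[ℝ] V := r • R with hτ
  set σ : V →L[ℝ] V := r⁻¹ • S with hσ
  have hστ : σ * τ = 1 := by
    rw [hσ, hτ, smul_mul_smul_comm, hSR, inv_mul_cancel₀ hr0.ne', one_smul]
  have hPτ : P ∘L τ = 0 := by rw [hτ, ContinuousLinearMap.comp_smul, hPR, smul_zero]
  have hσv : σ v₀ = 0 := by simp [hσ, hSv]
  set Y : F → Option (Fin n) → V →L[ℝ] V :=
    fun x i => Option.casesOn i τ (fun j => bas.repr x j • 1) with hY
  have hYan : ∀ x, AnalyticAt ℝ Y x := by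
    intro x
    rw [analyticAt_pi_iff]
    rintro (_ | j)
    · exact analyticAt_const
    · have : AnalyticAt ℝ (fun x => bas.repr x j) x :=
        ((bas.coord j).toContinuousLinearMap).analyticAt x
      exact this.smul analyticAt_const
  have hY0 : Y 0 = fun i => Option.casesOn i τ (fun _ => 0) := by
    funext i
    cases i <;> simp [hY]
  have hYg : AnalyticAt ℝ (fun x => Φg (Y x)) 0 :=
    AnalyticAt.comp (f := Y) (g := Φg) (hΦg.analyticAt_of_mem (hY0 ▸ hrg)) (hYan 0)
  have hYh : AnalyticAt ℝ (fun x => Φh (Y x)) 0 :=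
    AnalyticAt.comp (f := Y) (g := Φh) (hΦh.analyticAt_of_mem (hY0 ▸ hrh)) (hYan 0)
  set Λ : F → V →L[ℝ] V := fun x => 1 + (Φg (Y x) - τ ^ d) * σ ^ d with hΛ
  have hΛan : AnalyticAt ℝ Λ 0 :=
    analyticAt_const.add ((hYg.sub analyticAt_const).mul analyticAt_const)
  have hΛ0 : IsUnit (Λ 0) := by
    have : ‖-((Φg (Y 0) - τ ^ d) * σ ^ d)‖ < 1 := by
      rw [norm_neg]
      refine (norm_mul_le _ _).trans_lt (lt_of_le_of_lt ?_ hr1)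
      rw [hY0]
      refine mul_le_mul_of_nonneg_left ((norm_pow_le _ _).trans ?_) (norm_nonneg _)
      refine pow_le_pow_left₀ (norm_nonneg _) ?_ _
      rw [hσ, norm_smul, Real.norm_eq_abs, abs_of_pos (inv_pos.2 hr0)]
      exact mul_le_of_le_one_right (inv_pos.2 hr0).le hS
    have h2 := (Units.oneSub _ this).isUnit
    rwa [Units.val_oneSub, sub_neg_eq_add] at h2
  set c : F → V := fun x => Ring.inverse (Λ x) (Φh (Y x) v₀) with hc
  have happ : ∀ v : V, AnalyticAt ℝ (fun x => Φh (Y x) v) 0 := fun v =>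
    ((ContinuousLinearMap.apply ℝ V v).analyticAt _).comp hYh
  have hcan : AnalyticAt ℝ c 0 := by
    have h1 : AnalyticAt ℝ (fun x => Ring.inverse (Λ x)) 0 :=
      AnalyticAt.comp (f := Λ) (analyticAt_inverse (𝕜 := ℝ) hΛ0.unit) hΛan
    exact h1.clm_apply_vec (happ v₀)
  have hfst : AnalyticAt ℝ (Prod.fst : F × ℝ → F) 0 := analyticAt_fst
  have hsnd : AnalyticAt ℝ (Prod.snd : F × ℝ → ℝ) 0 := analyticAt_snd
  have hev : AnalyticAt ℝ (fun z : F × ℝ => resolventEval P σ z.2) 0 :=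
    AnalyticAt.comp (f := Prod.snd) (g := resolventEval P σ) (analyticAt_resolventEval P σ) hsnd
  refine ⟨fun z => resolventEval P σ z.2 ((σ ^ d) (c z.1)), fun j x => P ((σ ^ (j : ℕ)) (c x)),
    ?_, ?_, ?_⟩
  · refine hev.clm_apply_vec (((σ ^ d).analyticAt _).comp ?_)
    exact AnalyticAt.comp (f := Prod.fst) (g := c) hcan hfst
  · intro j
    exact (P.analyticAt _).comp (((σ ^ (j : ℕ)).analyticAt _).comp hcan)
  · have cY : Tendsto (fun z : F × ℝ => Y z.1) (𝓝 0) (𝓝 (Y 0)) :=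
      ((hYan 0).continuousAt.tendsto).comp (hfst.continuousAt.tendsto)
    have cΛ : Tendsto (fun z : F × ℝ => Λ z.1) (𝓝 0) (𝓝 (Λ 0)) :=
      (hΛan.continuousAt.tendsto).comp (hfst.continuousAt.tendsto)
    have ct : Tendsto (fun z : F × ℝ => z.2) (𝓝 0) (𝓝 0) := hsnd.continuousAt.tendsto
    filter_upwards [cY (Metric.isOpen_eball.mem_nhds (hY0 ▸ hrg)),
      cY (Metric.isOpen_eball.mem_nhds (hY0 ▸ hrh)), cΛ (Units.isOpen.mem_nhds hΛ0),
      ct (eventually_isUnit_one_sub_smul σ), Metric.eball_mem_nhds (0 : F × ℝ) hρg,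
      Metric.eball_mem_nhds (0 : F × ℝ) hρh] with z z1 z2 z3 z4 z5 z6
    set X : Option (Fin n) → ℝ := fun i => Option.casesOn i z.2 (fun j => bas.repr z.1 j) with hX
    have hsum : ∑ i, X i • e i = z := by
      rw [Fintype.sum_option]
      refine Prod.ext ?_ ?_
      · simp [hX, he, Prod.fst_sum]
      · simp [hX, he, Prod.snd_sum]
    have z4' : IsUnit (1 - z.2 • σ) := z4
    set ev := resolventEval P σ z.2 with hevdef
    have hact : ∀ i v, ev (Y z.1 i v) = X i * ev v := by
      rintro (_ | j) v
      · exact resolventEval_section z4' hστ hPτ v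
      · simp [hY, hX]
    have evg : ∀ v, ev (Φg (Y z.1) v) = g z * ev v := fun v => by
      have := hevg ev (Y z.1) X z1 (by rw [hsum]; exact z5) hact v
      rwa [hsum] at this
    have evh : ∀ v, ev (Φh (Y z.1) v) = h z * ev v := fun v => by
      have := hevh ev (Y z.1) X z2 (by rw [hsum]; exact z6) hact v
      rwa [hsum] at this
    have evv : ev v₀ = 1 := by
      rw [hevdef, resolventEval_apply z4', hσv, map_zero, mul_zero, add_zero, hPv]
    have evτ : ∀ k v, ev ((τ ^ k) v) = z.2 ^ k * ev v := by
      intro k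
      induction k with
      | zero => simp
      | succ k ih =>
        intro v
        rw [pow_succ', mul_apply_eq_comp, resolventEval_section z4' hστ hPτ, ih]
        ring
    have hΛc : Λ z.1 (c z.1) = Φh (Y z.1) v₀ := by
      have : Λ z.1 * Ring.inverse (Λ z.1) = 1 := Ring.mul_inverse_cancel _ z3
      exact DFunLike.congr_fun this _
    have h1 := congrArg ev hΛc
    rw [evh, evv, mul_one] at h1
    have h2 : ev (Λ z.1 (c z.1)) = ev (c z.1) + g z * ev ((σ ^ d) (c z.1)) -
        z.2 ^ d * ev ((σ ^ d) (c z.1)) := by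
      simp only [hΛ, _root_.add_apply, mul_apply_eq_comp,
        _root_.sub_apply, one_apply_eq_self, map_add, map_sub, evg, evτ]
      ring
    have h3 := resolventEval_eq_sum (p := P) z4' d (c z.1)
    rw [← h1, h2]
    simp only [← hevdef] at h3 ⊢
    linarith

/-! ### Weierstrass division -/

open Topology Filter in
/-- Weierstrass division for real analytic germs. -/
theorem weierstrass_division {F : Type*} [NormedAddCommGroup F] [NormedSpace ℝ F]
    [FiniteDimensional ℝ F] {g : F × ℝ → ℝ} (hg : AnalyticAt ℝ g 0)
    (hne : ¬ ∀ᶠ t in 𝓝 (0 : ℝ), g (0, t) = 0) : ∃ d : ℕ, ∀ h : F × ℝ → ℝ, AnalyticAt ℝ h 0 →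
    ∃ (q : F × ℝ → ℝ) (r : Fin d → F → ℝ), AnalyticAt ℝ q 0 ∧ (∀ j, AnalyticAt ℝ (r j) 0) ∧
      ∀ᶠ z in 𝓝 (0 : F × ℝ), h z = q z * g z + ∑ j, r j z.1 * z.2 ^ (j : ℕ) := by
  classical
  obtain ⟨p, hp⟩ := hg
  have hex : ∃ k, p k (fun _ => (0, 1)) ≠ 0 := by
    by_contra! hz
    refine hne ?_
    have hc : Tendsto (fun t : ℝ => ((0 : F), t)) (𝓝 0) (𝓝 0) := by
      have : Continuous (fun t : ℝ => ((0 : F), t)) := by fun_prop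
      exact this.tendsto 0
    filter_upwards [hc.eventually hp.eventually_hasSum] with t ht
    have h1 : ∀ n, p n (fun _ => ((0 : F), t)) = 0 := fun n => by
      have := (p n).map_smul_univ (fun _ => t) (fun _ => ((0 : F), (1 : ℝ)))
      simp only [Prod.smul_mk, smul_zero, smul_eq_mul, mul_one, hz] at this
      rw [this, mul_zero]
    simp only [h1, zero_add] at ht
    exact ht.unique hasSum_zero
  set d := Nat.find hex
  set c := p d (fun _ => ((0 : F), (1 : ℝ))) with hc
  have hc0 : c ≠ 0 := Nat.find_spec hex
  refine ⟨d, fun h hh => ?_⟩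
  have hp' : HasFPowerSeriesAt (c⁻¹ • g) (c⁻¹ • p) 0 := hp.const_smul
  obtain ⟨q, r, hq, hr, he⟩ := weierstrass_division_aux hp' d
    (fun k hk => by
      have := not_not.1 (Nat.find_min hex hk)
      simp [this])
    (by
      change c⁻¹ * c = 1
      exact inv_mul_cancel₀ hc0) hh
  refine ⟨fun z => q z * c⁻¹, r, hq.mul analyticAt_const, hr, ?_⟩
  filter_upwards [he] with z hz
  rw [hz]
  simp [mul_assoc]

theorem Derivation.exists_extension_of_formallyEtale {k R M : Type*} [CommRing k] [CommRing R]
    [CommRing M] [Algebra k R] [Algebra k M] [Algebra R M] [IsScalarTower k R M]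
    [Algebra.FormallyEtale R M] (d : Derivation k R M) :
    ∃ D : Derivation k M M, ∀ r, D (algebraMap R M r) = d r := by
  let f : TensorProduct R M (Ω[R⁄k]) →ₗ[M] M := d.liftKaehlerDifferential.liftBaseChange M
  let g : Ω[M⁄k] →ₗ[M] M := f ∘ₗ
    (KaehlerDifferential.tensorKaehlerEquivOfFormallyEtale k R M).symm.toLinearMap
  refine ⟨g.compDer (KaehlerDifferential.D k M), fun r => ?_⟩
  simp [g, f, KaehlerDifferential.tensorKaehlerEquivOfFormallyEtale_symm_D_algebraMap]

theorem Algebra.FormallyEtale.of_isAlgebraic_of_charZero {R M : Type*} [CommRing R] [IsDomain R]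
    [CharZero R] [Field M] [Algebra R M] [FaithfulSMul R M] [Algebra.IsAlgebraic R M] :
    Algebra.FormallyEtale R M := by
  let K := FractionRing R
  let _ : Algebra K M := FractionRing.liftAlgebra R M
  have : IsScalarTower R K M := FractionRing.isScalarTower_liftAlgebra R M
  have : Algebra.IsAlgebraic K M := IsFractionRing.comap_isAlgebraic_iff.1 ‹Algebra.IsAlgebraic R M›
  have : CharZero K := charZero_of_injective_algebraMap (IsFractionRing.injective R K)
  have : Algebra.FormallyEtale R K := Algebra.FormallyEtale.of_isLocalization (nonZeroDivisors R)
  have : Algebra.FormallyEtale K M := Algebra.FormallyEtale.of_isSeparable K M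
  exact Algebra.FormallyEtale.comp R K M

open Topology Filter

/-! ### Analytic functions near critical points -/

/-- The algebra of functions which are analytic at the origin. -/
def analyticAtZero (E : Type*) [NormedAddCommGroup E] [NormedSpace ℝ E] :
    Subalgebra ℝ (E → ℝ) where
  carrier := {a | AnalyticAt ℝ a 0}
  mul_mem' ha hb := AnalyticAt.mul ha hb
  add_mem' ha hb := AnalyticAt.add ha hb
  algebraMap_mem' _ := analyticAt_const

section analyticAtZero

variable {E : Type*} [NormedAddCommGroup E] [NormedSpace ℝ E]

theorem analyticAtZero.analyticAt (a : analyticAtZero E) : AnalyticAt ℝ a.1 0 := a.2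

/-- The directional derivative of a function analytic at the origin. -/
def analyticAtZero.deriv (e : E) (a : analyticAtZero E) : analyticAtZero E :=
  ⟨fun x => fderiv ℝ a.1 x e,
    ((ContinuousLinearMap.apply ℝ ℝ e).analyticAt _).comp (analyticAtZero.analyticAt a).fderiv⟩

/-- Composition with a continuous linear map. -/
def analyticAtZero.pullback {E' : Type*} [NormedAddCommGroup E'] [NormedSpace ℝ E']
    (L : E →L[ℝ] E') : analyticAtZero E' →ₐ[ℝ] analyticAtZero E where
  toFun a := ⟨a.1 ∘ L, AnalyticAt.comp (by rw [map_zero]; exact a.2) (L.analyticAt 0)⟩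
  map_one' := rfl
  map_mul' _ _ := rfl
  map_zero' := rfl
  map_add' _ _ := rfl
  commutes' _ := rfl

variable {M : Type*} [Field M] [Algebra ℝ M]

/-- A homomorphism which only depends on germs at the origin. -/
def RespectsGerms (π : analyticAtZero E →ₐ[ℝ] M) : Prop :=
  ∀ a b : analyticAtZero E, a.1 =ᶠ[𝓝 0] b.1 → π a = π b

/-- A derivation which is given on analytic functions by a vector field. -/
def IsVectorField (π : analyticAtZero E →ₐ[ℝ] M) (D : Derivation ℝ M M) : Prop :=
  ∃ (n : ℕ) (w : Fin n → M) (e : Fin n → E), ∀ a, D (π a) = ∑ i, w i * π (analyticAtZero.deriv (e i) a)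

theorem analyticAtZero.eventually_differentiableAt (a : analyticAtZero E) :
    ∀ᶠ x in 𝓝 0, DifferentiableAt ℝ a.1 x :=
  (analyticAtZero.analyticAt a).eventually_analyticAt.mono fun _ h => h.differentiableAt

/-- A directional derivative followed by a homomorphism to a field. -/
def RespectsGerms.derivLinear {π : analyticAtZero E →ₐ[ℝ] M} (hπ : RespectsGerms π) (e : E) :
    analyticAtZero E →ₗ[ℝ] M where
  toFun a := π (analyticAtZero.deriv e a)
  map_add' a b := by
    rw [← map_add]
    refine hπ _ _ ?_
    filter_upwards [(analyticAtZero.eventually_differentiableAt a), (analyticAtZero.eventually_differentiableAt b)] with x ha hb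
    have h := fderiv_add ha hb
    exact DFunLike.congr_fun h e
  map_smul' c a := by
    rw [RingHom.id_apply, ← map_smul]
    refine hπ _ _ ?_
    filter_upwards [(analyticAtZero.eventually_differentiableAt a)] with x ha
    have h := fderiv_const_smul ha c
    exact DFunLike.congr_fun h e

theorem RespectsGerms.derivLinear_mul {π : analyticAtZero E →ₐ[ℝ] M} (hπ : RespectsGerms π)
    (e : E) (a b : analyticAtZero E) : hπ.derivLinear e (a * b) =
      π a * hπ.derivLinear e b + π b * hπ.derivLinear e a := by
  change π _ = π a * π _ + π b * π _
  rw [← map_mul, ← map_mul, ← map_add]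
  refine hπ _ _ ?_
  filter_upwards [(analyticAtZero.eventually_differentiableAt a), (analyticAtZero.eventually_differentiableAt b)] with x ha hb
  have h := fderiv_mul ha hb
  exact DFunLike.congr_fun h e

theorem RespectsGerms.derivLinear_congr {π : analyticAtZero E →ₐ[ℝ] M} (hπ : RespectsGerms π)
    (e : E) {a b : analyticAtZero E} (h : a.1 =ᶠ[𝓝 0] b.1) :
    hπ.derivLinear e a = hπ.derivLinear e b := by
  refine hπ _ _ ?_
  filter_upwards [h.eventuallyEq_nhds] with x hx
  exact DFunLike.congr_fun hx.fderiv_eq e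

theorem RespectsGerms.apply_zero_of_eq_zero {π : analyticAtZero E →ₐ[ℝ] M} (hπ : RespectsGerms π)
    {a : analyticAtZero E} (ha : π a = 0) : a.1 0 = 0 := by
  by_contra h0
  let b : analyticAtZero E := ⟨fun x => (a.1 x)⁻¹, (analyticAtZero.analyticAt a).inv h0⟩
  have h1 : π (a * b) = π 1 := by
    refine hπ _ _ ?_
    filter_upwards [(analyticAtZero.analyticAt a).continuousAt.eventually_ne h0] with x hx
    exact mul_inv_cancel₀ hx
  rw [map_mul, ha, zero_mul, map_one] at h1
  exact zero_ne_one h1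

end analyticAtZero

section identity

variable {E : Type*} [NormedAddCommGroup E] [NormedSpace ℝ E]

theorem exists_eventually_eq_const_mul [FiniteDimensional ℝ E] {a b : E → ℝ}
    (ha : AnalyticAt ℝ a 0) (hb : AnalyticAt ℝ b 0) (hne : ¬ b =ᶠ[𝓝 0] 0)
    (h : ∀ e : E, (fun x => b x * fderiv ℝ a x e) =ᶠ[𝓝 0] fun x => a x * fderiv ℝ b x e) :
    ∃ c : ℝ, a =ᶠ[𝓝 0] fun x => c * b x := by
  let bas := Module.finBasis ℝ E
  have h' : ∀ᶠ x in 𝓝 0, ∀ i, b x * fderiv ℝ a x (bas i) = a x * fderiv ℝ b x (bas i) :=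
    eventually_all.2 fun i => h (bas i)
  obtain ⟨r, hr, hball⟩ := Metric.eventually_nhds_iff_ball.1
    ((ha.eventually_analyticAt.and hb.eventually_analyticAt).and h')
  obtain ⟨x₀, hx₀, hbx⟩ : ∃ x₀ ∈ Metric.ball (0 : E) r, b x₀ ≠ 0 := by
    by_contra! hz
    exact hne (Metric.eventually_nhds_iff_ball.2 ⟨r, hr, hz⟩)
  refine ⟨a x₀ / b x₀, ?_⟩
  set c := a x₀ / b x₀
  have hnear : ∀ᶠ x in 𝓝 x₀, b x ≠ 0 ∧ x ∈ Metric.ball (0 : E) r :=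
    ((hball x₀ hx₀).1.2.continuousAt.eventually_ne hbx).and (Metric.isOpen_ball.mem_nhds hx₀)
  obtain ⟨s, hs, hsball⟩ := Metric.eventually_nhds_iff_ball.1 hnear
  have hconst : ∀ x ∈ Metric.ball x₀ s, a x / b x = c := by
    intro x hx
    have hd : ∀ y ∈ Metric.ball x₀ s, HasFDerivAt (fun y => a y / b y) (0 : E →L[ℝ] ℝ) y := by
      intro y hy
      obtain ⟨hy1, hy2⟩ := hsball y hy
      obtain ⟨⟨hya, hyb⟩, hyd⟩ := hball y hy2
      have hA := hya.differentiableAt.hasFDerivAt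
      have hB := hyb.differentiableAt.hasFDerivAt
      have := hA.mul ((hasDerivAt_inv hy1).comp_hasFDerivAt y hB)
      convert! this using 1
      refine (ContinuousLinearMap.coe_inj.1 (bas.ext fun i => ?_)).symm
      have := hyd i
      simp
      field_simp
      linarith
    exact (convex_ball x₀ s).is_const_of_fderivWithin_eq_zero (𝕜 := ℝ)
      (f := fun y => a y / b y)
      (fun y hy => (hd y hy).differentiableAt.differentiableWithinAt)
      (fun y hy => by
        rw [fderivWithin_of_isOpen Metric.isOpen_ball hy]
        exact (hd y hy).fderiv) hx (Metric.mem_ball_self hs)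
  have hz : ∀ᶠ x in 𝓝 x₀, (fun x => a x - c * b x) x = 0 := by
    filter_upwards [Metric.ball_mem_nhds x₀ hs] with x hx
    rw [← hconst x hx, div_mul_cancel₀ _ (hsball x hx).1, sub_self]
  have han : AnalyticOnNhd ℝ (fun x => a x - c * b x) (Metric.ball 0 r) := fun x hx =>
    (hball x hx).1.1.sub (analyticAt_const.mul (hball x hx).1.2)
  have := han.eqOn_zero_of_preconnected_of_eventuallyEq_zero (convex_ball 0 r).isPreconnected hx₀ hz
  filter_upwards [Metric.ball_mem_nhds 0 hr] with x hx
  exact sub_eq_zero.1 (this hx)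

theorem exists_line_not_eventually_zero {a : E → ℝ} (ha : AnalyticAt ℝ a 0)
    (hne : ¬ a =ᶠ[𝓝 0] 0) : ∃ v : E, ¬ ∀ᶠ t : ℝ in 𝓝 0, a (t • v) = 0 := by
  by_contra! hz
  refine hne ?_
  obtain ⟨r, hr, hball⟩ := Metric.eventually_nhds_iff_ball.1 ha.eventually_analyticAt
  filter_upwards [Metric.ball_mem_nhds 0 hr] with x hx
  have han : AnalyticOnNhd ℝ (fun t : ℝ => a (t • x)) (Set.Icc 0 1) := by
    intro t ht
    have h1 : AnalyticAt ℝ (fun t : ℝ => t • x) t := analyticAt_id.smul analyticAt_const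
    refine AnalyticAt.comp (g := a) (hball _ ?_) h1
    rw [mem_ball_zero_iff] at hx ⊢
    rw [norm_smul, Real.norm_of_nonneg ht.1]
    exact (mul_le_of_le_one_left (norm_nonneg _) ht.2).trans_lt hx
  have := han.eqOn_zero_of_preconnected_of_eventuallyEq_zero isPreconnected_Icc
    (Set.left_mem_Icc.2 zero_le_one) (hz x) (Set.right_mem_Icc.2 zero_le_one)
  simpa using this

end identity

section injective

variable {E : Type*} [NormedAddCommGroup E] [NormedSpace ℝ E]
  {M : Type*} [Field M] [Algebra ℝ M] {π : analyticAtZero E →ₐ[ℝ] M}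

theorem RespectsGerms.eventuallyEq_of_injective
    (hinj : ∀ a, π a = 0 → a.1 =ᶠ[𝓝 0] 0) {a b : analyticAtZero E} (h : π a = π b) :
    a.1 =ᶠ[𝓝 0] b.1 := by
  have h1 := hinj (a - b) (by rw [map_sub, h, sub_self])
  filter_upwards [h1] with x hx
  exact sub_eq_zero.1 hx

theorem RespectsGerms.exists_derivation (hπ : RespectsGerms π)
    [Algebra.IsAlgebraic π.range M] (hinj : ∀ a, π a = 0 → a.1 =ᶠ[𝓝 0] 0) (e : E) :
    ∃ D : Derivation ℝ M M, ∀ a, D (π a) = π (analyticAtZero.deriv e a) := by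
  have hex : ∀ r : π.range, ∃ a, π a = r := fun r => r.2
  choose s hs using hex
  have key : ∀ (r : π.range) (a), π a = r → hπ.derivLinear e (s r) = hπ.derivLinear e a :=
    fun r a ha => hπ.derivLinear_congr e
      (RespectsGerms.eventuallyEq_of_injective hinj ((hs r).trans ha.symm))
  let f : π.range →ₗ[ℝ] M :=
    { toFun := fun r => hπ.derivLinear e (s r)
      map_add' := fun r t => by
        rw [key (r + t) (s r + s t) (by simp [hs]), map_add]
      map_smul' := fun c r => by
        rw [key (c • r) (c • s r) (by simp [hs]), map_smul, RingHom.id_apply] }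
  let d : Derivation ℝ π.range M := Derivation.mk' f fun r t => by
    change hπ.derivLinear e (s (r * t)) = _
    rw [key (r * t) (s r * s t) (by simp [hs]), hπ.derivLinear_mul, hs, hs]
    rfl
  have hR : CharZero π.range := charZero_of_injective_algebraMap (algebraMap ℝ π.range).injective
  have := Algebra.FormallyEtale.of_isAlgebraic_of_charZero (R := π.range) (M := M)
  obtain ⟨D, hD⟩ := d.exists_extension_of_formallyEtale
  refine ⟨D, fun a => ?_⟩
  have h1 := hD ⟨π a, a, rfl⟩
  have h2 : D (π a) = hπ.derivLinear e (s ⟨π a, a, rfl⟩) := h1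
  rw [h2, key _ a rfl]
  rfl

theorem RespectsGerms.isAlgebraic_of_injective [FiniteDimensional ℝ E] (hπ : RespectsGerms π)
    [Algebra.IsAlgebraic π.range M] (hinj : ∀ a, π a = 0 → a.1 =ᶠ[𝓝 0] 0) {c : M}
    (hc : ∀ D, IsVectorField π D → D c = 0) : IsAlgebraic ℝ c := by
  classical
  have hex : ∃ n, ∃ p : Polynomial π.range, p ≠ 0 ∧ Polynomial.aeval c p = 0 ∧ p.natDegree = n := by
    obtain ⟨p, hp, hp0⟩ := Algebra.IsAlgebraic.isAlgebraic (R := π.range) c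
    exact ⟨_, p, hp, hp0, rfl⟩
  obtain ⟨p, hp, hpc, hpn⟩ := Nat.find_spec hex
  have hmin : ∀ q : Polynomial π.range, Polynomial.aeval c q = 0 → q.natDegree ≤ Nat.find hex →
      q.coeff (Nat.find hex) = 0 → q = 0 := by
    intro q hq hdeg hcoef
    by_contra hne
    have h1 : Nat.find hex ≤ q.natDegree := Nat.find_min' hex ⟨q, hne, hq, rfl⟩
    have h2 := le_antisymm hdeg h1
    rw [← h2] at hcoef
    exact hne (Polynomial.leadingCoeff_eq_zero.1 hcoef)
  set n := Nat.find hex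
  have hsurj : ∀ r : π.range, ∃ a, π a = r := fun r => r.2
  choose s hs using hsurj
  have hpn0 : p.coeff n ≠ 0 := by
    rw [← hpn]
    exact Polynomial.leadingCoeff_ne_zero.2 hp
  have hcoef : ∀ (e : E) (i : ℕ), i ≤ n →
      π (s (p.coeff n)) * π (analyticAtZero.deriv e (s (p.coeff i))) =
      π (s (p.coeff i)) * π (analyticAtZero.deriv e (s (p.coeff n))) := by
    intro e i hi
    obtain ⟨D, hD⟩ := hπ.exists_derivation hinj e
    have hDc : D c = 0 := hc D ⟨1, fun _ => 1, fun _ => e, fun a => by simp [hD]⟩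
    let δ : π.range → π.range := fun r => ⟨π (analyticAtZero.deriv e (s r)), _, rfl⟩
    let q : Polynomial π.range := ∑ i ∈ Finset.range (n + 1), Polynomial.monomial i (δ (p.coeff i))
    have hqcoef : ∀ i ≤ n, q.coeff i = δ (p.coeff i) := by
      intro i hi
      simp only [q, Polynomial.finsetSum_coeff, Polynomial.coeff_monomial]
      rw [Finset.sum_ite_eq' (Finset.range (n + 1)) i]
      simp [Nat.lt_succ_of_le hi]
    have hqdeg : q.natDegree ≤ n := by
      refine Polynomial.natDegree_sum_le_of_forall_le _ _ fun i hi => ?_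
      exact (Polynomial.natDegree_monomial_le _).trans (Nat.lt_succ_iff.1 (Finset.mem_range.1 hi))
    have hqc : Polynomial.aeval c q = 0 := by
      have h1 : D (Polynomial.aeval c p) = 0 := by rw [hpc, map_zero]
      rw [Polynomial.aeval_eq_sum_range, map_sum, hpn] at h1
      rw [← h1, map_sum]
      refine Finset.sum_congr rfl fun i _ => ?_
      have h2 : p.coeff i • c ^ i = π (s (p.coeff i)) * c ^ i := by rw [hs]; rfl
      have h3 : D (c ^ i) = 0 := by rw [Derivation.leibniz_pow, hDc]; simp
      rw [Polynomial.aeval_monomial, h2, Derivation.leibniz, h3, hD, smul_zero, zero_add,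
        smul_eq_mul, mul_comm]
      rfl
    have hz := hmin (Polynomial.C (p.coeff n) * q - Polynomial.C (q.coeff n) * p)
      (by simp [hpc, hqc])
      ((Polynomial.natDegree_sub_le _ _).trans (max_le
        ((Polynomial.natDegree_C_mul_le _ _).trans hqdeg)
        ((Polynomial.natDegree_C_mul_le _ _).trans hpn.le)))
      (by simp [mul_comm])
    have h4 := congrArg (fun f => f.coeff i) hz
    simp only [Polynomial.coeff_sub, Polynomial.coeff_C_mul, Polynomial.coeff_zero,
      hqcoef i hi, hqcoef n le_rfl] at h4
    have h5 := congrArg (Subtype.val) h4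
    simp only [Subalgebra.coe_sub, Subalgebra.coe_mul, Subalgebra.coe_zero, δ] at h5
    rw [hs, hs]
    linear_combination h5
  have hne : ¬ (s (p.coeff n)).1 =ᶠ[𝓝 0] 0 := by
    intro h
    have := hπ (s (p.coeff n)) 0 h
    rw [hs, map_zero] at this
    exact hpn0 (Subtype.ext this)
  have hlam : ∀ i, ∃ l : ℝ, i ≤ n → (p.coeff i : M) = algebraMap ℝ M l * (p.coeff n : M) := by
    intro i
    by_cases hi : i ≤ n
    · obtain ⟨l, hl⟩ := exists_eventually_eq_const_mul
        (analyticAtZero.analyticAt (s (p.coeff i))) (analyticAtZero.analyticAt (s (p.coeff n))) hne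
        fun e => RespectsGerms.eventuallyEq_of_injective hinj
          (a := s (p.coeff n) * analyticAtZero.deriv e (s (p.coeff i)))
          (b := s (p.coeff i) * analyticAtZero.deriv e (s (p.coeff n)))
          (by rw [map_mul, map_mul, hcoef e i hi])
      refine ⟨l, fun _ => ?_⟩
      have := hπ (s (p.coeff i)) (l • s (p.coeff n)) hl
      rwa [map_smul, hs, hs, Algebra.smul_def] at this
    · exact ⟨0, fun h => absurd h hi⟩
  choose l hl using hlam
  have hpnM : (p.coeff n : M) ≠ 0 := fun h => hpn0 (Subtype.ext h)
  let P : Polynomial ℝ := ∑ i ∈ Finset.range (n + 1), Polynomial.monomial i (l i)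
  refine ⟨P, ?_, ?_⟩
  · intro hP
    have h1 : P.coeff n = l n := by
      simp only [P, Polynomial.finsetSum_coeff, Polynomial.coeff_monomial]
      rw [Finset.sum_ite_eq' (Finset.range (n + 1)) n]
      simp
    rw [hP, Polynomial.coeff_zero] at h1
    have h2 := hl n le_rfl
    rw [← h1, map_zero, zero_mul] at h2
    exact hpnM h2
  · have h1 : Polynomial.aeval c P * (p.coeff n : M) = Polynomial.aeval c p := by
      rw [Polynomial.aeval_eq_sum_range (p := p), hpn, map_sum, Finset.sum_mul]
      refine Finset.sum_congr rfl fun i hi => ?_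
      have h2 : p.coeff i • c ^ i = (p.coeff i : M) * c ^ i := rfl
      rw [h2, hl i (Nat.lt_succ_iff.1 (Finset.mem_range.1 hi)), Polynomial.aeval_monomial]
      ring
    rw [hpc] at h1
    exact (mul_eq_zero.1 h1).resolve_right hpnM

end injective

section pullback

variable {E E' : Type*} [NormedAddCommGroup E] [NormedSpace ℝ E]
  [NormedAddCommGroup E'] [NormedSpace ℝ E'] {M : Type*} [Field M] [Algebra ℝ M]

theorem RespectsGerms.comp_pullback {π : analyticAtZero E →ₐ[ℝ] M} (hπ : RespectsGerms π)
    (L : E →L[ℝ] E') : RespectsGerms (π.comp (analyticAtZero.pullback L)) := by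
  intro a b h
  refine hπ _ _ ?_
  have h1 : Tendsto L (𝓝 0) (𝓝 0) := by simpa using L.continuous.tendsto 0
  exact h1.eventually h

theorem RespectsGerms.deriv_pullback {π : analyticAtZero E →ₐ[ℝ] M} (hπ : RespectsGerms π)
    (L : E →L[ℝ] E') (e : E) (a : analyticAtZero E') :
    π (analyticAtZero.deriv e (analyticAtZero.pullback L a)) =
      π (analyticAtZero.pullback L (analyticAtZero.deriv (L e) a)) := by
  refine hπ _ _ ?_
  have h1 : Tendsto L (𝓝 0) (𝓝 0) := by simpa using L.continuous.tendsto 0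
  filter_upwards [h1.eventually (analyticAtZero.eventually_differentiableAt a)] with x hx
  have h2 : HasFDerivAt (a.1 ∘ L) ((fderiv ℝ a.1 (L x)).comp L) x :=
    hx.hasFDerivAt.comp x L.hasFDerivAt
  exact DFunLike.congr_fun h2.fderiv e

theorem IsVectorField.of_comp_pullback_equiv {π : analyticAtZero E →ₐ[ℝ] M} (hπ : RespectsGerms π)
    (L : E ≃L[ℝ] E') {D : Derivation ℝ M M}
    (hD : IsVectorField (π.comp (analyticAtZero.pullback (L : E →L[ℝ] E'))) D) :
    IsVectorField π D := by
  obtain ⟨n, w, e, h⟩ := hD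
  refine ⟨n, w, fun i => L.symm (e i), fun a => ?_⟩
  have h1 : a = analyticAtZero.pullback (L : E →L[ℝ] E')
      (analyticAtZero.pullback (L.symm : E' →L[ℝ] E) a) := by
    refine Subtype.ext (funext fun x => ?_)
    change a.1 x = a.1 (L.symm (L x))
    rw [L.symm_apply_apply]
  have h2 := h (analyticAtZero.pullback (L.symm : E' →L[ℝ] E) a)
  conv_lhs => rw [h1]
  refine h2.trans (Finset.sum_congr rfl fun i _ => ?_)
  congr 1
  conv_rhs => rw [h1]
  rw [hπ.deriv_pullback]
  simp

theorem range_comp_pullback_equiv (π : analyticAtZero E →ₐ[ℝ] M) (L : E ≃L[ℝ] E') :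
    (π.comp (analyticAtZero.pullback (L : E →L[ℝ] E'))).range = π.range := by
  refine le_antisymm ?_ ?_
  · rintro _ ⟨a, rfl⟩
    exact ⟨_, rfl⟩
  · rintro _ ⟨a, rfl⟩
    refine ⟨analyticAtZero.pullback (L.symm : E' →L[ℝ] E) a, ?_⟩
    refine congrArg π (Subtype.ext (funext fun x => ?_))
    change a.1 (L.symm (L x)) = a.1 x
    rw [L.symm_apply_apply]

end pullback

section product

variable {F : Type*} [NormedAddCommGroup F] [NormedSpace ℝ F]
  {M : Type*} [Field M] [Algebra ℝ M] {π : analyticAtZero (F × ℝ) →ₐ[ℝ] M}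

/-- The last coordinate as an analytic function. -/
def analyticAtZero.last (F : Type*) [NormedAddCommGroup F] [NormedSpace ℝ F] :
    analyticAtZero (F × ℝ) := ⟨Prod.snd, analyticAt_snd⟩

/-- Functions which do not depend on the last coordinate. -/
abbrev analyticAtZero.pullFst (F : Type*) [NormedAddCommGroup F] [NormedSpace ℝ F] :
    analyticAtZero F →ₐ[ℝ] analyticAtZero (F × ℝ) :=
  analyticAtZero.pullback (ContinuousLinearMap.fst ℝ F ℝ)

theorem exists_weierstrass_polynomial [FiniteDimensional ℝ F] (hπ : RespectsGerms π)
    {g : analyticAtZero (F × ℝ)} (hg : π g = 0) (hne : ¬ ∀ᶠ t in 𝓝 (0 : ℝ), g.1 (0, t) = 0) :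
    ∃ (d : ℕ) (r : Fin d → analyticAtZero F),
      π (analyticAtZero.last F ^ d) =
        π (∑ j, analyticAtZero.pullFst F (r j) * analyticAtZero.last F ^ (j : ℕ)) := by
  obtain ⟨d, hd⟩ := weierstrass_division (analyticAtZero.analyticAt g) hne
  obtain ⟨q, r, hq, hr, h⟩ := hd _ (analyticAtZero.analyticAt (analyticAtZero.last F ^ d))
  refine ⟨d, fun j => ⟨r j, hr j⟩, ?_⟩
  have h1 := hπ (analyticAtZero.last F ^ d)
    (⟨q, hq⟩ * g + ∑ j, analyticAtZero.pullFst F ⟨r j, hr j⟩ * analyticAtZero.last F ^ (j : ℕ)) (by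
      filter_upwards [h] with z hz
      rw [hz]
      simp [analyticAtZero.last, analyticAtZero.pullback])
  rw [h1, map_add, map_mul, hg, mul_zero, zero_add]

open Polynomial in
theorem not_eventually_zero_of_weierstrass (d : ℕ) (r : Fin d → analyticAtZero F) :
    ¬ ∀ᶠ t in 𝓝 (0 : ℝ), (analyticAtZero.last F ^ d -
      ∑ j, analyticAtZero.pullFst F (r j) * analyticAtZero.last F ^ (j : ℕ)).1 (0, t) = 0 := by
  intro h
  let P : ℝ[X] := X ^ d - ∑ j : Fin d, C ((r j).1 0) * X ^ (j : ℕ)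
  have hP : P.Monic := monic_X_pow_sub (degree_sum_fin_lt _)
  have hev : ∀ᶠ t in 𝓝 (0 : ℝ), P.eval t = 0 := by
    filter_upwards [h] with t ht
    rw [← ht]
    simp [P, eval_finsetSum, analyticAtZero.last, analyticAtZero.pullback]
  have hinf : Set.Infinite {t : ℝ | P.IsRoot t} := by
    have : {t : ℝ | P.IsRoot t} ∈ 𝓝 (0 : ℝ) := hev
    exact infinite_of_mem_nhds 0 this
  exact hinf (P.finite_setOfPred_isRoot hP.ne_zero)

theorem isAlgebraic_range_comp_pullFst
    [Algebra.IsAlgebraic π.range M] {d : ℕ} {r : Fin d → analyticAtZero F}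
    (hW : π (analyticAtZero.last F ^ d) =
      π (∑ j, analyticAtZero.pullFst F (r j) * analyticAtZero.last F ^ (j : ℕ)))
    (hdiv : ∀ h : analyticAtZero (F × ℝ), ∃ (m : ℕ) (s : Fin m → analyticAtZero F),
      π h = π (∑ j, analyticAtZero.pullFst F (s j) * analyticAtZero.last F ^ (j : ℕ))) :
    Algebra.IsAlgebraic (π.comp (analyticAtZero.pullFst F)).range M := by
  set R' := (π.comp (analyticAtZero.pullFst F)).range with hR'
  let A := Subalgebra.algebraicClosure R' M
  have hmem : ∀ a, π (analyticAtZero.pullFst F a) ∈ A := fun a =>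
    A.algebraMap_mem (⟨π (analyticAtZero.pullFst F a), a, rfl⟩ : R')
  have hT : π (analyticAtZero.last F) ∈ A := by
    refine IsIntegral.isAlgebraic ?_
    let P : Polynomial R' := Polynomial.X ^ d - ∑ j : Fin d,
      Polynomial.C (⟨π (analyticAtZero.pullFst F (r j)), r j, rfl⟩ : R') * Polynomial.X ^ (j : ℕ)
    refine ⟨P, Polynomial.monic_X_pow_sub (Polynomial.degree_sum_fin_lt _), ?_⟩
    rw [map_pow, map_sum] at hW
    simp only [map_mul, map_pow] at hW
    simp only [P, Polynomial.eval₂_sub, Polynomial.eval₂_pow, Polynomial.eval₂_X,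
      Polynomial.eval₂_finsetSum, Polynomial.eval₂_mul, Polynomial.eval₂_C, hW]
    exact sub_self _
  have hle : ∀ h, π h ∈ A := by
    intro h
    obtain ⟨m, s, hs⟩ := hdiv h
    rw [hs, map_sum]
    refine A.sum_mem fun j _ => ?_
    rw [map_mul, map_pow]
    exact A.mul_mem (hmem _) (A.pow_mem hT _)
  refine ⟨fun m => ?_⟩
  obtain ⟨p, hp0, hp⟩ := Algebra.IsAlgebraic.isAlgebraic (R := π.range) m
  let i : π.range →+* A :=
    { toFun := fun x => ⟨x.1, by obtain ⟨_, a, rfl⟩ := x; exact hle a⟩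
      map_one' := rfl
      map_mul' := fun _ _ => rfl
      map_zero' := rfl
      map_add' := fun _ _ => rfl }
  have hi : Function.Injective i := fun x y hxy => Subtype.ext (congrArg (fun z : A => (z : M)) hxy)
  have hm : IsAlgebraic A m := by
    refine ⟨p.map i, (Polynomial.map_ne_zero_iff hi).2 hp0, ?_⟩
    rw [Polynomial.aeval_def, Polynomial.eval₂_map]
    exact hp
  exact hm.restrictScalars R'

theorem IsVectorField.of_comp_pullFst (hπ : RespectsGerms π) {d : ℕ} {r : Fin d → analyticAtZero F}
    (hW : π (analyticAtZero.last F ^ d) =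
      π (∑ j, analyticAtZero.pullFst F (r j) * analyticAtZero.last F ^ (j : ℕ)))
    (hdiv : ∀ h : analyticAtZero (F × ℝ), ∃ (q : analyticAtZero (F × ℝ)) (m : ℕ)
      (s : Fin m → analyticAtZero F), h.1 =ᶠ[𝓝 0] (q * (analyticAtZero.last F ^ d -
        ∑ j, analyticAtZero.pullFst F (r j) * analyticAtZero.last F ^ (j : ℕ)) +
        ∑ j, analyticAtZero.pullFst F (s j) * analyticAtZero.last F ^ (j : ℕ)).1)
    {D : Derivation ℝ M M} (hD : IsVectorField (π.comp (analyticAtZero.pullFst F)) D) :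
    IsVectorField π D := by
  obtain ⟨n, w, e, hD⟩ := hD
  let δ : analyticAtZero (F × ℝ) →ₗ[ℝ] M :=
    D.toLinearMap ∘ₗ π.toLinearMap - (∑ i, w i • hπ.derivLinear (e i, (0 : ℝ)) +
      D (π (analyticAtZero.last F)) • hπ.derivLinear ((0 : F), (1 : ℝ)))
  have hδ : ∀ a, δ a = D (π a) - (∑ i, w i * π (analyticAtZero.deriv (e i, (0 : ℝ)) a) +
      D (π (analyticAtZero.last F)) * π (analyticAtZero.deriv ((0 : F), (1 : ℝ)) a)) := by
    intro a
    simp [δ]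
    rfl
  have hmul : ∀ a b, δ (a * b) = π a * δ b + π b * δ a := by
    intro a b
    have h1 : ∀ v, π (analyticAtZero.deriv v (a * b)) = π a * π (analyticAtZero.deriv v b) +
      π b * π (analyticAtZero.deriv v a) := fun v => hπ.derivLinear_mul v a b
    simp only [hδ, h1, map_mul, Derivation.leibniz, smul_eq_mul, mul_add, Finset.sum_add_distrib]
    rw [mul_sub, mul_sub, mul_add, mul_add, Finset.mul_sum, Finset.mul_sum]
    have h2 : ∀ i, w i * (π a * π (analyticAtZero.deriv (e i, (0 : ℝ)) b)) =
      π a * (w i * π (analyticAtZero.deriv (e i, (0 : ℝ)) b)) := fun i => by ring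
    have h3 : ∀ i, w i * (π b * π (analyticAtZero.deriv (e i, (0 : ℝ)) a)) =
      π b * (w i * π (analyticAtZero.deriv (e i, (0 : ℝ)) a)) := fun i => by ring
    simp only [h2, h3]
    ring
  have hcongr : ∀ a b : analyticAtZero (F × ℝ), a.1 =ᶠ[𝓝 0] b.1 → δ a = δ b := by
    intro a b h
    have h1 : ∀ v, π (analyticAtZero.deriv v a) = π (analyticAtZero.deriv v b) :=
      fun v => hπ.derivLinear_congr v h
    simp only [hδ, h1, hπ a b h]
  have hfst : ∀ a, δ (analyticAtZero.pullFst F a) = 0 := by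
    intro a
    have h0 : ∀ b : analyticAtZero F, analyticAtZero.deriv (0 : F) b = 0 := by
      intro b
      refine Subtype.ext (funext fun x => ?_)
      simp [analyticAtZero.deriv]
    rw [hδ, hπ.deriv_pullback]
    have h1 := hD a
    simp only [AlgHom.comp_apply] at h1
    simp only [hπ.deriv_pullback, h1]
    simp [h0]
  have hlast : δ (analyticAtZero.last F) = 0 := by
    have h1 : ∀ v, analyticAtZero.deriv v (analyticAtZero.last F) =
        algebraMap ℝ _ v.2 := by
      intro v
      refine Subtype.ext (funext fun x => ?_)
      change fderiv ℝ Prod.snd x v = v.2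
      rw [fderiv_snd]
      rfl
    simp [hδ, h1]
  have hpow : ∀ k, δ (analyticAtZero.last F ^ k) = 0 := by
    intro k
    induction k with
    | zero =>
      have := hmul 1 1
      simp only [mul_one, map_one, one_mul] at this
      rw [pow_zero]
      linear_combination -this
    | succ k ih => rw [pow_succ, hmul, ih, hlast]; simp
  have hpoly : ∀ (m : ℕ) (s : Fin m → analyticAtZero F),
      δ (∑ j, analyticAtZero.pullFst F (s j) * analyticAtZero.last F ^ (j : ℕ)) = 0 := by
    intro m s
    rw [map_sum]
    exact Finset.sum_eq_zero fun j _ => by rw [hmul, hpow, hfst]; simp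
  have hzero : ∀ a, δ a = 0 := by
    intro a
    obtain ⟨q, m, s, h⟩ := hdiv a
    rw [hcongr _ _ h, map_add, hpoly, hmul, map_sub δ, hpow, hpoly, map_sub π, hW]
    simp
  refine ⟨n + 1, Fin.cons (D (π (analyticAtZero.last F))) w,
    Fin.cons ((0 : F), (1 : ℝ)) (fun i => (e i, (0 : ℝ))), fun a => ?_⟩
  have h1 := hzero a
  rw [hδ, sub_eq_zero] at h1
  rw [h1, Fin.sum_univ_succ]
  simp [add_comm]

end product

theorem RespectsGerms.isAlgebraic {M : Type*} [Field M] [Algebra ℝ M] {c : M} (n : ℕ) :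
    ∀ (E : Type) [NormedAddCommGroup E] [NormedSpace ℝ E] [FiniteDimensional ℝ E]
      (π : analyticAtZero E →ₐ[ℝ] M), Module.finrank ℝ E = n → RespectsGerms π →
      Algebra.IsAlgebraic π.range M → (∀ D, IsVectorField π D → D c = 0) → IsAlgebraic ℝ c := by
  induction n with
  | zero =>
    intro E _ _ _ π hn hπ _ hc
    refine hπ.isAlgebraic_of_injective (fun a ha => ?_) hc
    have := Module.finrank_zero_iff.1 hn
    refine Eventually.of_forall fun x => ?_
    rw [Subsingleton.elim x 0]
    exact hπ.apply_zero_of_eq_zero ha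
  | succ n ih =>
    intro E _ _ _ π hn hπ halg hc
    by_cases hinj : ∀ a, π a = 0 → a.1 =ᶠ[𝓝 0] 0
    · exact hπ.isAlgebraic_of_injective hinj hc
    push Not at hinj
    obtain ⟨a, ha, hne⟩ := hinj
    obtain ⟨v, hv⟩ := exists_line_not_eventually_zero (analyticAtZero.analyticAt a) hne
    have hv0 : v ≠ 0 := by
      rintro rfl
      exact hv (Eventually.of_forall fun t => by
        rw [smul_zero]; exact hπ.apply_zero_of_eq_zero ha)
    obtain ⟨F, hF⟩ := Submodule.exists_isCompl (Submodule.span ℝ {v})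
    let L₁ : (F × ℝ) ≃ₗ[ℝ] E :=
      ((LinearEquiv.refl ℝ F).prodCongr (LinearEquiv.toSpanNonzeroSingleton ℝ E v hv0)).trans
        (Submodule.prodEquivOfIsCompl F _ hF.symm)
    let L : E ≃L[ℝ] (F × ℝ) := L₁.symm.toContinuousLinearEquiv
    have hL : ∀ t : ℝ, L.symm ((0 : F), t) = t • v := by
      intro t
      change L₁ ((0 : F), t) = t • v
      simp [L₁]
    have hdim : Module.finrank ℝ F = n := by
      have h1 := L₁.finrank_eq
      rw [Module.finrank_prod, Module.finrank_self, hn] at h1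
      omega
    let π₁ := π.comp (analyticAtZero.pullback (L : E →L[ℝ] (F × ℝ)))
    have hπ₁ : RespectsGerms π₁ := hπ.comp_pullback _
    have halg₁ : Algebra.IsAlgebraic π₁.range M := by
      have := range_comp_pullback_equiv π L
      rw [this]
      exact halg
    let g := analyticAtZero.pullback (L.symm : (F × ℝ) →L[ℝ] E) a
    have hg : π₁ g = 0 := by
      rw [← ha]
      refine congrArg π (Subtype.ext (funext fun x => ?_))
      change a.1 (L.symm (L x)) = a.1 x
      rw [L.symm_apply_apply]
    have hgne : ¬ ∀ᶠ t in 𝓝 (0 : ℝ), g.1 (0, t) = 0 := by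
      intro h
      refine hv ?_
      filter_upwards [h] with t ht
      rw [← hL]
      exact ht
    obtain ⟨d, r, hW⟩ := exists_weierstrass_polynomial hπ₁ hg hgne
    obtain ⟨m, hm⟩ := weierstrass_division (analyticAtZero.analyticAt _)
      (not_eventually_zero_of_weierstrass d r)
    have hdiv : ∀ h : analyticAtZero (F × ℝ), ∃ (q : analyticAtZero (F × ℝ)) (m : ℕ)
        (s : Fin m → analyticAtZero F), h.1 =ᶠ[𝓝 0] (q * (analyticAtZero.last F ^ d -
        ∑ j, analyticAtZero.pullFst F (r j) * analyticAtZero.last F ^ (j : ℕ)) +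
        ∑ j, analyticAtZero.pullFst F (s j) * analyticAtZero.last F ^ (j : ℕ)).1 := by
      intro h
      obtain ⟨q, s, hq, hs, he⟩ := hm _ (analyticAtZero.analyticAt h)
      refine ⟨⟨q, hq⟩, m, fun j => ⟨s j, hs j⟩, ?_⟩
      filter_upwards [he] with z hz
      rw [hz]
      simp [analyticAtZero.last, analyticAtZero.pullback]
    refine ih F (π₁.comp (analyticAtZero.pullFst F)) hdim (hπ₁.comp_pullback _) ?_ ?_
    · refine isAlgebraic_range_comp_pullFst hW fun h => ?_
      obtain ⟨q, m, s, he⟩ := hdiv h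
      refine ⟨m, s, ?_⟩
      rw [hπ₁ _ _ he, map_add, map_mul, map_sub, hW]
      simp
    · intro D hD
      exact hc D (IsVectorField.of_comp_pullback_equiv hπ L
        (IsVectorField.of_comp_pullFst hπ₁ hW hdiv hD))

/-- An analytic function is locally constant on its set of critical points. -/
theorem AnalyticAt.eventually_eq_of_fderiv_eq_zero {E : Type} [NormedAddCommGroup E]
    [NormedSpace ℝ E] [FiniteDimensional ℝ E] {f : E → ℝ} (hf : AnalyticAt ℝ f 0) :
    ∀ᶠ x in 𝓝 0, fderiv ℝ f x = 0 → f x = f 0 := by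
  by_contra hne
  have hfr := Filter.not_eventually.1 hne
  obtain ⟨U, hU⟩ := Filter.exists_ultrafilter_iff.2 (Filter.frequently_iff_neBot.1 hfr)
  have hU0 : (U : Filter E) ≤ 𝓝 0 := hU.trans inf_le_left
  have hUs : ∀ᶠ x in (U : Filter E), ¬ (fderiv ℝ f x = 0 → f x = f 0) :=
    hU (mem_inf_of_right (mem_principal_self _))
  let L := Germ (U : Filter E) ℝ
  let _ : Algebra ℝ L := ((Germ.coeRingHom (U : Filter E)).comp (Pi.constRingHom E ℝ)).toAlgebra
  let π₀ : analyticAtZero E →ₐ[ℝ] L :=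
    { toRingHom := (Germ.coeRingHom (U : Filter E)).comp (analyticAtZero E).val.toRingHom
      commutes' := fun _ => rfl }
  let M := IntermediateField.adjoin ℝ (π₀.range : Set L)
  let π : analyticAtZero E →ₐ[ℝ] M := π₀.codRestrict M.toSubalgebra
    fun a => IntermediateField.subset_adjoin ℝ _ ⟨a, rfl⟩
  have hval : ∀ a, ((π a : M) : L) = ((a.1 : E → ℝ) : Germ (U : Filter E) ℝ) := fun _ => rfl
  have hcongr : ∀ a b : analyticAtZero E, a.1 =ᶠ[(U : Filter E)] b.1 → π a = π b := fun a b h =>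
    Subtype.ext (by rw [hval, hval]; exact Germ.coe_eq.2 h)
  have hπ : RespectsGerms π := fun a b h => hcongr a b (h.filter_mono hU0)
  have halg : Algebra.IsAlgebraic π.range M := by
    refine ⟨fun m => ?_⟩
    obtain ⟨x, hx, y, hy, hxy⟩ := (IntermediateField.mem_adjoin_iff_div).1 m.2
    rw [Algebra.adjoin_eq] at hx hy
    obtain ⟨a, rfl⟩ := hx
    obtain ⟨b, rfl⟩ := hy
    replace hxy : (m : L) = π₀ a / π₀ b := hxy
    by_cases hb : π b = 0
    · have : m = 0 := by
        refine Subtype.ext ?_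
        have hb' : π₀ b = 0 := congrArg Subtype.val hb
        rw [hxy, hb', div_zero]
        rfl
      rw [this]
      exact isAlgebraic_zero
    · refine ⟨Polynomial.C (⟨π b, b, rfl⟩ : π.range) * Polynomial.X -
        Polynomial.C (⟨π a, a, rfl⟩ : π.range), ?_, ?_⟩
      · intro h0
        have h1 := congrArg (fun p => p.coeff 1) h0
        simp only [Polynomial.coeff_sub, Polynomial.coeff_C_mul, Polynomial.coeff_X_one, mul_one,
          Polynomial.coeff_C_succ, sub_zero, Polynomial.coeff_zero] at h1
        exact hb (congrArg Subtype.val h1)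
      · have h1 : π b * m = π a := by
          refine Subtype.ext ?_
          have hb' : π₀ b ≠ 0 := fun h => hb (Subtype.ext h)
          change π₀ b * (m : L) = π₀ a
          rw [hxy]
          exact mul_div_cancel₀ _ hb'
        simp only [map_sub, map_mul, Polynomial.aeval_C, Polynomial.aeval_X]
        exact sub_eq_zero.2 h1
  let f' : analyticAtZero E := ⟨f, hf⟩
  have hkill : ∀ D, IsVectorField π D → D (π f') = 0 := by
    rintro D ⟨n, w, e, hD⟩
    rw [hD]
    refine Finset.sum_eq_zero fun i _ => ?_
    have : π (analyticAtZero.deriv (e i) f') = π 0 := by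
      refine hcongr _ _ ?_
      filter_upwards [hUs] with x hx
      push Not at hx
      change fderiv ℝ f x (e i) = 0
      rw [hx.1]
      rfl
    rw [this, map_zero, mul_zero]
  obtain ⟨P, hP, hPf⟩ := RespectsGerms.isAlgebraic _ E π rfl hπ halg hkill
  have hroot : ∀ᶠ x in (U : Filter E), P.IsRoot (f x) := by
    have h1 : π (Polynomial.aeval f' P) = π 0 := by
      rw [← Polynomial.aeval_algHom_apply, hPf, map_zero]
    have h2 := congrArg (fun m : M => (m : L)) h1
    simp only [hval] at h2
    have h3 := Germ.coe_eq.1 h2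
    filter_upwards [h3] with x hx
    let ev : analyticAtZero E →ₐ[ℝ] ℝ := (Pi.evalAlgHom ℝ (fun _ : E => ℝ) x).comp (analyticAtZero E).val
    have h4 : ev (Polynomial.aeval f' P) = 0 := hx
    rw [← Polynomial.aeval_algHom_apply] at h4
    have h5 : ev f' = f x := rfl
    rw [h5] at h4
    simpa [Polynomial.IsRoot, Polynomial.aeval_def] using h4
  have hfin : ({y : ℝ | P.IsRoot y} \ {f 0}).Finite :=
    (P.finite_setOfPred_isRoot hP).subset Set.sdiff_subset
  have hnhd : ({y : ℝ | P.IsRoot y} \ {f 0})ᶜ ∈ 𝓝 (f 0) :=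
    hfin.isClosed.isOpen_compl.mem_nhds (by simp)
  have hlim : ∀ᶠ x in (U : Filter E), f x ∈ ({y : ℝ | P.IsRoot y} \ {f 0})ᶜ :=
    hU0 (hf.continuousAt hnhd)
  obtain ⟨x, hx1, hx2, hx3⟩ := (hUs.and (hroot.and hlim)).exists
  push Not at hx1
  exact hx3 ⟨hx2, hx1.2⟩

open scoped ContDiff

/-! ### Finiteness of critical values on Hilbert spaces -/

section CriticalValues

variable {X Z : Type} [NormedAddCommGroup X] [InnerProductSpace ℝ X]
  [NormedAddCommGroup Z] [NormedSpace ℝ Z]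

/-- The real inner product as a continuous bilinear map. -/
def realInnerL : X →L[ℝ] X →L[ℝ] ℝ := innerSL ℝ

@[simp]
theorem realInnerL_apply (x y : X) : realInnerL x y = inner ℝ x y := rfl

theorem norm_realInnerL_apply (x : X) : ‖realInnerL x‖ = ‖x‖ := innerSL_apply_norm ℝ x

/-- A coercive bilinear form identifies a Hilbert space with its dual. -/
theorem IsCoercive.exists_equiv_dual [CompleteSpace X] {B : X →L[ℝ] X →L[ℝ] ℝ} (hB : IsCoercive B) :
    ∃ e : X ≃L[ℝ] (X →L[ℝ] ℝ), (e : X →L[ℝ] (X →L[ℝ] ℝ)) = B := by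
  have hinj : B.ker = ⊥ := by
    obtain ⟨c, hc, h⟩ := hB
    refine (Submodule.eq_bot_iff _).2 fun x hx => ?_
    have hx' : B x = 0 := hx
    have h1 := h x
    rw [hx'] at h1
    by_contra hne
    have : 0 < ‖x‖ := norm_pos_iff.2 hne
    have h2 : 0 < c * ‖x‖ * ‖x‖ := by positivity
    exact absurd h1 (not_le.2 (by simpa using h2))
  have hsurj : B.range = ⊤ := by
    refine LinearMap.range_eq_top.2 fun φ => ?_
    refine ⟨hB.continuousLinearEquivOfBilin.symm ((InnerProductSpace.toDual ℝ X).symm φ), ?_⟩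
    ext w
    have := hB.continuousLinearEquivOfBilin_apply
      (hB.continuousLinearEquivOfBilin.symm ((InnerProductSpace.toDual ℝ X).symm φ)) w
    rw [ContinuousLinearEquiv.apply_symm_apply] at this
    rw [InnerProductSpace.toDual_symm_apply] at this
    exact this.symm
  exact ⟨ContinuousLinearEquiv.ofBijective B hinj hsurj, by ext; rfl⟩

/-- Lyapunov–Schmidt reduction: an analytic function whose Hessian is coercive up to a finite
rank correction is locally constant on its critical set. -/
theorem eventually_eq_of_fderiv_eq_zero_of_isCoercive [CompleteSpace X] {E : X → ℝ} (hE : ContDiff ℝ ω E) {u₀ : X}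
    (hu₀ : fderiv ℝ E u₀ = 0) (V : Submodule ℝ X) [FiniteDimensional ℝ V] (c : ℝ)
    (hB : IsCoercive (fderiv ℝ (fderiv ℝ E) u₀ + c • realInnerL.comp V.starProjection)) :
    ∀ᶠ u in 𝓝 u₀, fderiv ℝ E u = 0 → E u = E u₀ := by
  obtain ⟨L, hL⟩ : ∃ L : X →L[ℝ] X →L[ℝ] ℝ, L = c • realInnerL.comp V.starProjection := ⟨_, rfl⟩
  rw [← hL] at hB
  obtain ⟨e, he⟩ := hB.exists_equiv_dual
  let Φ : X → (X →L[ℝ] ℝ) := fun u => fderiv ℝ E u + L (u - u₀)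
  have hE' : ContDiff ℝ ω (fderiv ℝ E) := hE.fderiv_right (by simp)
  have hΦ : ContDiff ℝ ω Φ := hE'.add (L.contDiff.comp (contDiff_id.sub contDiff_const))
  have hL' : HasFDerivAt (fun u => L (u - u₀)) L u₀ :=
    L.hasFDerivAt.comp u₀ ((hasFDerivAt_id u₀).sub_const u₀)
  have hΦ' : HasFDerivAt Φ (e : X →L[ℝ] (X →L[ℝ] ℝ)) u₀ := by
    rw [he]
    exact ((hE'.differentiable (by simp)) u₀).hasFDerivAt.add hL'
  have hω : (ω : WithTop ℕ∞) ≠ 0 := by simp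
  have hΦ0 : Φ u₀ = 0 := by simp [Φ, hu₀]
  let Ψ := hΦ.contDiffAt.localInverse hΦ' hω
  have hΨ : ContDiffAt ℝ ω Ψ (Φ u₀) := hΦ.contDiffAt.to_localInverse hΦ' hω
  have hleft : ∀ᶠ u in 𝓝 u₀, Ψ (Φ u) = u :=
    (hΦ.contDiffAt.hasStrictFDerivAt' hΦ' hω).eventually_left_inverse
  have hΨ0 : Ψ 0 = u₀ := by rw [← hΦ0]; exact hleft.self_of_nhds
  rw [hΦ0] at hΨ
  let j : V →L[ℝ] (X →L[ℝ] ℝ) := c • realInnerL.comp V.subtypeL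
  let f : V → ℝ := fun y => E (Ψ (j y))
  have hΨj : ContDiffAt ℝ ω (fun y => Ψ (j y)) 0 :=
    ContDiffAt.comp (0 : V) (by rw [map_zero]; exact hΨ) j.contDiff.contDiffAt
  have hf : AnalyticAt ℝ f 0 := (hE.contDiffAt.comp (0 : V) hΨj).analyticAt
  have hdiff : ∀ᶠ y in 𝓝 (0 : V), DifferentiableAt ℝ (fun y => Ψ (j y)) y := by
    filter_upwards [(hΨj.analyticAt).eventually_analyticAt] with y hy using hy.differentiableAt
  let p : X → V := fun u => V.orthogonalProjectionOnto (u - u₀)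
  have hp : Tendsto p (𝓝 u₀) (𝓝 0) := by
    have : Continuous p := V.orthogonalProjectionOnto.continuous.comp (continuous_id.sub continuous_const)
    have h := this.tendsto u₀
    simpa [p] using h
  have hjp : ∀ u, j (p u) = L (u - u₀) := fun u => by rw [hL]; rfl
  filter_upwards [hp.eventually hf.eventually_eq_of_fderiv_eq_zero, hp.eventually hdiff, hleft]
    with u h1 h2 h3 hu
  have h4 : Ψ (j (p u)) = u := by
    rw [hjp]
    have : Φ u = L (u - u₀) := by simp [Φ, hu]
    rw [← this, h3]
  have h5 : fderiv ℝ f (p u) = 0 := by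
    have h6 := (((hE.differentiable hω) (Ψ (j (p u)))).hasFDerivAt.comp (p u) h2.hasFDerivAt).fderiv
    rw [h4, hu] at h6
    exact h6.trans (ContinuousLinearMap.zero_comp _)
  have h6 := h1 h5
  simp only [f, h4, map_zero, hΨ0] at h6
  exact h6

/-- An operator which is small on subspaces of finite codimension is compact. -/
theorem isCompactOperator_of_forall_small_orthogonal [CompleteSpace X] [CompleteSpace Z] (K : X →L[ℝ] Z)
    (hK : ∀ ε > 0, ∃ V : Submodule ℝ X, FiniteDimensional ℝ V ∧ ∀ v ∈ Vᗮ, ‖K v‖ ≤ ε * ‖v‖) :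
    IsCompactOperator K := by
  have hcl : IsClosed {f : X →L[ℝ] Z | IsCompactOperator f} := isClosed_setOfPred_isCompactOperator
  refine hcl.closure_subset_iff.2 subset_rfl (Metric.mem_closure_iff.2 fun ε hε => ?_)
  obtain ⟨V, hV, h⟩ := hK (ε / 2) (half_pos hε)
  refine ⟨K.comp V.starProjection, ?_, ?_⟩
  · have h1 : IsCompactOperator (V.subtypeL : V → X) :=
      have := FiniteDimensional.proper_real V
      isCompactOperator_of_locallyCompactSpace_rng (ContinuousLinearMap.id ℝ V) |>.clm_comp V.subtypeL
    exact (h1.clm_comp K).comp_clm V.orthogonalProjectionOnto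
  · rw [dist_eq_norm]
    refine lt_of_le_of_lt (ContinuousLinearMap.opNorm_le_bound _ (half_pos hε).le fun v => ?_)
      (half_lt_self hε)
    have h2 : (K - K.comp V.starProjection) v = K (v - V.starProjection v) := by simp
    rw [h2]
    refine (h _ (V.sub_starProjection_mem_orthogonal v)).trans ?_
    gcongr
    rw [← Submodule.starProjection_orthogonal_val]
    exact Submodule.norm_starProjection_apply_le _ _

variable (K : X →L[ℝ] Z) (G : Z → X) (M : Z → ℝ)

/-- The part of the differential factoring through `K`. -/
def reducedDifferential (u : X) : Z →L[ℝ] ℝ :=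
  (realInnerL u).comp (fderiv ℝ G (K u)) + fderiv ℝ M (K u)

variable {K G M} {E : X → ℝ}

theorem hasFDerivAt_of_quadratic_add (hG : ContDiff ℝ ω G) (hM : ContDiff ℝ ω M)
    (hE : ∀ u, E u = 1 / 2 * ‖u‖ ^ 2 + inner ℝ u (G (K u)) + M (K u)) (u : X) :
    HasFDerivAt E (realInnerL u + realInnerL (G (K u)) + (reducedDifferential K G M u).comp K) u := by
  have hG' : HasFDerivAt (fun u => G (K u)) ((fderiv ℝ G (K u)).comp K) u :=
    ((hG.differentiable (by simp)) (K u)).hasFDerivAt.comp u K.hasFDerivAt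
  have hM' : HasFDerivAt (fun u => M (K u)) ((fderiv ℝ M (K u)).comp K) u :=
    ((hM.differentiable (by simp)) (K u)).hasFDerivAt.comp u K.hasFDerivAt
  have h1 := (((hasStrictFDerivAt_norm_sq u).hasFDerivAt.const_mul (1 / 2 : ℝ)).add
    ((hasFDerivAt_id u).inner ℝ hG')).add hM'
  rw [show E = fun u => 1 / 2 * ‖u‖ ^ 2 + inner ℝ u (G (K u)) + M (K u) from funext hE]
  refine h1.congr_fderiv ?_
  ext v
  simp [reducedDifferential, real_inner_comm]
  ring

/-- The critical points in a ball form a compact set. -/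
theorem isCompact_criticalPoints [CompleteSpace X] [CompleteSpace Z] (hG : ContDiff ℝ ω G) (hM : ContDiff ℝ ω M)
    (hK : IsCompactOperator K)
    (hE : ∀ u, E u = 1 / 2 * ‖u‖ ^ 2 + inner ℝ u (G (K u)) + M (K u)) (r : ℝ) :
    IsCompact {u | fderiv ℝ E u = 0 ∧ ‖u‖ ≤ r} := by
  have hEc : ContDiff ℝ ω E := by
    rw [show E = fun u => 1 / 2 * ‖u‖ ^ 2 + inner ℝ u (G (K u)) + M (K u) from funext hE]
    exact ((contDiff_const.mul (contDiff_norm_sq ℝ)).add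
      (contDiff_id.inner ℝ (hG.comp K.contDiff))).add (hM.comp K.contDiff)
  have hclosed : IsClosed {u | fderiv ℝ E u = 0 ∧ ‖u‖ ≤ r} :=
    (isClosed_eq (hEc.continuous_fderiv (by simp)) continuous_const).inter
      (isClosed_le continuous_norm continuous_const)
  have hcrit : ∀ u, fderiv ℝ E u = 0 → ∀ v,
      inner ℝ u v = - inner ℝ (G (K u)) v - reducedDifferential K G M u (K v) := by
    intro u hu v
    have h1 := (hasFDerivAt_of_quadratic_add hG hM hE u).fderiv
    rw [hu] at h1
    have h2 := congrArg (fun φ => φ v) h1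
    simp at h2
    linarith
  refine IsSeqCompact.isCompact fun u hu => ?_
  have hKc : IsCompact (closure (K '' Metric.closedBall 0 r)) :=
    hK.isCompact_closure_image_closedBall r
  obtain ⟨z, -, φ, hφ, hz⟩ := hKc.isSeqCompact (x := fun n => K (u n)) fun n =>
    subset_closure ⟨u n, by simpa using (hu n).2, rfl⟩
  have hr0 : 0 ≤ r := (norm_nonneg _).trans (hu 0).2
  have hGz : Tendsto (fun n => G (K (u (φ n)))) atTop (𝓝 (G z)) := (hG.continuous.tendsto z).comp hz
  obtain ⟨C, hC⟩ : ∃ C, ∀ n, ‖reducedDifferential K G M (u (φ n))‖ ≤ C := by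
    have h1 : Tendsto (fun n => r * ‖fderiv ℝ G (K (u (φ n)))‖ + ‖fderiv ℝ M (K (u (φ n)))‖) atTop
        (𝓝 (r * ‖fderiv ℝ G z‖ + ‖fderiv ℝ M z‖)) :=
      ((((hG.continuous_fderiv (by simp)).tendsto z).comp hz).norm.const_mul r).add
        (((hM.continuous_fderiv (by simp)).tendsto z).comp hz).norm
    obtain ⟨C, hC⟩ := h1.bddAbove_range
    refine ⟨C, fun n => le_trans ?_ (hC ⟨n, rfl⟩)⟩
    refine (norm_add_le _ _).trans (add_le_add_left ?_ _)
    refine (ContinuousLinearMap.opNorm_comp_le _ _).trans ?_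
    gcongr
    rw [norm_realInnerL_apply]
    exact (hu _).2
  have hcauchy : CauchySeq (u ∘ φ) := by
    rw [Metric.cauchySeq_iff']
    have hGc := Metric.cauchySeq_iff'.1 hGz.cauchySeq
    intro ε hε
    have hC0 : 0 ≤ C := (norm_nonneg _).trans (hC 0)
    obtain ⟨N, hN⟩ := (Metric.cauchySeq_iff.1 hGz.cauchySeq) (ε / 2) (half_pos hε)
    obtain ⟨N', hN'⟩ := (Metric.cauchySeq_iff.1 hz.cauchySeq) (ε ^ 2 / (8 * (C + 1))) (by positivity)
    refine ⟨max N N', fun n hn => ?_⟩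
    have h1 := hN n ((le_max_left _ _).trans hn) _ (le_max_left N N')
    have h2 := hN' n ((le_max_right _ _).trans hn) _ (le_max_right N N')
    set m := max N N'
    rw [dist_eq_norm] at h1 h2 ⊢
    set w := (u ∘ φ) n - (u ∘ φ) m with hw
    have h3 : ‖w‖ ^ 2 = - inner ℝ (G (K (u (φ n))) - G (K (u (φ m)))) w -
        (reducedDifferential K G M (u (φ n)) (K w) - reducedDifferential K G M (u (φ m)) (K w)) := by
      rw [← real_inner_self_eq_norm_sq]
      have hs : inner ℝ w w = inner ℝ (u (φ n)) w - inner ℝ (u (φ m)) w := by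
        rw [← inner_sub_left]; rfl
      rw [hs, inner_sub_left]
      have ha := hcrit _ (hu (φ n)).1 w
      have hb := hcrit _ (hu (φ m)).1 w
      linarith
    have hKw : ‖K w‖ ≤ ε ^ 2 / (8 * (C + 1)) := by rw [hw, map_sub]; exact h2.le
    have h4 := abs_real_inner_le_norm (G (K (u (φ n))) - G (K (u (φ m)))) w
    have h5 := (reducedDifferential K G M (u (φ n))).le_of_opNorm_le (hC n) (K w)
    have h6 := (reducedDifferential K G M (u (φ m))).le_of_opNorm_le (hC m) (K w)
    rw [Real.norm_eq_abs] at h5 h6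
    have h7 : C * ‖K w‖ ≤ ε ^ 2 / 8 := by
      calc C * ‖K w‖ ≤ (C + 1) * (ε ^ 2 / (8 * (C + 1))) := by gcongr; linarith
        _ = ε ^ 2 / 8 := by field_simp
    have h8 : ‖w‖ ^ 2 ≤ ε / 2 * ‖w‖ + ε ^ 2 / 4 := by
      have := mul_le_mul_of_nonneg_right h1.le (norm_nonneg w)
      have := (abs_le.1 h4).1
      have := (abs_le.1 h5).1
      have := (abs_le.1 h6).2
      linarith
    nlinarith [norm_nonneg w]
  obtain ⟨a, ha⟩ := cauchySeq_tendsto_of_complete hcauchy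
  exact ⟨a, hclosed.mem_of_tendsto ha (Eventually.of_forall fun n => hu (φ n)), φ, hφ, ha⟩

theorem fderiv_fderiv_self_ge (hG : ContDiff ℝ ω G) (hM : ContDiff ℝ ω M)
    (hE : ∀ u, E u = 1 / 2 * ‖u‖ ^ 2 + inner ℝ u (G (K u)) + M (K u)) (u : X) :
    ∃ C, 0 ≤ C ∧ ∀ v, ‖v‖ ^ 2 - C * ‖v‖ * ‖K v‖ ≤ fderiv ℝ (fderiv ℝ E) u v v := by
  have hω : (ω : WithTop ℕ∞) ≠ 0 := by simp
  have hψ : ContDiff ℝ ω (reducedDifferential K G M) := by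
    have h1 : ContDiff ℝ ω (fun u => fderiv ℝ G (K u)) :=
      (hG.fderiv_right (m := ω) (by simp)).comp K.contDiff
    have h2 : ContDiff ℝ ω (fun u => fderiv ℝ M (K u)) :=
      (hM.fderiv_right (m := ω) (by simp)).comp K.contDiff
    exact ((realInnerL (X := X)).contDiff.clm_comp h1).add h2
  set A := (fderiv ℝ G (K u))
  set S := fderiv ℝ (reducedDifferential K G M) u
  have h1 : HasFDerivAt (fun u => realInnerL (G (K u))) (realInnerL.comp (A.comp K)) u :=
    (realInnerL).hasFDerivAt.comp u
      (((hG.differentiable hω) (K u)).hasFDerivAt.comp u K.hasFDerivAt)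
  have h2 : HasFDerivAt (fun u => (reducedDifferential K G M u).comp K)
      (((ContinuousLinearMap.compL ℝ X Z ℝ).flip K).comp S) u :=
    ((ContinuousLinearMap.compL ℝ X Z ℝ).flip K).hasFDerivAt.comp u
      ((hψ.differentiable hω) u).hasFDerivAt
  have h3 : HasFDerivAt (fderiv ℝ E) (realInnerL + realInnerL.comp (A.comp K) +
      ((ContinuousLinearMap.compL ℝ X Z ℝ).flip K).comp S) u := by
    rw [show fderiv ℝ E = fun u => realInnerL u + realInnerL (G (K u)) +
      (reducedDifferential K G M u).comp K from
        funext fun u => (hasFDerivAt_of_quadratic_add hG hM hE u).fderiv]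
    exact (((realInnerL).hasFDerivAt (x := u)).add h1).add h2
  refine ⟨‖A‖ + ‖S‖, by positivity, fun v => ?_⟩
  rw [h3.fderiv]
  have h4 : (realInnerL + realInnerL.comp (A.comp K) +
      ((ContinuousLinearMap.compL ℝ X Z ℝ).flip K).comp S : X →L[ℝ] X →L[ℝ] ℝ) v v =
      ‖v‖ ^ 2 + inner ℝ (A (K v)) v + S v (K v) := by
    simp
  rw [h4]
  have h5 : |inner ℝ (A (K v)) v| ≤ ‖A‖ * ‖K v‖ * ‖v‖ :=
    (abs_real_inner_le_norm _ _).trans (by gcongr; exact A.le_opNorm _)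
  have h6 : |S v (K v)| ≤ ‖S‖ * ‖v‖ * ‖K v‖ := S.le_opNorm₂ v (K v)
  have := (abs_le.1 h5).1
  have := (abs_le.1 h6).1
  linarith

/-- Finiteness of the critical values of an analytic perturbation of `‖u‖² / 2` by terms factoring
through a compact operator, for the critical points in a ball. -/
theorem finite_image_criticalPoints [CompleteSpace X] [CompleteSpace Z]
    (hK : ∀ ε > 0, ∃ V : Submodule ℝ X, FiniteDimensional ℝ V ∧ ∀ v ∈ Vᗮ, ‖K v‖ ≤ ε * ‖v‖)
    (hG : ContDiff ℝ ω G) (hM : ContDiff ℝ ω M)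
    (hE : ∀ u, E u = 1 / 2 * ‖u‖ ^ 2 + inner ℝ u (G (K u)) + M (K u)) (r : ℝ) :
    (E '' {u | fderiv ℝ E u = 0 ∧ ‖u‖ ≤ r}).Finite := by
  have hcomp := isCompact_criticalPoints hG hM (isCompactOperator_of_forall_small_orthogonal K hK)
    hE r
  have hEc : ContDiff ℝ ω E := by
    rw [show E = fun u => 1 / 2 * ‖u‖ ^ 2 + inner ℝ u (G (K u)) + M (K u) from funext hE]
    exact ((contDiff_const.mul (contDiff_norm_sq ℝ)).add
      (contDiff_id.inner ℝ (hG.comp K.contDiff))).add (hM.comp K.contDiff)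
  refine hcomp.induction_on (p := fun s => (E '' (s ∩ {u | fderiv ℝ E u = 0 ∧ ‖u‖ ≤ r})).Finite)
    (by simp) (fun s t hst ht => ht.subset (Set.image_mono (Set.inter_subset_inter_left _ hst)))
    (fun s t hs ht => ?_) (fun u₀ hu₀ => ?_) |>.subset (by rw [Set.inter_self])
  · rw [Set.union_inter_distrib_right, Set.image_union]
    exact hs.union ht
  obtain ⟨C, hC, hCv⟩ := fderiv_fderiv_self_ge hG hM hE u₀
  obtain ⟨V, hV, hVK⟩ := hK (1 / (2 * (C + 1))) (by positivity)
  set H := fderiv ℝ (fderiv ℝ E) u₀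
  have hcoer : IsCoercive (H + (1 / 4 + 16 * ‖H‖ ^ 2 + 2 * ‖H‖) • realInnerL.comp V.starProjection) := by
    refine ⟨1 / 8, by norm_num, fun v => ?_⟩
    set a := V.starProjection v
    set b := v - a with hb
    have hv : v = a + b := by rw [hb]; abel
    have hbV : b ∈ Vᗮ := V.sub_starProjection_mem_orthogonal v
    have hab : inner ℝ a b = 0 := (Submodule.mem_orthogonal V b).1 hbV a (V.starProjection_apply_mem v)
    have h1 : 1 / 2 * ‖b‖ ^ 2 ≤ H b b := by
      refine le_trans ?_ (hCv b)
      have h2 : C * ‖b‖ * ‖K b‖ ≤ C * ‖b‖ * (1 / (2 * (C + 1)) * ‖b‖) := by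
        gcongr
        exact hVK b hbV
      have h3 : C * ‖b‖ * (1 / (2 * (C + 1)) * ‖b‖) ≤ 1 / 2 * ‖b‖ ^ 2 := by
        have : C / (C + 1) ≤ 1 := by rw [div_le_one (by positivity)]; linarith
        calc C * ‖b‖ * (1 / (2 * (C + 1)) * ‖b‖) = C / (C + 1) * (1 / 2 * ‖b‖ ^ 2) := by
              field_simp
          _ ≤ 1 * (1 / 2 * ‖b‖ ^ 2) := by gcongr
          _ = _ := one_mul _
      linarith
    have hnorm : ‖v‖ * ‖v‖ = ‖a‖ ^ 2 + ‖b‖ ^ 2 := by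
      rw [hv, norm_add_mul_self_real, hab]; ring
    have h2 : H v v = H a a + H a b + H b a + H b b := by
      rw [hv]; simp only [map_add, _root_.add_apply]; ring
    have h3 := (abs_le.1 (H.le_opNorm₂ a a)).1
    have h4 := (abs_le.1 (H.le_opNorm₂ a b)).1
    have h5 := (abs_le.1 (H.le_opNorm₂ b a)).1
    have h6 : inner ℝ a v = ‖a‖ ^ 2 := by
      rw [hv, inner_add_right, hab, real_inner_self_eq_norm_sq, add_zero]
    have h7 : (H + (1 / 4 + 16 * ‖H‖ ^ 2 + 2 * ‖H‖) • realInnerL.comp V.starProjection) v v =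
        H v v + (1 / 4 + 16 * ‖H‖ ^ 2 + 2 * ‖H‖) * ‖a‖ ^ 2 := by
      rw [← h6]; simp [a]
    rw [h7, h2, mul_assoc, hnorm]
    have h8 := norm_nonneg H
    have h9 : 0 ≤ ‖H‖ * ‖a‖ ^ 2 := by positivity
    nlinarith [sq_nonneg (4 * ‖H‖ * ‖a‖ - ‖b‖ / 4), sq_nonneg ‖a‖, sq_nonneg ‖b‖]
  have hev := eventually_eq_of_fderiv_eq_zero_of_isCoercive hEc hu₀.1 V _ hcoer
  refine ⟨_, mem_nhdsWithin_of_mem_nhds hev, (Set.finite_singleton (E u₀)).subset ?_⟩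
  rintro _ ⟨u, ⟨hu1, hu2⟩, rfl⟩
  exact hu1 hu2.1

end CriticalValues

/-! ### Function spaces on the disk -/

theorem isClosed_disk : IsClosed disk :=
  isClosed_le (by fun_prop) continuous_const

theorem isCompact_disk : IsCompact disk := by
  refine ((isCompact_Icc (a := (-1 : ℝ)) (b := 1)).prod
    (isCompact_Icc (a := (-1 : ℝ)) (b := 1))).of_isClosed_subset isClosed_disk ?_
  rintro ⟨x, y⟩ h
  have h' : x ^ 2 + y ^ 2 ≤ 1 := h
  exact ⟨⟨by nlinarith [sq_nonneg y], by nlinarith [sq_nonneg y]⟩,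
    ⟨by nlinarith [sq_nonneg x], by nlinarith [sq_nonneg x]⟩⟩

/-- Lebesgue measure on the unit disk. -/
def diskMeasure : Measure (ℝ × ℝ) := volume.restrict disk

instance : IsFiniteMeasure diskMeasure :=
  ⟨by rw [diskMeasure, Measure.restrict_apply_univ]; exact isCompact_disk.measure_lt_top⟩

theorem ae_diskMeasure_mem : ∀ᵐ x ∂diskMeasure, x ∈ disk :=
  ae_restrict_mem isClosed_disk.measurableSet

theorem Continuous.memLp_disk {f : ℝ × ℝ → ℝ} (hf : Continuous f) (p : ENNReal) :
    MemLp f p diskMeasure := by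
  obtain ⟨C, hC⟩ := isCompact_disk.exists_bound_of_continuousOn hf.continuousOn
  exact MemLp.of_bound hf.aestronglyMeasurable C (ae_diskMeasure_mem.mono hC)

theorem Continuous.integrable_disk {f : ℝ × ℝ → ℝ} (hf : Continuous f) :
    Integrable f diskMeasure :=
  memLp_one_iff_integrable.1 (hf.memLp_disk 1)

/-- The class in `L^p` of the disk of a continuous function on the plane. -/
def toDiskLp (p : ENNReal) : C(ℝ × ℝ, ℝ) →ₗ[ℝ] Lp ℝ p diskMeasure where
  toFun f := (f.continuous.memLp_disk p).toLp f
  map_add' f g := MemLp.toLp_add (f.continuous.memLp_disk p) (g.continuous.memLp_disk p)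
  map_smul' _ _ := rfl

theorem coeFn_toDiskLp (p : ENNReal) (f : C(ℝ × ℝ, ℝ)) : toDiskLp p f =ᵐ[diskMeasure] f :=
  (f.continuous.memLp_disk p).coeFn_toLp

theorem inner_toDiskLp (f g : C(ℝ × ℝ, ℝ)) :
    inner ℝ (toDiskLp 2 f) (toDiskLp 2 g) = ∫ x in disk, f x * g x := by
  rw [L2.inner_def]
  refine integral_congr_ae ?_
  filter_upwards [coeFn_toDiskLp 2 f, coeFn_toDiskLp 2 g] with x hf hg
  rw [hf, hg]
  simp [mul_comm]

instance : ENNReal.HolderTriple 4 4 2 where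
  inv_add_inv_eq_inv := by
    rw [← two_mul, show (4 : ENNReal) = 2 * 2 by norm_num,
      ENNReal.mul_inv (by simp) (by simp), ← mul_assoc,
      ENNReal.mul_inv_cancel (by simp) (by simp), one_mul]

instance : Fact ((1 : ENNReal) ≤ 4) := ⟨by norm_num⟩

/-- Multiplication `L⁴ × L⁴ → L²`. -/
def mulDiskLp : Lp ℝ 4 diskMeasure →L[ℝ] Lp ℝ 4 diskMeasure →L[ℝ] Lp ℝ 2 diskMeasure :=
  (ContinuousLinearMap.mul ℝ ℝ).holderL diskMeasure 4 4 2

theorem mulDiskLp_toDiskLp (f g : C(ℝ × ℝ, ℝ)) :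
    mulDiskLp (toDiskLp 4 f) (toDiskLp 4 g) = toDiskLp 2 (f * g) := by
  refine Lp.ext ?_
  filter_upwards [(ContinuousLinearMap.mul ℝ ℝ).coeFn_holder (r := 2) (toDiskLp 4 f) (toDiskLp 4 g),
    coeFn_toDiskLp 4 f, coeFn_toDiskLp 4 g, coeFn_toDiskLp 2 (f * g)] with x h hf hg hfg
  rw [hfg]
  refine h.trans ?_
  rw [hf, hg]
  rfl

/-! ### Operators which are small on subspaces of finite codimension -/

section SmallOnFiniteCodim

variable {X Y Z Z' : Type*} [NormedAddCommGroup X] [InnerProductSpace ℝ X]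
  [NormedAddCommGroup Y] [InnerProductSpace ℝ Y]
  [NormedAddCommGroup Z] [NormedSpace ℝ Z] [NormedAddCommGroup Z'] [NormedSpace ℝ Z']

/-- The operator `K` has arbitrarily small norm on subspaces of finite codimension. -/
def SmallOnFiniteCodim (K : X →L[ℝ] Z) : Prop :=
  ∀ ε > 0, ∃ V : Submodule ℝ X, FiniteDimensional ℝ V ∧ ∀ v ∈ Vᗮ, ‖K v‖ ≤ ε * ‖v‖

namespace SmallOnFiniteCodim

theorem add {K L : X →L[ℝ] Z} (hK : SmallOnFiniteCodim K) (hL : SmallOnFiniteCodim L) :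
    SmallOnFiniteCodim (K + L) := by
  intro ε hε
  obtain ⟨V, hV, h⟩ := hK (ε / 2) (half_pos hε)
  obtain ⟨V', hV', h'⟩ := hL (ε / 2) (half_pos hε)
  refine ⟨V ⊔ V', inferInstance, fun v hv => ?_⟩
  rw [← Submodule.inf_orthogonal] at hv
  have h1 := h v hv.1
  have h2 := h' v hv.2
  calc ‖(K + L) v‖ ≤ ‖K v‖ + ‖L v‖ := norm_add_le _ _
    _ ≤ ε * ‖v‖ := by linarith

theorem postcomp {K : X →L[ℝ] Z} (hK : SmallOnFiniteCodim K) (A : Z →L[ℝ] Z') :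
    SmallOnFiniteCodim (A.comp K) := by
  intro ε hε
  obtain ⟨V, hV, h⟩ := hK (ε / (‖A‖ + 1)) (by positivity)
  refine ⟨V, hV, fun v hv => (A.le_opNorm _).trans ?_⟩
  calc ‖A‖ * ‖K v‖ ≤ (‖A‖ + 1) * (ε / (‖A‖ + 1) * ‖v‖) := by
        gcongr
        · linarith
        · exact h v hv
    _ = ε * ‖v‖ := by field_simp

theorem precomp [CompleteSpace X] [CompleteSpace Y] {K : X →L[ℝ] Z} (hK : SmallOnFiniteCodim K)
    (A : Y →L[ℝ] X) : SmallOnFiniteCodim (K.comp A) := by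
  intro ε hε
  obtain ⟨V, hV, h⟩ := hK (ε / (‖A‖ + 1)) (by positivity)
  refine ⟨V.map (A.adjoint : X →ₗ[ℝ] Y), inferInstance, fun v hv => ?_⟩
  have hAv : A v ∈ Vᗮ := by
    refine (Submodule.mem_orthogonal _ _).2 fun w hw => ?_
    have := (Submodule.mem_orthogonal _ _).1 hv _ (Submodule.mem_map_of_mem hw)
    rw [← ContinuousLinearMap.adjoint_inner_left]
    exact this
  calc ‖K (A v)‖ ≤ ε / (‖A‖ + 1) * ‖A v‖ := h _ hAv
    _ ≤ ε / (‖A‖ + 1) * ((‖A‖ + 1) * ‖v‖) := by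
        gcongr
        exact (A.le_opNorm v).trans (by gcongr; linarith)
    _ = ε * ‖v‖ := by field_simp

theorem of_tendsto {ι : Type*} {l : Filter ι} [l.NeBot] {K : ι → X →L[ℝ] Z} {L : X →L[ℝ] Z}
    (hK : ∀ᶠ i in l, SmallOnFiniteCodim (K i)) (hL : Tendsto K l (𝓝 L)) :
    SmallOnFiniteCodim L := by
  intro ε hε
  obtain ⟨i, hi, hd⟩ := (hK.and (Metric.tendsto_nhds.1 hL (ε / 2) (half_pos hε))).exists
  obtain ⟨V, hV, h⟩ := hi (ε / 2) (half_pos hε)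
  refine ⟨V, hV, fun v hv => ?_⟩
  have h1 : ‖(L - K i) v‖ ≤ ε / 2 * ‖v‖ := by
    refine ContinuousLinearMap.le_of_opNorm_le _ ?_ v
    rw [← dist_eq_norm, dist_comm]
    exact hd.le
  calc ‖L v‖ = ‖(L - K i) v + K i v‖ := by simp
    _ ≤ ‖(L - K i) v‖ + ‖K i v‖ := norm_add_le _ _
    _ ≤ ε * ‖v‖ := by linarith [h v hv]

theorem smulRight (w : X) (z : Z) :
    SmallOnFiniteCodim ((innerSL ℝ w : X →L[ℝ] ℝ).smulRight z) := by
  intro ε hε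
  refine ⟨ℝ ∙ w, inferInstance, fun v hv => ?_⟩
  have : inner ℝ w v = 0 := (Submodule.mem_orthogonal _ _).1 hv w (Submodule.mem_span_singleton_self w)
  simp [this]
  positivity

end SmallOnFiniteCodim

end SmallOnFiniteCodim

/-! ### Integral operators with continuous kernels -/

section ContinuousKernel

variable {κ : ℝ × ℝ → Lp ℝ 2 diskMeasure}

theorem memLp_inner_kernel (hκ : Continuous κ) (p : ENNReal) (f : Lp ℝ 2 diskMeasure) :
    MemLp (fun x => inner ℝ (κ x) f) p diskMeasure :=
  Continuous.memLp_disk (by fun_prop) p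

/-- The integral operator `L² → L⁴` with a continuous kernel. -/
def kernelOperator (hκ : Continuous κ) : Lp ℝ 2 diskMeasure →L[ℝ] Lp ℝ 4 diskMeasure :=
  LinearMap.mkContinuousOfExistsBound
    { toFun := fun f => (memLp_inner_kernel hκ 4 f).toLp _
      map_add' := fun f g => by
        rw [← MemLp.toLp_add]
        exact (MemLp.toLp_eq_toLp_iff _ _).2 (Eventually.of_forall fun x => inner_add_right _ _ _)
      map_smul' := fun c f => by
        rw [RingHom.id_apply, ← MemLp.toLp_const_smul]
        exact (MemLp.toLp_eq_toLp_iff _ _).2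
          (Eventually.of_forall fun x => real_inner_smul_right _ _ _) }
    (by
      obtain ⟨C, hC⟩ := isCompact_disk.exists_bound_of_continuousOn hκ.continuousOn
      refine ⟨measureUnivNNReal diskMeasure ^ (4 : ENNReal).toReal⁻¹ * C, fun f => ?_⟩
      have hC0 : 0 ≤ C := (norm_nonneg _).trans (hC (0, 0) (by simp [disk]))
      rw [mul_assoc]
      refine Lp.norm_le_of_ae_bound (by positivity) ?_
      filter_upwards [ae_diskMeasure_mem, (memLp_inner_kernel hκ 4 f).coeFn_toLp] with x hx hx'
      refine (congrArg _ hx').trans_le ?_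
      exact (norm_inner_le_norm _ _).trans (by gcongr; exact hC x hx))

theorem coeFn_kernelOperator (hκ : Continuous κ) (f : Lp ℝ 2 diskMeasure) :
    kernelOperator hκ f =ᵐ[diskMeasure] fun x => inner ℝ (κ x) f :=
  (memLp_inner_kernel hκ 4 f).coeFn_toLp

theorem smallOnFiniteCodim_kernelOperator (hκ : Continuous κ) :
    SmallOnFiniteCodim (kernelOperator hκ) := by
  intro ε hε
  set c : ℝ := measureUnivNNReal diskMeasure ^ (4 : ENNReal).toReal⁻¹ with hc
  have hc0 : 0 ≤ c := by positivity
  have hcomp : IsCompact (κ '' disk) := isCompact_disk.image hκ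
  obtain ⟨t, -, htf, ht⟩ := hcomp.finite_cover_balls (e := ε / (c + 1)) (by positivity)
  refine ⟨Submodule.span ℝ t, FiniteDimensional.span_of_finite ℝ htf, fun f hf => ?_⟩
  have h1 : ‖kernelOperator hκ f‖ ≤ c * (ε / (c + 1) * ‖f‖) := by
    refine Lp.norm_le_of_ae_bound (by positivity) ?_
    filter_upwards [ae_diskMeasure_mem, coeFn_kernelOperator hκ f] with x hx hx'
    rw [hx']
    obtain ⟨y, hy, hxy⟩ := Set.mem_iUnion₂.1 (ht ⟨x, hx, rfl⟩)
    have h2 : inner ℝ y f = 0 := (Submodule.mem_orthogonal _ _).1 hf y (Submodule.subset_span hy)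
    have h3 : inner ℝ (κ x) f = inner ℝ (κ x - y) f := by rw [inner_sub_left, h2, sub_zero]
    rw [h3]
    refine (norm_inner_le_norm _ _).trans ?_
    gcongr
    rw [← dist_eq_norm]
    exact (Metric.mem_ball.1 hxy).le
  refine h1.trans ?_
  calc c * (ε / (c + 1) * ‖f‖) ≤ (c + 1) * (ε / (c + 1) * ‖f‖) := by gcongr; linarith
    _ = ε * ‖f‖ := by field_simp

/-- A jointly continuous kernel defines a continuous family in `L²`. -/
theorem continuous_toDiskLp_of_continuous_uncurry {k : ℝ × ℝ → C(ℝ × ℝ, ℝ)}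
    (hk : Continuous fun p : (ℝ × ℝ) × (ℝ × ℝ) => k p.1 p.2) :
    Continuous fun x => toDiskLp 2 (k x) := by
  set c : ℝ := measureUnivNNReal diskMeasure ^ (2 : ENNReal).toReal⁻¹ with hc
  have hc0 : 0 ≤ c := by positivity
  refine continuous_iff_continuousAt.2 fun x₀ => Metric.tendsto_nhds.2 fun ε hε => ?_
  have hε' : 0 < ε / (c + 1) := by positivity
  have h1 : ∀ᶠ x in 𝓝 x₀, ∀ z ∈ disk, ‖k x z - k x₀ z‖ < ε / (c + 1) := by
    refine isCompact_disk.eventually_forall_of_forall_eventually fun z _ => ?_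
    have h2 : Continuous fun p : (ℝ × ℝ) × (ℝ × ℝ) => ‖k p.1 p.2 - k x₀ p.2‖ :=
      (hk.sub (hk.comp (by fun_prop : Continuous fun p : (ℝ × ℝ) × (ℝ × ℝ) => (x₀, p.2)))).norm
    have h3 := h2.tendsto (x₀, z)
    simp only [sub_self, norm_zero] at h3
    exact h3.eventually_lt_const hε'
  filter_upwards [h1] with x hx
  rw [dist_eq_norm, ← map_sub]
  have h4 : ‖toDiskLp 2 (k x - k x₀)‖ ≤ c * (ε / (c + 1)) := by
    refine Lp.norm_le_of_ae_bound hε'.le ?_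
    filter_upwards [ae_diskMeasure_mem, coeFn_toDiskLp 2 (k x - k x₀)] with z hz hz'
    rw [hz']
    exact (hx z hz).le
  refine h4.trans_lt ?_
  calc c * (ε / (c + 1)) < (c + 1) * (ε / (c + 1)) := by gcongr; linarith
    _ = ε := by field_simp

end ContinuousKernel

/-! ### Norm bounds for nearly diagonal kernels -/

theorem norm_Lp_four_pow (f : Lp ℝ 4 diskMeasure) : ‖f‖ ^ 4 = ∫ x in disk, f x ^ 4 := by
  have h := (Lp.memLp f).eLpNorm_eq_integral_rpow_norm (p := 4) (by simp) (by simp)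
  have h4 : (4 : ENNReal).toReal = 4 := by simp
  have h0 : 0 ≤ ∫ x, ‖f x‖ ^ (4 : ℝ) ∂diskMeasure := integral_nonneg fun x => by positivity
  rw [Lp.norm_def, h, h4, ENNReal.toReal_ofReal (by positivity), ← Real.rpow_natCast,
    ← Real.rpow_mul h0]
  norm_num
  refine integral_congr_ae (Eventually.of_forall fun x => ?_)
  exact Even.pow_abs (by decide) _

theorem norm_Lp_two_sq (f : Lp ℝ 2 diskMeasure) : ‖f‖ ^ 2 = ∫ x in disk, f x ^ 2 := by
  rw [← real_inner_self_eq_norm_sq, L2.inner_def]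
  refine integral_congr_ae (Eventually.of_forall fun x => ?_)
  simp [sq]

/-- Indicator function of a neighbourhood of the diagonal. -/
def nearDiagonal (r : ℝ) (x z : ℝ × ℝ) : ℝ := (Metric.closedBall x r).indicator 1 z

theorem nearDiagonal_nonneg (r : ℝ) (x z : ℝ × ℝ) : 0 ≤ nearDiagonal r x z :=
  Set.indicator_nonneg (fun _ _ => zero_le_one) _

theorem nearDiagonal_le_one (r : ℝ) (x z : ℝ × ℝ) : nearDiagonal r x z ≤ 1 :=
  Set.indicator_le' (fun _ _ => le_rfl) (fun _ _ => zero_le_one) _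

theorem nearDiagonal_comm (r : ℝ) (x z : ℝ × ℝ) : nearDiagonal r x z = nearDiagonal r z x := by
  simp only [nearDiagonal, Set.indicator, Metric.mem_closedBall, dist_comm, Pi.one_apply]

theorem measurable_nearDiagonal (r : ℝ) :
    Measurable fun p : (ℝ × ℝ) × (ℝ × ℝ) => nearDiagonal r p.1 p.2 := by
  have : (fun p : (ℝ × ℝ) × (ℝ × ℝ) => nearDiagonal r p.1 p.2) =
      {p : (ℝ × ℝ) × (ℝ × ℝ) | dist p.2 p.1 ≤ r}.indicator 1 := by
    ext p
    simp only [nearDiagonal, Set.indicator, Metric.mem_closedBall, Set.mem_ofPred_eq]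
    rfl
  rw [this]
  exact measurable_one.indicator
    (isClosed_le (by fun_prop) continuous_const).measurableSet

theorem volume_closedBall_prod (x : ℝ × ℝ) {r : ℝ} (hr : 0 ≤ r) :
    (volume (Metric.closedBall x r)).toReal = 4 * r ^ 2 := by
  obtain ⟨a, b⟩ := x
  rw [← closedBall_prod_same, Measure.volume_eq_prod, Measure.prod_prod, ENNReal.toReal_mul]
  simp only [Real.volume_closedBall]
  rw [ENNReal.toReal_ofReal (by positivity)]
  ring

theorem integral_nearDiagonal_le (x : ℝ × ℝ) {r : ℝ} (hr : 0 ≤ r) :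
    ∫ z in disk, nearDiagonal r x z ≤ 4 * r ^ 2 := by
  have h : ∫ z, nearDiagonal r x z = 4 * r ^ 2 := by
    simp only [nearDiagonal]
    rw [integral_indicator_one Metric.isClosed_closedBall.measurableSet]
    exact volume_closedBall_prod x hr
  rw [← h]
  refine setIntegral_le_integral ?_ (Eventually.of_forall fun z => nearDiagonal_nonneg r x z)
  exact (integrable_indicator_iff Metric.isClosed_closedBall.measurableSet).2
    (integrableOn_const (hs := (isCompact_closedBall x r).measure_lt_top.ne))

theorem norm_kernelOperator_le {k : ℝ × ℝ → C(ℝ × ℝ, ℝ)}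
    (hk : Continuous fun p : (ℝ × ℝ) × (ℝ × ℝ) => k p.1 p.2) {A r : ℝ} (hA : 0 ≤ A) (hr : 0 < r)
    (hb : ∀ x ∈ disk, ∀ z ∈ disk, |k x z| ≤ A * nearDiagonal r x z) :
    ‖kernelOperator (continuous_toDiskLp_of_continuous_uncurry hk)‖ ≤
      2 * A * r * √(2 * r) := by
  refine ContinuousLinearMap.opNorm_le_bound _ (by positivity) fun f => ?_
  set u := kernelOperator (continuous_toDiskLp_of_continuous_uncurry hk) f with hu
  have hf2 : Integrable (fun z => f z ^ 2) diskMeasure := (Lp.memLp f).integrable_sq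
  have hf1 : Integrable (fun z => f z) diskMeasure := (Lp.memLp f).integrable (by norm_num)
  have hm : ∀ x, AEStronglyMeasurable (fun z => nearDiagonal r x z) diskMeasure := fun x =>
    ((measurable_nearDiagonal r).comp (measurable_const.prodMk measurable_id)).aestronglyMeasurable
  have hbd : ∀ x, ∀ᵐ z ∂diskMeasure, ‖nearDiagonal r x z‖ ≤ 1 := fun x =>
    Eventually.of_forall fun z => by
      rw [Real.norm_of_nonneg (nearDiagonal_nonneg r x z)]; exact nearDiagonal_le_one r x z
  have hi0 : ∀ x, Integrable (fun z => nearDiagonal r x z) diskMeasure := fun x =>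
    Integrable.of_bound (hm x) 1 (hbd x)
  have hi1 : ∀ x, Integrable (fun z => nearDiagonal r x z * |f z|) diskMeasure := fun x =>
    hf1.abs.bdd_mul (hm x) (hbd x)
  have hi2 : ∀ x, Integrable (fun z => nearDiagonal r x z * f z ^ 2) diskMeasure := fun x =>
    hf2.bdd_mul (hm x) (hbd x)
  set I : ℝ × ℝ → ℝ := fun x => ∫ z in disk, nearDiagonal r x z * f z ^ 2 with hI
  set J : ℝ × ℝ → ℝ := fun x => ∫ z in disk, nearDiagonal r x z * |f z| with hJ
  have hI0 : ∀ x, 0 ≤ I x := fun x =>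
    integral_nonneg fun z => mul_nonneg (nearDiagonal_nonneg r x z) (sq_nonneg _)
  have hIle : ∀ x, I x ≤ ‖f‖ ^ 2 := fun x => by
    rw [norm_Lp_two_sq]
    refine integral_mono (hi2 x) hf2 fun z => ?_
    exact mul_le_of_le_one_left (sq_nonneg _) (nearDiagonal_le_one r x z)
  have hJI : ∀ x, J x ^ 2 ≤ 4 * r ^ 2 * I x := fun x => by
    have h1 : ∀ t : ℝ, 0 ≤ I x - 2 * t * J x + t ^ 2 * (4 * r ^ 2) := fun t => by
      have h2 : 0 ≤ ∫ z in disk, nearDiagonal r x z * (|f z| - t) ^ 2 :=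
        integral_nonneg fun z => mul_nonneg (nearDiagonal_nonneg r x z) (sq_nonneg _)
      have h3 : ∫ z in disk, nearDiagonal r x z * (|f z| - t) ^ 2 =
          I x - 2 * t * J x + t ^ 2 * ∫ z in disk, nearDiagonal r x z := by
        simp only [hI, hJ]
        rw [← integral_const_mul, ← integral_const_mul, ← integral_sub, ← integral_add]
        · refine integral_congr_ae (Eventually.of_forall fun z => ?_)
          simp only
          rw [sub_sq, sq_abs]
          ring
        · exact (hi2 x).sub ((hi1 x).const_mul _)
        · exact (hi0 x).const_mul _
        · exact hi2 x
        · exact (hi1 x).const_mul _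
      have h4 := integral_nearDiagonal_le x hr.le
      nlinarith [sq_nonneg t]
    have h5 := h1 (J x / (4 * r ^ 2))
    have h6 : I x - 2 * (J x / (4 * r ^ 2)) * J x + (J x / (4 * r ^ 2)) ^ 2 * (4 * r ^ 2) =
        I x - J x ^ 2 / (4 * r ^ 2) := by field_simp; ring
    rw [h6, sub_nonneg, div_le_iff₀ (by positivity)] at h5
    linarith
  have huJ : ∀ᵐ x ∂diskMeasure, |u x| ≤ A * J x := by
    filter_upwards [ae_diskMeasure_mem,
      coeFn_kernelOperator (continuous_toDiskLp_of_continuous_uncurry hk) f] with x hx hux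
    rw [hu, hux, L2.inner_def, hJ, ← integral_const_mul, ← Real.norm_eq_abs]
    refine norm_integral_le_of_norm_le ((hi1 x).const_mul A) ?_
    filter_upwards [ae_diskMeasure_mem, coeFn_toDiskLp 2 (k x)] with z hz hkz
    rw [hkz]
    simp only [RCLike.inner_apply, conj_trivial, norm_mul, Real.norm_eq_abs]
    rw [mul_comm, ← mul_assoc]
    gcongr
    exact hb x hx z hz
  have hprod : Integrable (fun p : (ℝ × ℝ) × (ℝ × ℝ) => nearDiagonal r p.1 p.2 * f p.2 ^ 2)
      (diskMeasure.prod diskMeasure) := by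
    refine Integrable.bdd_mul (c := 1) (hf2.comp_snd diskMeasure)
      (measurable_nearDiagonal r).aestronglyMeasurable (Eventually.of_forall fun p => ?_)
    rw [Real.norm_of_nonneg (nearDiagonal_nonneg r _ _)]
    exact nearDiagonal_le_one r _ _
  have hIint : Integrable I diskMeasure := hprod.integral_prod_left
  have hII : ∫ x in disk, I x ≤ 4 * r ^ 2 * ‖f‖ ^ 2 := by
    have h1 : ∫ x in disk, I x =
        ∫ z in disk, (∫ x in disk, nearDiagonal r x z) * f z ^ 2 := by
      rw [hI, integral_integral_swap hprod]
      simp_rw [integral_mul_const]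
    rw [h1, norm_Lp_two_sq, ← integral_const_mul]
    refine integral_mono_of_nonneg (Eventually.of_forall fun z => ?_) (hf2.const_mul _)
      (Eventually.of_forall fun z => ?_)
    · exact mul_nonneg (integral_nonneg fun x => nearDiagonal_nonneg r x z) (sq_nonneg _)
    · simp only
      gcongr
      simp_rw [nearDiagonal_comm r _ z]
      exact integral_nearDiagonal_le z hr.le
  have hu4 : ‖u‖ ^ 4 ≤ (2 * A * r * √(2 * r) * ‖f‖) ^ 4 := by
    rw [norm_Lp_four_pow]
    have h1 : ∫ x in disk, u x ^ 4 ≤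
        ∫ x in disk, A ^ 4 * (4 * r ^ 2) ^ 2 * ‖f‖ ^ 2 * I x := by
      refine integral_mono_of_nonneg (Eventually.of_forall fun x => by positivity)
        (hIint.const_mul _) ?_
      filter_upwards [huJ] with x hx
      have h2 : u x ^ 2 ≤ A ^ 2 * (4 * r ^ 2 * I x) := by
        rw [← sq_abs]
        calc |u x| ^ 2 ≤ (A * J x) ^ 2 := by gcongr
          _ = A ^ 2 * J x ^ 2 := by ring
          _ ≤ _ := by gcongr; exact hJI x
      calc u x ^ 4 = (u x ^ 2) ^ 2 := by ring
        _ ≤ (A ^ 2 * (4 * r ^ 2 * I x)) ^ 2 := by gcongr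
        _ = A ^ 4 * (4 * r ^ 2) ^ 2 * I x * I x := by ring
        _ ≤ A ^ 4 * (4 * r ^ 2) ^ 2 * ‖f‖ ^ 2 * I x := by
            have := hI0 x
            gcongr
            exact hIle x
    rw [integral_const_mul] at h1
    have hs : √(2 * r) ^ 4 = (2 * r) ^ 2 := by
      rw [show √(2 * r) ^ 4 = (√(2 * r) ^ 2) ^ 2 by ring, Real.sq_sqrt (by positivity)]
    calc _ ≤ _ := h1
      _ ≤ A ^ 4 * (4 * r ^ 2) ^ 2 * ‖f‖ ^ 2 * (4 * r ^ 2 * ‖f‖ ^ 2) := by gcongr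
      _ = (2 * A * r) ^ 4 * √(2 * r) ^ 4 * ‖f‖ ^ 4 := by rw [hs]; ring
      _ = _ := by ring
  exact le_of_pow_le_pow_left₀ (by norm_num) (by positivity) hu4

/-! ### Integrals of continuous families -/

/-- Extension by zero of a function on the disk. -/
def extendDisk (g : C(disk, ℝ)) : ℝ × ℝ → ℝ := Function.extend Subtype.val g 0

theorem extendDisk_apply (g : C(disk, ℝ)) {x : ℝ × ℝ} (hx : x ∈ disk) :
    extendDisk g x = g ⟨x, hx⟩ :=
  Subtype.val_injective.extend_apply g 0 ⟨x, hx⟩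

instance : CompactSpace disk := isCompact_iff_compactSpace.1 isCompact_disk

theorem ae_norm_extendDisk_le (g : C(disk, ℝ)) : ∀ᵐ x ∂diskMeasure, ‖extendDisk g x‖ ≤ ‖g‖ := by
  filter_upwards [ae_diskMeasure_mem] with x hx
  rw [extendDisk_apply g hx]
  exact g.norm_coe_le_norm _

theorem memLp_extendDisk (g : C(disk, ℝ)) : MemLp (extendDisk g) 4 diskMeasure := by
  refine MemLp.of_bound (Measurable.aestronglyMeasurable ?_) _ (ae_norm_extendDisk_le g)
  exact (MeasurableEmbedding.subtype_coe isClosed_disk.measurableSet).measurable_extend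
    g.continuous.measurable measurable_zero

/-- The class in `L⁴` of a continuous function on the disk. -/
def diskToLp : C(disk, ℝ) →L[ℝ] Lp ℝ 4 diskMeasure :=
  LinearMap.mkContinuousOfExistsBound
    { toFun := fun g => (memLp_extendDisk g).toLp _
      map_add' := fun f g => by
        rw [← MemLp.toLp_add]
        refine (MemLp.toLp_eq_toLp_iff _ _).2 (ae_diskMeasure_mem.mono fun x hx => ?_)
        rw [Pi.add_apply, extendDisk_apply _ hx, extendDisk_apply _ hx, extendDisk_apply _ hx]
        rfl
      map_smul' := fun c f => by
        rw [RingHom.id_apply, ← MemLp.toLp_const_smul]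
        refine (MemLp.toLp_eq_toLp_iff _ _).2 (ae_diskMeasure_mem.mono fun x hx => ?_)
        rw [Pi.smul_apply, extendDisk_apply _ hx, extendDisk_apply _ hx]
        rfl }
    ⟨measureUnivNNReal diskMeasure ^ (4 : ENNReal).toReal⁻¹, fun g => by
      refine Lp.norm_le_of_ae_bound (norm_nonneg _) ?_
      filter_upwards [ae_norm_extendDisk_le g, (memLp_extendDisk g).coeFn_toLp] with x hx hx'
      exact (congrArg _ hx').trans_le hx⟩

theorem diskToLp_restrict (f : C(ℝ × ℝ, ℝ)) : diskToLp (f.restrict disk) = toDiskLp 4 f := by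
  refine (MemLp.toLp_eq_toLp_iff (memLp_extendDisk _) (f.continuous.memLp_disk 4)).2
    (ae_diskMeasure_mem.mono fun x hx => ?_)
  rw [extendDisk_apply _ hx]
  rfl

theorem toDiskLp_integral {b : ℝ → C(ℝ × ℝ, ℝ)} (hb : Continuous fun p : ℝ × (ℝ × ℝ) => b p.1 p.2)
    {B : C(ℝ × ℝ, ℝ)} (hB : ∀ x, B x = ∫ s in Set.Ioc (0 : ℝ) 1, b s x) :
    toDiskLp 4 B = ∫ s in Set.Ioc (0 : ℝ) 1, toDiskLp 4 (b s) := by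
  have hc : Continuous fun s => (b s).restrict disk :=
    ContinuousMap.continuous_of_continuous_uncurry _
      (hb.comp (by fun_prop : Continuous fun p : ℝ × disk => (p.1, (p.2 : ℝ × ℝ))))
  have hi : Integrable (fun s => (b s).restrict disk) (volume.restrict (Set.Ioc (0 : ℝ) 1)) :=
    (hc.integrableOn_Icc (a := 0) (b := 1)).mono_set Set.Ioc_subset_Icc_self
  have h1 : ∫ s in Set.Ioc (0 : ℝ) 1, toDiskLp 4 (b s) =
      diskToLp (∫ s in Set.Ioc (0 : ℝ) 1, (b s).restrict disk) := by
    rw [← diskToLp.integral_comp_comm hi]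
    simp_rw [diskToLp_restrict]
  rw [h1, ← diskToLp_restrict]
  congr 1
  ext x
  have h2 := (ContinuousMap.evalCLM ℝ x).integral_comp_comm hi
  simp only [ContinuousMap.evalCLM_apply, ContinuousMap.restrict_apply] at h2
  rw [ContinuousMap.restrict_apply, hB, ← h2]

/-! ### Continuous families of kernels -/

theorem kernelOperator_sub {κ κ' : ℝ × ℝ → Lp ℝ 2 diskMeasure} (hκ : Continuous κ)
    (hκ' : Continuous κ') {κ'' : ℝ × ℝ → Lp ℝ 2 diskMeasure} (hκ'' : Continuous κ'')
    (h : ∀ x, κ'' x = κ x - κ' x) :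
    kernelOperator hκ - kernelOperator hκ' = kernelOperator hκ'' := by
  ext1 f
  refine Lp.ext ?_
  filter_upwards [coeFn_kernelOperator hκ f, coeFn_kernelOperator hκ' f,
    coeFn_kernelOperator hκ'' f, Lp.coeFn_sub (kernelOperator hκ f) (kernelOperator hκ' f)]
    with x h1 h2 h3 h4
  rw [_root_.sub_apply, h4, Pi.sub_apply, h1, h2, h3, h, inner_sub_left]

theorem nearDiagonal_two {x z : ℝ × ℝ} (hx : x ∈ disk) (hz : z ∈ disk) :
    nearDiagonal 2 x z = 1 := by
  have h : ∀ y ∈ disk, ‖y‖ ≤ 1 := fun y hy => by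
    have hy' : y.1 ^ 2 + y.2 ^ 2 ≤ 1 := hy
    rw [Prod.norm_def]
    exact max_le (abs_le_one_iff_mul_self_le_one.2 (by nlinarith [sq_nonneg y.2]))
      (abs_le_one_iff_mul_self_le_one.2 (by nlinarith [sq_nonneg y.1]))
  refine Set.indicator_of_mem (Metric.mem_closedBall.2 ?_) _
  rw [dist_eq_norm]
  exact (norm_sub_le _ _).trans (by linarith [h x hx, h z hz])

theorem continuousOn_kernelOperator {S : Set ℝ} {k : ℝ → ℝ × ℝ → C(ℝ × ℝ, ℝ)}
    (hk : ∀ s, Continuous fun p : (ℝ × ℝ) × (ℝ × ℝ) => k s p.1 p.2)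
    (hkS : ∀ s ∈ S, ∀ q, ContinuousAt
      (fun p : ℝ × (ℝ × ℝ) × (ℝ × ℝ) => k p.1 p.2.1 p.2.2) (s, q)) :
    ContinuousOn (fun s => kernelOperator (continuous_toDiskLp_of_continuous_uncurry (hk s))) S := by
  intro s₀ hs₀
  refine ContinuousAt.continuousWithinAt (Metric.tendsto_nhds.2 fun ε hε => ?_)
  have h1 : ∀ᶠ s in 𝓝 s₀, ∀ q ∈ disk ×ˢ disk, ‖k s q.1 q.2 - k s₀ q.1 q.2‖ < ε / 16 := by
    refine (isCompact_disk.prod isCompact_disk).eventually_forall_of_forall_eventually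
      fun q _ => ?_
    have h2 : ContinuousAt (fun p : ℝ × (ℝ × ℝ) × (ℝ × ℝ) =>
        ‖k p.1 p.2.1 p.2.2 - k s₀ p.2.1 p.2.2‖) (s₀, q) :=
      ((hkS s₀ hs₀ q).sub ((hk s₀).comp continuous_snd).continuousAt).norm
    have h3 := h2.tendsto
    simp only [sub_self, norm_zero] at h3
    exact h3.eventually_lt_const (by positivity)
  filter_upwards [h1] with s hs
  have hd : Continuous fun p : (ℝ × ℝ) × (ℝ × ℝ) => (k s p.1 - k s₀ p.1) p.2 := (hk s).sub (hk s₀)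
  rw [dist_eq_norm, kernelOperator_sub _ _ (continuous_toDiskLp_of_continuous_uncurry hd)
    fun x => map_sub _ _ _]
  refine (norm_kernelOperator_le hd (A := ε / 16) (r := 2) (by positivity) (by norm_num)
    fun x hx z hz => ?_).trans_lt ?_
  · rw [nearDiagonal_two hx hz, mul_one]
    exact (hs (x, z) ⟨hx, hz⟩).le
  · have : √(2 * 2 : ℝ) = 2 := Real.sqrt_mul_self (by norm_num)
    rw [this]
    linarith

theorem SmallOnFiniteCodim.smul {X Z : Type*} [NormedAddCommGroup X] [InnerProductSpace ℝ X]
    [NormedAddCommGroup Z] [NormedSpace ℝ Z] {K : X →L[ℝ] Z} (hK : SmallOnFiniteCodim K) (c : ℝ) :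
    SmallOnFiniteCodim (c • K) :=
  hK.postcomp (c • ContinuousLinearMap.id ℝ Z)

theorem convex_smallOnFiniteCodim {X Z : Type*} [NormedAddCommGroup X] [InnerProductSpace ℝ X]
    [NormedAddCommGroup Z] [NormedSpace ℝ Z] :
    Convex ℝ {K : X →L[ℝ] Z | SmallOnFiniteCodim K} :=
  fun _ hK _ hL a b _ _ _ => (SmallOnFiniteCodim.smul hK a).add (SmallOnFiniteCodim.smul hL b)

theorem isClosed_smallOnFiniteCodim {X Z : Type*} [NormedAddCommGroup X] [InnerProductSpace ℝ X]
    [NormedAddCommGroup Z] [NormedSpace ℝ Z] :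
    IsClosed {K : X →L[ℝ] Z | SmallOnFiniteCodim K} :=
  IsSeqClosed.isClosed fun _ _ hK hL =>
    SmallOnFiniteCodim.of_tendsto (Eventually.of_forall hK) hL

theorem SmallOnFiniteCodim.integral {X Z : Type*} [NormedAddCommGroup X] [InnerProductSpace ℝ X]
    [NormedAddCommGroup Z] [NormedSpace ℝ Z] [CompleteSpace Z] {B : ℝ → X →L[ℝ] Z}
    (hB : ∀ s, SmallOnFiniteCodim (B s)) (hi : IntegrableOn B (Set.Ioc 0 1)) :
    SmallOnFiniteCodim (∫ s in Set.Ioc (0 : ℝ) 1, B s) := by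
  have : IsProbabilityMeasure (volume.restrict (Set.Ioc (0 : ℝ) 1)) := ⟨by simp⟩
  have h := (convex_smallOnFiniteCodim (X := X) (Z := Z)).integral_mem isClosed_smallOnFiniteCodim
    (Eventually.of_forall hB) hi
  exact h

/-! ### Averages over segments with endpoints distributed in the disk -/

/-- The unnormalized density of the averages. -/
def rawBump (y : ℝ × ℝ) : ℝ := max 0 (1 - (y.1 ^ 2 + y.2 ^ 2))

theorem continuous_rawBump : Continuous rawBump := by unfold rawBump; fun_prop

theorem rawBump_nonneg (y : ℝ × ℝ) : 0 ≤ rawBump y := le_max_left _ _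

theorem rawBump_of_notMem {y : ℝ × ℝ} (hy : y ∉ disk) : rawBump y = 0 := by
  have : 1 < y.1 ^ 2 + y.2 ^ 2 := not_le.1 hy
  exact max_eq_left (by linarith)

theorem integral_rawBump_pos : 0 < ∫ y in disk, rawBump y := by
  rw [setIntegral_eq_integral_of_forall_compl_eq_zero fun y hy => rawBump_of_notMem hy]
  refine continuous_rawBump.integral_pos_of_hasCompactSupport_nonneg_nonzero
    (HasCompactSupport.intro isCompact_disk fun y hy => rawBump_of_notMem hy) rawBump_nonneg
    (x := 0) ?_
  simp [rawBump]

/-- A continuous probability density on the disk. -/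
def diskBump (y : ℝ × ℝ) : ℝ := rawBump y / ∫ z in disk, rawBump z

theorem continuous_diskBump : Continuous diskBump := continuous_rawBump.div_const _

theorem diskBump_nonneg (y : ℝ × ℝ) : 0 ≤ diskBump y :=
  div_nonneg (rawBump_nonneg y) integral_rawBump_pos.le

theorem diskBump_of_notMem {y : ℝ × ℝ} (hy : y ∉ disk) : diskBump y = 0 := by
  rw [diskBump, rawBump_of_notMem hy, zero_div]

theorem integral_diskBump : ∫ y in disk, diskBump y = 1 := by
  simp only [diskBump]
  rw [integral_div, div_self integral_rawBump_pos.ne']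

theorem exists_diskBump_le : ∃ C, 0 ≤ C ∧ ∀ y, diskBump y ≤ C := by
  refine ⟨1 / ∫ z in disk, rawBump z, by have := integral_rawBump_pos; positivity, fun y => ?_⟩
  refine div_le_div_of_nonneg_right ?_ integral_rawBump_pos.le
  exact max_le zero_le_one (by nlinarith [sq_nonneg y.1, sq_nonneg y.2])

theorem segment_mem_disk {x y : ℝ × ℝ} (hx : x ∈ disk) (hy : y ∈ disk) {s : ℝ}
    (hs : s ∈ Set.Icc (0 : ℝ) 1) : (1 - s) • x + s • y ∈ disk := by
  have hx' : x.1 ^ 2 + x.2 ^ 2 ≤ 1 := hx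
  have hy' : y.1 ^ 2 + y.2 ^ 2 ≤ 1 := hy
  have h0 := hs.1
  have h1 : 0 ≤ 1 - s := sub_nonneg.2 hs.2
  change ((1 - s) * x.1 + s * y.1) ^ 2 + ((1 - s) * x.2 + s * y.2) ^ 2 ≤ 1
  nlinarith [mul_nonneg h0 h1, mul_nonneg (mul_nonneg h0 h1) (sq_nonneg (x.1 - y.1)),
    mul_nonneg (mul_nonneg h0 h1) (sq_nonneg (x.2 - y.2))]

theorem norm_le_one_of_mem_disk {x : ℝ × ℝ} (hx : x ∈ disk) : ‖x‖ ≤ 1 := by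
  have hx' : x.1 ^ 2 + x.2 ^ 2 ≤ 1 := hx
  rw [Prod.norm_def]
  exact max_le (abs_le_one_iff_mul_self_le_one.2 (by nlinarith [sq_nonneg x.2]))
    (abs_le_one_iff_mul_self_le_one.2 (by nlinarith [sq_nonneg x.1]))

/-- The function `x ↦ ∫ θ(y) m(s) e(x - y) f((1 - s) x + s y) dy`. -/
def segmentAverage (m : C(ℝ, ℝ)) (e : (ℝ × ℝ) →L[ℝ] ℝ) (f : C(ℝ × ℝ, ℝ)) (s : ℝ)
    (x : ℝ × ℝ) : ℝ :=
  ∫ y in disk, diskBump y * (m s * e (x - y) * f ((1 - s) • x + s • y))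

theorem continuous_segmentAverage (m : C(ℝ, ℝ)) (e : (ℝ × ℝ) →L[ℝ] ℝ) (f : C(ℝ × ℝ, ℝ)) :
    Continuous fun p : ℝ × (ℝ × ℝ) => segmentAverage m e f p.1 p.2 := by
  refine continuous_parametric_integral_of_continuous
    (f := fun (p : ℝ × (ℝ × ℝ)) y =>
      diskBump y * (m p.1 * e (p.2 - y) * f ((1 - p.1) • p.2 + p.1 • y))) ?_ isCompact_disk
  have := continuous_diskBump
  unfold Function.uncurry
  fun_prop

/-- The kernel of the operator `segmentAverage`. -/
def segmentKernel (m : C(ℝ, ℝ)) (e : (ℝ × ℝ) →L[ℝ] ℝ) (s : ℝ) (x : ℝ × ℝ) : C(ℝ × ℝ, ℝ) where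
  toFun z := m s * s⁻¹ ^ 3 * diskBump (s⁻¹ • (z - (1 - s) • x)) * e (x - z)
  continuous_toFun := by
    have := continuous_diskBump
    fun_prop

theorem segmentKernel_apply (m : C(ℝ, ℝ)) (e : (ℝ × ℝ) →L[ℝ] ℝ) (s : ℝ) (x z : ℝ × ℝ) :
    segmentKernel m e s x z =
      m s * s⁻¹ ^ 3 * diskBump (s⁻¹ • (z - (1 - s) • x)) * e (x - z) := rfl

theorem continuous_segmentKernel (m : C(ℝ, ℝ)) (e : (ℝ × ℝ) →L[ℝ] ℝ) (s : ℝ) :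
    Continuous fun p : (ℝ × ℝ) × (ℝ × ℝ) => segmentKernel m e s p.1 p.2 := by
  have := continuous_diskBump
  simp only [segmentKernel_apply]
  fun_prop

theorem continuousAt_segmentKernel (m : C(ℝ, ℝ)) (e : (ℝ × ℝ) →L[ℝ] ℝ) {s : ℝ} (hs : s ≠ 0)
    (q : (ℝ × ℝ) × (ℝ × ℝ)) : ContinuousAt
      (fun p : ℝ × (ℝ × ℝ) × (ℝ × ℝ) => segmentKernel m e p.1 p.2.1 p.2.2) (s, q) := by
  simp only [segmentKernel_apply]
  have hinv : ContinuousAt (fun p : ℝ × (ℝ × ℝ) × (ℝ × ℝ) => p.1⁻¹) (s, q) :=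
    continuousAt_fst.inv₀ hs
  have harg : ContinuousAt (fun p : ℝ × (ℝ × ℝ) × (ℝ × ℝ) =>
      p.1⁻¹ • (p.2.2 - (1 - p.1) • p.2.1)) (s, q) :=
    hinv.smul (Continuous.continuousAt (by fun_prop))
  exact (((Continuous.continuousAt (by fun_prop)).mul (hinv.pow 3)).mul
    (continuous_diskBump.continuousAt.comp harg)).mul (Continuous.continuousAt (by fun_prop))

theorem segmentKernel_eq_zero (m : C(ℝ, ℝ)) (e : (ℝ × ℝ) →L[ℝ] ℝ) (s : ℝ) {x z : ℝ × ℝ}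
    (h : s⁻¹ • (z - (1 - s) • x) ∉ disk) : segmentKernel m e s x z = 0 := by
  rw [segmentKernel_apply, diskBump_of_notMem h, mul_zero, zero_mul]

theorem abs_segmentKernel_le {m : C(ℝ, ℝ)} {e : (ℝ × ℝ) →L[ℝ] ℝ} {s M C : ℝ} (hs : 0 < s)
    (hM : |m s| ≤ M) (hC : ∀ y, diskBump y ≤ C) {x z : ℝ × ℝ} (hx : x ∈ disk) :
    |segmentKernel m e s x z| ≤ (2 * M * C * ‖e‖ * s⁻¹ ^ 2) * nearDiagonal (2 * s) x z := by
  have hM0 : 0 ≤ M := (abs_nonneg _).trans hM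
  have hC0 : 0 ≤ C := (diskBump_nonneg 0).trans (hC 0)
  by_cases h : s⁻¹ • (z - (1 - s) • x) ∈ disk
  · have h1 := norm_le_one_of_mem_disk h
    have h2 : z - x = s • (s⁻¹ • (z - (1 - s) • x) - x) := by
      rw [smul_sub, smul_smul, mul_inv_cancel₀ hs.ne', one_smul, sub_smul, one_smul]
      abel
    have h3 : ‖z - x‖ ≤ 2 * s := by
      rw [h2, norm_smul, Real.norm_of_nonneg hs.le, mul_comm]
      gcongr
      exact (norm_sub_le _ _).trans (by linarith [norm_le_one_of_mem_disk hx])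
    have h4 : nearDiagonal (2 * s) x z = 1 :=
      Set.indicator_of_mem (Metric.mem_closedBall.2 (by rwa [dist_eq_norm])) _
    have h5 : |e (x - z)| ≤ ‖e‖ * (2 * s) := by
      refine (e.le_opNorm _).trans ?_
      gcongr
      rwa [norm_sub_rev]
    rw [h4, mul_one, segmentKernel_apply, abs_mul, abs_mul, abs_mul, abs_of_nonneg
      (diskBump_nonneg _), abs_of_nonneg (by positivity : 0 ≤ s⁻¹ ^ 3)]
    calc _ ≤ M * s⁻¹ ^ 3 * C * (‖e‖ * (2 * s)) := by
          refine mul_le_mul (mul_le_mul (by gcongr) (hC _) (diskBump_nonneg _) ?_) h5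
            (abs_nonneg _) ?_ <;> positivity
      _ = _ := by field_simp
  · rw [segmentKernel_eq_zero m e s h, abs_zero]
    exact mul_nonneg (by positivity) (nearDiagonal_nonneg _ _ _)

theorem integral_segmentKernel (m : C(ℝ, ℝ)) (e : (ℝ × ℝ) →L[ℝ] ℝ) (f : C(ℝ × ℝ, ℝ)) {s : ℝ}
    (hs : s ∈ Set.Ioc (0 : ℝ) 1) {x : ℝ × ℝ} (hx : x ∈ disk) :
    ∫ z in disk, segmentKernel m e s x z * f z = segmentAverage m e f s x := by
  have hs0 : s ≠ 0 := hs.1.ne'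
  have harg (y : ℝ × ℝ) : s⁻¹ • ((s • y + (1 - s) • x) - (1 - s) • x) = y := by
    rw [add_sub_cancel_right, smul_smul, inv_mul_cancel₀ hs0, one_smul]
  rw [setIntegral_eq_integral_of_forall_compl_eq_zero, segmentAverage,
    setIntegral_eq_integral_of_forall_compl_eq_zero]
  · have h1 := Measure.integral_comp_smul_of_nonneg (volume : Measure (ℝ × ℝ))
      (fun z => segmentKernel m e s x (z + (1 - s) • x) * f (z + (1 - s) • x)) s (hR := hs.1.le)
    rw [integral_add_right_eq_self fun z => segmentKernel m e s x z * f z] at h1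
    have h2 : Module.finrank ℝ (ℝ × ℝ) = 2 := by simp
    rw [h2, smul_eq_mul, eq_inv_mul_iff_mul_eq₀ (by positivity), ← integral_const_mul] at h1
    rw [← h1]
    refine integral_congr_ae (Eventually.of_forall fun y => ?_)
    have h3 : x - (s • y + (1 - s) • x) = s • (x - y) := by
      rw [smul_sub, sub_smul, one_smul]; abel
    simp only [segmentKernel_apply]
    rw [harg, h3, map_smul, smul_eq_mul, add_comm (s • y)]
    field_simp
  · intro y hy
    rw [diskBump_of_notMem hy, zero_mul]
  · intro z hz
    rw [segmentKernel_eq_zero, zero_mul]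
    intro h
    refine hz ?_
    have := segment_mem_disk hx h ⟨hs.1.le, hs.2⟩
    rwa [smul_smul, mul_inv_cancel₀ hs0, one_smul, add_sub_cancel] at this

/-- The potential `x ↦ ∫₀¹ ∫ θ(y) m(s) e(x - y) f((1 - s) x + s y) dy ds`. -/
def segmentPotential (m : C(ℝ, ℝ)) (e : (ℝ × ℝ) →L[ℝ] ℝ) (f : C(ℝ × ℝ, ℝ)) : C(ℝ × ℝ, ℝ) where
  toFun x := ∫ s in Set.Ioc (0 : ℝ) 1, segmentAverage m e f s x
  continuous_toFun := by
    simp only [← integral_Icc_eq_integral_Ioc]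
    exact continuous_parametric_integral_of_continuous
      (f := fun x s => segmentAverage m e f s x)
      ((continuous_segmentAverage m e f).comp continuous_swap) isCompact_Icc

theorem exists_segmentPotential_operator (m : C(ℝ, ℝ)) (e : (ℝ × ℝ) →L[ℝ] ℝ) :
    ∃ T : Lp ℝ 2 diskMeasure →L[ℝ] Lp ℝ 4 diskMeasure, SmallOnFiniteCodim T ∧
      ∀ f, T (toDiskLp 2 f) = toDiskLp 4 (segmentPotential m e f) := by
  set B : ℝ → Lp ℝ 2 diskMeasure →L[ℝ] Lp ℝ 4 diskMeasure := fun s =>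
    kernelOperator (continuous_toDiskLp_of_continuous_uncurry (continuous_segmentKernel m e s))
    with hB
  obtain ⟨M, hM⟩ := (isCompact_Icc (a := (0 : ℝ)) (b := 1)).exists_bound_of_continuousOn
    m.continuous.continuousOn
  obtain ⟨C, hC0, hC⟩ := exists_diskBump_le
  have hM0 : 0 ≤ M := (norm_nonneg _).trans (hM 0 (by simp))
  have hcont : ContinuousOn B (Set.Ioi 0) :=
    continuousOn_kernelOperator (continuous_segmentKernel m e)
      fun s hs q => continuousAt_segmentKernel m e (ne_of_gt hs) q
  have hbound : ∀ s ∈ Set.Ioc (0 : ℝ) 1, ‖B s‖ ≤ 16 * M * C * ‖e‖ * s ^ (-(1 / 2) : ℝ) := by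
    intro s hs
    have hs0 : 0 < s := hs.1
    refine (norm_kernelOperator_le (continuous_segmentKernel m e s)
      (A := 2 * M * C * ‖e‖ * s⁻¹ ^ 2) (r := 2 * s) (by positivity) (by linarith)
      fun x hx z _ => abs_segmentKernel_le hs0 (hM s ⟨hs0.le, hs.2⟩) hC hx).trans_eq ?_
    have h1 : √(2 * (2 * s)) = 2 * √s := by
      rw [← mul_assoc, Real.sqrt_mul (by norm_num), show (2 * 2 : ℝ) = 2 ^ 2 by norm_num,
        Real.sqrt_sq (by norm_num)]
    have h2 : s ^ (-(1 / 2) : ℝ) = (√s)⁻¹ := by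
      rw [Real.rpow_neg hs0.le, Real.sqrt_eq_rpow]
    rw [h1, h2]
    have h3 : √s ≠ 0 := (Real.sqrt_pos.2 hs0).ne'
    field_simp
    rw [Real.sq_sqrt hs0.le]
    ring
  have hint : IntegrableOn B (Set.Ioc 0 1) := by
    have h1 : IntegrableOn (fun s : ℝ => 16 * M * C * ‖e‖ * s ^ (-(1 / 2) : ℝ)) (Set.Ioc 0 1) :=
      ((intervalIntegrable_iff_integrableOn_Ioc_of_le zero_le_one).1
        (intervalIntegral.intervalIntegrable_rpow' (by norm_num))).const_mul _
    refine Integrable.mono' h1 ?_ ((ae_restrict_mem measurableSet_Ioc).mono hbound)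
    exact (hcont.mono fun s hs => hs.1).aestronglyMeasurable measurableSet_Ioc
  refine ⟨∫ s in Set.Ioc (0 : ℝ) 1, B s,
    SmallOnFiniteCodim.integral (fun s => smallOnFiniteCodim_kernelOperator _) hint, fun f => ?_⟩
  rw [ContinuousLinearMap.integral_apply hint]
  set b : ℝ → C(ℝ × ℝ, ℝ) := fun s =>
    ⟨segmentAverage m e f s, (continuous_segmentAverage m e f).comp (Continuous.prodMk_right s)⟩ with hb
  rw [toDiskLp_integral (b := b) (continuous_segmentAverage m e f) fun x => rfl]
  refine setIntegral_congr_fun measurableSet_Ioc fun s hs => Lp.ext ?_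
  filter_upwards [coeFn_kernelOperator (continuous_toDiskLp_of_continuous_uncurry
    (continuous_segmentKernel m e s)) (toDiskLp 2 f), coeFn_toDiskLp 4 (b s), ae_diskMeasure_mem]
    with x h1 h2 hx
  rw [h2, hB, h1, inner_toDiskLp, integral_segmentKernel m e f hs hx]
  rfl

/-! ### Averaged homotopy formulas -/

theorem fderiv_apply_eq_pd {E : Type*} [NormedAddCommGroup E] [NormedSpace ℝ E]
    (f : ℝ × ℝ → E) (x v : ℝ × ℝ) : fderiv ℝ f x v = v.1 • pd1 f x + v.2 • pd2 f x := by
  rw [pd1, pd2, ← map_smul, ← map_smul, ← map_add]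
  simp

theorem ContDiff.continuous_pd1 {E : Type*} [NormedAddCommGroup E] [NormedSpace ℝ E]
    {f : ℝ × ℝ → E} (hf : ContDiff ℝ 1 f) : Continuous (pd1 f) :=
  (hf.continuous_fderiv (by norm_num)).clm_apply continuous_const

theorem ContDiff.continuous_pd2 {E : Type*} [NormedAddCommGroup E] [NormedSpace ℝ E]
    {f : ℝ × ℝ → E} (hf : ContDiff ℝ 1 f) : Continuous (pd2 f) :=
  (hf.continuous_fderiv (by norm_num)).clm_apply continuous_const

/-- Differentiation under the integral over a compact set. -/
theorem hasFDerivAt_setIntegral_of_continuous {Y E G : Type*} [TopologicalSpace Y]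
    [MeasurableSpace Y] [OpensMeasurableSpace Y] [SecondCountableTopology Y] {μ : Measure Y}
    [IsFiniteMeasureOnCompacts μ] [NormedAddCommGroup E] [NormedSpace ℝ E] [ProperSpace E]
    [NormedAddCommGroup G] [NormedSpace ℝ G] {K : Set Y} (hK : IsCompact K)
    (hKm : MeasurableSet K) {f : E → Y → G} {f' : E → Y → E →L[ℝ] G}
    (hf : Continuous f.uncurry) (hf' : Continuous f'.uncurry)
    (h : ∀ x y, HasFDerivAt (f · y) (f' x y) x) (x : E) :
    HasFDerivAt (fun x => ∫ y in K, f x y ∂μ) (∫ y in K, f' x y ∂μ) x := by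
  obtain ⟨C, hC⟩ := ((isCompact_closedBall x 1).prod hK).exists_bound_of_continuousOn
    hf'.continuousOn
  have hfx : ∀ x, Continuous (f x) := fun x => hf.comp (Continuous.prodMk_right x)
  have hf'x : ∀ x, Continuous (f' x) := fun x => hf'.comp (Continuous.prodMk_right x)
  refine hasFDerivAt_integral_of_dominated_of_fderiv_le (bound := fun _ => C)
    (Metric.ball_mem_nhds x one_pos)
    (Eventually.of_forall fun x => (hfx x).continuousOn.aestronglyMeasurable_of_isCompact hK hKm)
    ((hfx x).continuousOn.integrableOn_of_subset_isCompact hK hKm subset_rfl hK.measure_ne_top)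
    ((hf'x x).continuousOn.aestronglyMeasurable_of_isCompact hK hKm)
    ((ae_restrict_mem hKm).mono fun y hy z hz => ?_)
    (integrableOn_const (hs := hK.measure_ne_top)) (Eventually.of_forall fun y z _ => h z y)
  exact hC (z, y) ⟨Metric.ball_subset_closedBall hz, hy⟩

/-- The product of the unit interval and the disk. -/
def diskCylinder : Set (ℝ × (ℝ × ℝ)) := Set.Icc (0 : ℝ) 1 ×ˢ disk

theorem isCompact_diskCylinder : IsCompact diskCylinder := isCompact_Icc.prod isCompact_disk

theorem measurableSet_diskCylinder : MeasurableSet diskCylinder := isCompact_diskCylinder.measurableSet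

theorem Continuous.integrable_diskCylinder {h : ℝ × (ℝ × ℝ) → ℝ} (hh : Continuous h) :
    IntegrableOn h diskCylinder :=
  hh.continuousOn.integrableOn_compact isCompact_diskCylinder

theorem restrict_diskCylinder : (volume : Measure (ℝ × (ℝ × ℝ))).restrict diskCylinder =
    (volume.restrict (Set.Ioc (0 : ℝ) 1)).prod (volume.restrict disk) := by
  rw [Measure.restrict_congr_set Ioc_ae_eq_Icc, Measure.prod_restrict]
  rfl

theorem integral_diskCylinder {h : ℝ × (ℝ × ℝ) → ℝ} (hh : Continuous h) :
    ∫ p in diskCylinder, h p = ∫ s in Set.Ioc (0 : ℝ) 1, ∫ y in disk, h (s, y) := by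
  have := hh.integrable_diskCylinder
  rw [IntegrableOn, restrict_diskCylinder] at this
  rw [restrict_diskCylinder, integral_prod _ this]

theorem integral_diskCylinder_symm {h : ℝ × (ℝ × ℝ) → ℝ} (hh : Continuous h) :
    ∫ p in diskCylinder, h p = ∫ y in disk, ∫ s in Set.Ioc (0 : ℝ) 1, h (s, y) := by
  have := hh.integrable_diskCylinder
  rw [IntegrableOn, restrict_diskCylinder] at this
  rw [restrict_diskCylinder, integral_prod_symm _ this]

/-- The point with parameter `p.1` on the segment from `x` to `p.2`. -/
def segmentPoint (x : ℝ × ℝ) (p : ℝ × (ℝ × ℝ)) : ℝ × ℝ := (1 - p.1) • x + p.1 • p.2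

theorem continuous_segmentPoint : Continuous (fun q : (ℝ × ℝ) × (ℝ × (ℝ × ℝ)) =>
    segmentPoint q.1 q.2) := by
  unfold segmentPoint
  fun_prop

@[fun_prop]
theorem Continuous.segmentPoint_mk {Y : Type*} [TopologicalSpace Y] {g : Y → ℝ × ℝ}
    {h : Y → ℝ × (ℝ × ℝ)} (hg : Continuous g) (hh : Continuous h) :
    Continuous fun t => segmentPoint (g t) (h t) :=
  continuous_segmentPoint.comp (hg.prodMk hh)

theorem segmentPotential_apply (m : C(ℝ, ℝ)) (e : (ℝ × ℝ) →L[ℝ] ℝ) (f : C(ℝ × ℝ, ℝ))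
    (x : ℝ × ℝ) : segmentPotential m e f x =
      ∫ p in diskCylinder, diskBump p.2 * (m p.1 * e (x - p.2) * f (segmentPoint x p)) := by
  have h1 := continuous_diskBump
  have h2 := f.continuous
  rw [integral_diskCylinder (by fun_prop)]
  rfl

theorem integral_segment {f : ℝ × ℝ → ℝ} (hf : ContDiff ℝ 1 f) (c : ℝ) (x y : ℝ × ℝ) :
    ∫ s in Set.Ioc (0 : ℝ) 1, ((1 - c * s) * fderiv ℝ f (segmentPoint x (s, y)) (x - y)
      + c * f (segmentPoint x (s, y))) = f x - (1 - c) * f y := by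
  have hfd : Continuous (fderiv ℝ f) := hf.continuous_fderiv (by norm_num)
  have h1 : ∀ s, HasDerivAt (fun s => -((1 - c * s) * f (segmentPoint x (s, y))))
      ((1 - c * s) * fderiv ℝ f (segmentPoint x (s, y)) (x - y)
        + c * f (segmentPoint x (s, y))) s := fun s => by
    have h2 : HasDerivAt (fun s : ℝ => segmentPoint x (s, y)) (y - x) s := by
      refine ((((hasDerivAt_id s).const_sub 1).smul_const x).add
        ((hasDerivAt_id s).smul_const y)).congr_deriv ?_
      rw [neg_one_smul, one_smul]
      abel
    have h4 := ((hf.differentiable (by norm_num)) _).hasFDerivAt.comp_hasDerivAt s h2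
    refine ((((hasDerivAt_id s).const_mul c).const_sub 1).mul h4).neg.congr_deriv ?_
    rw [← neg_sub x y, map_neg]
    simp
    ring
  have hc : Continuous fun s => ((1 - c * s) * fderiv ℝ f (segmentPoint x (s, y)) (x - y)
      + c * f (segmentPoint x (s, y))) := by
    have h6 := hf.continuous
    fun_prop
  rw [← intervalIntegral.integral_of_le zero_le_one,
    intervalIntegral.integral_eq_sub_of_hasDerivAt (fun s _ => h1 s) (hc.intervalIntegrable _ _)]
  simp [segmentPoint]
  ring

theorem integral_diskCylinder_fderiv {f : ℝ × ℝ → ℝ} (hf : ContDiff ℝ 1 f) (c : ℝ) (x : ℝ × ℝ) :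
    ∫ p in diskCylinder, diskBump p.2 * ((1 - c * p.1) * fderiv ℝ f (segmentPoint x p) (x - p.2)
      + c * f (segmentPoint x p)) = f x - (1 - c) * ∫ y in disk, diskBump y * f y := by
  have hfd : Continuous (fderiv ℝ f) := hf.continuous_fderiv (by norm_num)
  have h2 := hf.continuous
  have h3 := continuous_diskBump
  rw [integral_diskCylinder_symm (by fun_prop)]
  have h4 : ∀ y, ∫ s in Set.Ioc (0 : ℝ) 1, diskBump y *
      ((1 - c * s) * fderiv ℝ f (segmentPoint x (s, y)) (x - y)
        + c * f (segmentPoint x (s, y))) =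
      diskBump y * f x - (1 - c) * (diskBump y * f y) := fun y => by
    rw [integral_const_mul, integral_segment hf]
    ring
  simp only [h4]
  have h5 := hf.continuous
  rw [integral_sub, integral_mul_const, integral_diskBump, integral_const_mul, one_mul]
  · exact (h3.mul continuous_const).integrable_disk
  · exact (continuous_const.mul (h3.mul h5)).integrable_disk

/-- The weight `s ↦ 1 - s`. -/
def oneSub : C(ℝ, ℝ) where
  toFun s := 1 - s

/-- A `C¹` function is determined by its mean and its gradient. -/
theorem eq_mean_add_segmentPotential {f : ℝ × ℝ → ℝ} (hf : ContDiff ℝ 1 f) (x : ℝ × ℝ) :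
    f x = (∫ y in disk, diskBump y * f y)
      + segmentPotential 1 (ContinuousLinearMap.fst ℝ ℝ ℝ) ⟨pd1 f, hf.continuous_pd1⟩ x
      + segmentPotential 1 (ContinuousLinearMap.snd ℝ ℝ ℝ) ⟨pd2 f, hf.continuous_pd2⟩ x := by
  have h := integral_diskCylinder_fderiv hf 0 x
  have h1 := hf.continuous_pd1
  have h2 := hf.continuous_pd2
  have h3 := continuous_diskBump
  rw [segmentPotential_apply, segmentPotential_apply, add_assoc, ← integral_add, ← sub_eq_iff_eq_add']
  · simp only [sub_zero, one_mul] at h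
    rw [← h]
    refine integral_congr_ae (Eventually.of_forall fun p => ?_)
    simp [fderiv_apply_eq_pd]
    ring
  · exact Continuous.integrable_diskCylinder (by simp only [ContinuousMap.coe_mk]; fun_prop)
  · exact Continuous.integrable_diskCylinder (by simp only [ContinuousMap.coe_mk]; fun_prop)

theorem hasFDerivAt_segmentPotential_one (e : (ℝ × ℝ) →L[ℝ] ℝ) {f : ℝ × ℝ → ℝ}
    (hf : ContDiff ℝ 1 f) :
    ContDiff ℝ 1 (segmentPotential 1 e ⟨f, hf.continuous⟩) ∧
    ∀ x v, fderiv ℝ (segmentPotential 1 e ⟨f, hf.continuous⟩) x v =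
      ∫ p in diskCylinder, diskBump p.2 * (e v * f (segmentPoint x p)
        + (1 - p.1) * e (x - p.2) * fderiv ℝ f (segmentPoint x p) v) := by
  have hfd : Continuous (fderiv ℝ f) := hf.continuous_fderiv (by norm_num)
  have h1 : Continuous fun q : (ℝ × ℝ) × (ℝ × (ℝ × ℝ)) => fderiv ℝ f (segmentPoint q.1 q.2) :=
    hfd.comp continuous_segmentPoint
  have h2 : Continuous fun q : (ℝ × ℝ) × (ℝ × (ℝ × ℝ)) => f (segmentPoint q.1 q.2) :=
    hf.continuous.comp continuous_segmentPoint
  have h3 := continuous_diskBump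
  set g : ℝ × ℝ → ℝ × (ℝ × ℝ) → ℝ := fun x p =>
    diskBump p.2 * (e (x - p.2) * f (segmentPoint x p)) with hg
  set g' : ℝ × ℝ → ℝ × (ℝ × ℝ) → (ℝ × ℝ) →L[ℝ] ℝ := fun x p =>
    diskBump p.2 • (f (segmentPoint x p) • e
      + ((1 - p.1) * e (x - p.2)) • fderiv ℝ f (segmentPoint x p)) with hg'
  have hgc : Continuous g.uncurry := by
    simp only [hg, Function.uncurry_def]
    fun_prop
  have hgc' : Continuous g'.uncurry := by
    simp only [hg', Function.uncurry_def]
    fun_prop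
  have hd : ∀ x p, HasFDerivAt (g · p) (g' x p) x := fun x p => by
    have h4 : HasFDerivAt (fun x => segmentPoint x p)
        ((1 - p.1) • ContinuousLinearMap.id ℝ (ℝ × ℝ)) x :=
      ((hasFDerivAt_id x).const_smul (1 - p.1)).add_const (p.1 • p.2)
    have h5 : HasFDerivAt (fun x => e (x - p.2)) e x :=
      (e.hasFDerivAt.comp x ((hasFDerivAt_id x).sub_const p.2)).congr_fderiv
        e.comp_id
    have h6 := ((hf.differentiable (by norm_num)) (segmentPoint x p)).hasFDerivAt.comp x h4
    refine ((h5.mul h6).const_mul (diskBump p.2)).congr_fderiv ?_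
    ext <;> simp [hg'] <;> ring
  have hχ : (segmentPotential 1 e ⟨f, hf.continuous⟩ : ℝ × ℝ → ℝ) =
      fun x => ∫ p in diskCylinder, g x p := by
    ext x
    rw [segmentPotential_apply]
    simp [hg]
  have hD := hasFDerivAt_setIntegral_of_continuous (μ := volume) isCompact_diskCylinder
    measurableSet_diskCylinder hgc hgc' hd
  have hfderiv : fderiv ℝ (fun x => ∫ p in diskCylinder, g x p) = fun x => ∫ p in diskCylinder, g' x p :=
    funext fun x => (hD x).fderiv
  rw [hχ]
  refine ⟨contDiff_one_iff_fderiv.2 ⟨fun x => (hD x).differentiableAt, ?_⟩, fun x v => ?_⟩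
  · rw [hfderiv]
    exact continuous_parametric_integral_of_continuous hgc' isCompact_diskCylinder
  · have hi : IntegrableOn (g' x) diskCylinder :=
      (hgc'.comp (Continuous.prodMk_right x)).continuousOn.integrableOn_compact isCompact_diskCylinder
    rw [hfderiv]
    simp only
    rw [ContinuousLinearMap.integral_apply hi]
    refine integral_congr_ae (Eventually.of_forall fun p => ?_)
    simp [hg']
    ring

/-- Every `C¹` vector field is the sum of a gradient and a potential of its curl. -/
theorem exists_gauge {a1 a2 : ℝ × ℝ → ℝ} (h1 : ContDiff ℝ 1 a1) (h2 : ContDiff ℝ 1 a2)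
    (hF : Continuous (curv a1 a2)) :
    ∃ χ : ℝ × ℝ → ℝ, ContDiff ℝ 1 χ ∧
      (∀ x, pd1 χ x = a1 x + segmentPotential oneSub (ContinuousLinearMap.snd ℝ ℝ ℝ)
        ⟨curv a1 a2, hF⟩ x) ∧
      ∀ x, pd2 χ x = a2 x - segmentPotential oneSub (ContinuousLinearMap.fst ℝ ℝ ℝ)
        ⟨curv a1 a2, hF⟩ x := by
  obtain ⟨c1, d1⟩ := hasFDerivAt_segmentPotential_one (ContinuousLinearMap.fst ℝ ℝ ℝ) h1
  obtain ⟨c2, d2⟩ := hasFDerivAt_segmentPotential_one (ContinuousLinearMap.snd ℝ ℝ ℝ) h2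
  have hd : ∀ x v, fderiv ℝ (fun x => segmentPotential 1 (ContinuousLinearMap.fst ℝ ℝ ℝ)
        ⟨a1, h1.continuous⟩ x + segmentPotential 1 (ContinuousLinearMap.snd ℝ ℝ ℝ)
        ⟨a2, h2.continuous⟩ x) x v = v.1 * a1 x + v.2 * a2 x
        + ∫ p in diskCylinder, diskBump p.2 * ((1 - p.1) *
          (v.1 * (x - p.2).2 - v.2 * (x - p.2).1) * curv a1 a2 (segmentPoint x p)) := by
    intro x v
    rw [fderiv_fun_add (c1.differentiable (by norm_num) x) (c2.differentiable (by norm_num) x),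
      _root_.add_apply, d1, d2]
    have e1 := integral_diskCylinder_fderiv h1 1 x
    have e2 := integral_diskCylinder_fderiv h2 1 x
    simp only [sub_self, zero_mul, sub_zero] at e1 e2
    have k1 := (h1.continuous_fderiv (by norm_num))
    have k2 := (h2.continuous_fderiv (by norm_num))
    have k3 := h1.continuous
    have k4 := h2.continuous
    have k5 := continuous_diskBump
    have k6 := hF
    rw [← e1, ← e2, ← integral_const_mul, ← integral_const_mul, ← integral_add, ← integral_add,
      ← integral_add]
    · refine integral_congr_ae (Eventually.of_forall fun p => ?_)
      simp [fderiv_apply_eq_pd, curv]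
      ring
    all_goals exact Continuous.integrable_diskCylinder (by fun_prop)
  refine ⟨_, c1.add c2, fun x => ?_, fun x => ?_⟩
  · rw [pd1, hd, segmentPotential_apply]
    simp [oneSub]
  · rw [pd2, hd, segmentPotential_apply]
    rw [sub_eq_add_neg, ← integral_neg]
    simp only [zero_mul, zero_add, one_mul, zero_sub]
    congr 1
    refine integral_congr_ae (Eventually.of_forall fun p => ?_)
    simp [oneSub]
    ring

/-! ### The divergence theorem on the disk for tangential fields -/

theorem convex_disk : Convex ℝ disk := by
  intro x hx y hy a b ha hb hab
  have hx' : x.1 ^ 2 + x.2 ^ 2 ≤ 1 := hx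
  have hy' : y.1 ^ 2 + y.2 ^ 2 ≤ 1 := hy
  change (a * x.1 + b * y.1) ^ 2 + (a * x.2 + b * y.2) ^ 2 ≤ 1
  have h1 : a * b * ((x.1 - y.1) ^ 2 + (x.2 - y.2) ^ 2) ≥ 0 := by positivity
  have h2 := mul_le_mul_of_nonneg_left hx' ha
  have h3 := mul_le_mul_of_nonneg_left hy' hb
  obtain rfl : b = 1 - a := by linarith
  nlinarith

theorem ae_disk_lt : ∀ᵐ x ∂(volume.restrict disk), x.1 ^ 2 + x.2 ^ 2 < (1 : ℝ) := by
  have h : volume {x : ℝ × ℝ | x.1 ^ 2 + x.2 ^ 2 = 1} = 0 := by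
    rw [Measure.volume_eq_prod, Measure.measure_prod_null
      (isClosed_eq (by fun_prop) continuous_const).measurableSet]
    refine Eventually.of_forall fun x => Set.Finite.measure_zero ?_ _
    refine (Set.toFinite {√(1 - x ^ 2), -√(1 - x ^ 2)}).subset fun y hy => ?_
    have hy' : x ^ 2 + y ^ 2 = 1 := hy
    have hs : √(1 - x ^ 2) = |y| := by rw [← Real.sqrt_sq_eq_abs]; congr 1; linarith
    rw [hs]
    rcases abs_choice y with h | h <;> rw [h] <;> simp
  filter_upwards [ae_restrict_of_ae (compl_mem_ae_iff.2 h), ae_diskMeasure_mem] with x h1 h2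
  exact lt_of_le_of_ne h2 h1

/-- A `C¹` function vanishing on the unit circle is bounded by the distance to the circle. -/
theorem exists_bound_of_eq_zero_on_circle {g : ℝ × ℝ → ℝ} (hg : ContDiff ℝ 1 g) (h0 : g 0 = 0)
    (h : ∀ x, x.1 ^ 2 + x.2 ^ 2 = 1 → g x = 0) :
    ∃ C, 0 ≤ C ∧ ∀ x ∈ disk, |g x| ≤ C * (1 - (x.1 ^ 2 + x.2 ^ 2)) := by
  obtain ⟨C, hC⟩ := isCompact_disk.exists_bound_of_continuousOn
    (hg.continuous_fderiv (by norm_num)).continuousOn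
  have hC0 : 0 ≤ C := (norm_nonneg _).trans (hC 0 (by simp [disk]))
  refine ⟨C, hC0, fun x hx => ?_⟩
  have hx' : x.1 ^ 2 + x.2 ^ 2 ≤ 1 := hx
  rcases eq_or_ne x 0 with rfl | hne
  · rw [h0, abs_zero]
    exact mul_nonneg hC0 (by simp)
  set r := √(x.1 ^ 2 + x.2 ^ 2) with hr
  have hpos : 0 < x.1 ^ 2 + x.2 ^ 2 := by
    rcases not_and_or.1 (fun h : x.1 = 0 ∧ x.2 = 0 => hne (Prod.ext h.1 h.2)) with h | h <;>
      positivity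
  have hr0 : 0 < r := Real.sqrt_pos.2 hpos
  have hr2 : r ^ 2 = x.1 ^ 2 + x.2 ^ 2 := Real.sq_sqrt hpos.le
  have hr1 : r ≤ 1 := by nlinarith
  set y : ℝ × ℝ := r⁻¹ • x with hy
  have hy1 : y.1 ^ 2 + y.2 ^ 2 = 1 := by
    simp only [hy, Prod.smul_fst, Prod.smul_snd, smul_eq_mul, mul_pow]
    rw [← mul_add, ← hr2]
    field_simp
  have hmv := convex_disk.norm_image_sub_le_of_norm_fderiv_le
    (fun z _ => hg.differentiable (by norm_num) z) hC (show y ∈ disk from hy1.le) hx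
  rw [h y hy1, sub_zero, Real.norm_eq_abs] at hmv
  refine hmv.trans (mul_le_mul_of_nonneg_left ?_ hC0)
  have hxy : x - y = (r - 1) • y := by
    rw [sub_smul, one_smul, hy, smul_smul, mul_inv_cancel₀ hr0.ne', one_smul]
  rw [hxy, norm_smul, ← hr2, Real.norm_eq_abs, abs_of_nonpos (by linarith)]
  have hyn := norm_le_one_of_mem_disk (show y ∈ disk from hy1.le)
  nlinarith [norm_nonneg y]

/-- Smooth cutoff functions exhausting the disk. -/
def diskCutoff (n : ℕ) (x : ℝ × ℝ) : ℝ :=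
  Real.smoothTransition (n * (1 - (x.1 ^ 2 + x.2 ^ 2)) - 1)

theorem contDiff_diskCutoff (n : ℕ) : ContDiff ℝ 1 (diskCutoff n) :=
  (Real.smoothTransition.contDiff (n := 1)).comp (by fun_prop)

theorem diskCutoff_of_notMem (n : ℕ) {x : ℝ × ℝ} (hx : x ∉ disk) : diskCutoff n x = 0 := by
  have hx' : 1 < x.1 ^ 2 + x.2 ^ 2 := not_le.1 hx
  refine Real.smoothTransition.zero_of_nonpos ?_
  have : (0 : ℝ) ≤ n := n.cast_nonneg
  nlinarith

theorem hasCompactSupport_diskCutoff (n : ℕ) : HasCompactSupport (diskCutoff n) :=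
  HasCompactSupport.of_support_subset_isCompact isCompact_disk fun x hx => by
    by_contra h
    exact hx (diskCutoff_of_notMem n h)

theorem fderiv_diskCutoff (n : ℕ) (x v : ℝ × ℝ) : fderiv ℝ (diskCutoff n) x v =
    -2 * n * (x.1 * v.1 + x.2 * v.2)
      * deriv Real.smoothTransition (n * (1 - (x.1 ^ 2 + x.2 ^ 2)) - 1) := by
  have h1 : HasFDerivAt (fun x : ℝ × ℝ => (n : ℝ) * (1 - (x.1 ^ 2 + x.2 ^ 2)) - 1)
      ((n : ℝ) • -((2 * x.1) • ContinuousLinearMap.fst ℝ ℝ ℝ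
        + (2 * x.2) • ContinuousLinearMap.snd ℝ ℝ ℝ)) x := by
    have h2 : HasFDerivAt (fun x : ℝ × ℝ => x.1) (ContinuousLinearMap.fst ℝ ℝ ℝ) x :=
      hasFDerivAt_fst
    have h3 : HasFDerivAt (fun x : ℝ × ℝ => x.2) (ContinuousLinearMap.snd ℝ ℝ ℝ) x :=
      hasFDerivAt_snd
    refine (((((h2.pow 2).add (h3.pow 2)).const_sub 1).const_mul (n : ℝ)).sub_const 1).congr_fderiv
      ?_
    simp
  have h4 := ((Real.smoothTransition.contDiff (n := 1)).differentiable (by norm_num)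
    (n * (1 - (x.1 ^ 2 + x.2 ^ 2)) - 1)).hasDerivAt.comp_hasFDerivAt x h1
  rw [show diskCutoff n = Real.smoothTransition ∘
    fun x : ℝ × ℝ => (n : ℝ) * (1 - (x.1 ^ 2 + x.2 ^ 2)) - 1 from rfl, h4.fderiv]
  simp
  ring

theorem deriv_smoothTransition_of_nonpos {t : ℝ} (ht : t ≤ 0) :
    deriv Real.smoothTransition t = 0 := by
  refine IsLocalMin.deriv_eq_zero (Eventually.of_forall fun s => ?_)
  rw [Real.smoothTransition.zero_of_nonpos ht]
  exact Real.smoothTransition.nonneg s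

theorem deriv_smoothTransition_of_one_le {t : ℝ} (ht : 1 ≤ t) :
    deriv Real.smoothTransition t = 0 := by
  refine IsLocalMax.deriv_eq_zero (Eventually.of_forall fun s => ?_)
  rw [Real.smoothTransition.one_of_one_le ht]
  exact Real.smoothTransition.le_one s

theorem integral_diskCutoff_mul_fderiv (n : ℕ) {V : ℝ × ℝ → ℝ} (hV : ContDiff ℝ 1 V)
    (v : ℝ × ℝ) : ∫ x in disk, diskCutoff n x * fderiv ℝ V x v =
      ∫ x in disk, 2 * n * (x.1 * v.1 + x.2 * v.2)
        * deriv Real.smoothTransition (n * (1 - (x.1 ^ 2 + x.2 ^ 2)) - 1) * V x := by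
  have h1 := contDiff_diskCutoff n
  have h2 := hasCompactSupport_diskCutoff n
  have hV' : Continuous fun x => fderiv ℝ V x v :=
    (hV.continuous_fderiv (by norm_num)).clm_apply continuous_const
  have h1' : Continuous fun x => fderiv ℝ (diskCutoff n) x v :=
    (h1.continuous_fderiv (by norm_num)).clm_apply continuous_const
  have h2' : HasCompactSupport fun x => fderiv ℝ (diskCutoff n) x v :=
    (h2.fderiv (𝕜 := ℝ)).comp_left (g := fun L : (ℝ × ℝ) →L[ℝ] ℝ => L v) rfl
  have h3 := integral_mul_fderiv_eq_neg_fderiv_mul_of_integrable (μ := volume)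
    (f := diskCutoff n) (g := V) (v := v)
    ((h1'.mul hV.continuous).integrable_of_hasCompactSupport h2'.mul_right)
    ((h1.continuous.mul hV').integrable_of_hasCompactSupport h2.mul_right)
    ((h1.continuous.mul hV.continuous).integrable_of_hasCompactSupport h2.mul_right)
    (fun x _ => h1.differentiable (by norm_num) x) (fun x _ => hV.differentiable (by norm_num) x)
  rw [setIntegral_eq_integral_of_forall_compl_eq_zero, h3, ← integral_neg,
    setIntegral_eq_integral_of_forall_compl_eq_zero]
  · refine integral_congr_ae (Eventually.of_forall fun x => ?_)
    simp only [fderiv_diskCutoff]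
    ring
  · intro x hx
    have hx' : 1 < x.1 ^ 2 + x.2 ^ 2 := not_le.1 hx
    rw [deriv_smoothTransition_of_nonpos, mul_zero, zero_mul]
    have : (0 : ℝ) ≤ n := n.cast_nonneg
    nlinarith
  · intro x hx
    rw [diskCutoff_of_notMem n hx, zero_mul]

theorem integral_divergence_disk {V1 V2 : ℝ × ℝ → ℝ} (h1 : ContDiff ℝ 1 V1)
    (h2 : ContDiff ℝ 1 V2)
    (h : ∀ x : ℝ × ℝ, x.1 ^ 2 + x.2 ^ 2 = 1 → x.1 * V1 x + x.2 * V2 x = 0) :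
    ∫ x in disk, (pd1 V1 x + pd2 V2 x) = 0 := by
  set g : ℝ × ℝ → ℝ := fun x => x.1 * V1 x + x.2 * V2 x with hg
  have hgc : ContDiff ℝ 1 g := (contDiff_fst.mul h1).add (contDiff_snd.mul h2)
  obtain ⟨C, hC0, hC⟩ := exists_bound_of_eq_zero_on_circle hgc (by simp [hg]) h
  have hst := (Real.smoothTransition.contDiff (n := 1)).continuous_deriv le_rfl
  obtain ⟨B, hB⟩ := (isCompact_Icc (a := (0 : ℝ)) (b := 1)).exists_bound_of_continuousOn
    hst.continuousOn
  have hB0 : 0 ≤ B := (norm_nonneg _).trans (hB 0 (by simp))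
  have hp1 := h1.continuous_pd1
  have hp2 := h2.continuous_pd2
  set ψ : ℕ → ℝ × ℝ → ℝ := fun n x =>
    2 * n * g x * deriv Real.smoothTransition (n * (1 - (x.1 ^ 2 + x.2 ^ 2)) - 1) with hψ
  have heq : ∀ n, ∫ x in disk, diskCutoff n x * (pd1 V1 x + pd2 V2 x) = ∫ x in disk, ψ n x := by
    intro n
    have hn := (contDiff_diskCutoff n).continuous
    have e1 := integral_diskCutoff_mul_fderiv n h1 ((1 : ℝ), (0 : ℝ))
    have e2 := integral_diskCutoff_mul_fderiv n h2 ((0 : ℝ), (1 : ℝ))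
    have c1 := h1.continuous
    have c2 := h2.continuous
    have hst' : Continuous fun x : ℝ × ℝ =>
      deriv Real.smoothTransition (n * (1 - (x.1 ^ 2 + x.2 ^ 2)) - 1) := hst.comp (by fun_prop)
    simp only [mul_add]
    refine (integral_add (hn.mul hp1).integrable_disk (hn.mul hp2).integrable_disk).trans ?_
    refine (congrArg₂ (· + ·) e1 e2).trans ?_
    rw [← integral_add]
    · refine integral_congr_ae (Eventually.of_forall fun x => ?_)
      simp only [hψ, hg]
      ring
    · exact Continuous.integrable_disk (by fun_prop)
    · exact Continuous.integrable_disk (by fun_prop)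
  have hev : ∀ x : ℝ × ℝ, x.1 ^ 2 + x.2 ^ 2 < 1 →
      ∀ᶠ n : ℕ in atTop, 1 ≤ n * (1 - (x.1 ^ 2 + x.2 ^ 2)) - 1 := fun x hx => by
    filter_upwards [eventually_ge_atTop ⌈2 / (1 - (x.1 ^ 2 + x.2 ^ 2))⌉₊] with n hn
    have := (div_le_iff₀ (by linarith)).1 (Nat.ceil_le.1 hn)
    linarith
  have hlim1 : Tendsto (fun n => ∫ x in disk, diskCutoff n x * (pd1 V1 x + pd2 V2 x)) atTop
      (𝓝 (∫ x in disk, (pd1 V1 x + pd2 V2 x))) := by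
    refine tendsto_integral_of_dominated_convergence (fun x => ‖pd1 V1 x + pd2 V2 x‖)
      (fun n => ((contDiff_diskCutoff n).continuous.mul (hp1.add hp2)).aestronglyMeasurable)
      (hp1.add hp2).norm.integrable_disk (fun n => Eventually.of_forall fun x => ?_) ?_
    · rw [norm_mul]
      refine mul_le_of_le_one_left (norm_nonneg _) ?_
      rw [diskCutoff, Real.norm_eq_abs, abs_of_nonneg (Real.smoothTransition.nonneg _)]
      exact Real.smoothTransition.le_one _
    · filter_upwards [ae_disk_lt] with x hx
      refine tendsto_const_nhds.congr' ?_
      filter_upwards [hev x hx] with n hn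
      rw [diskCutoff, Real.smoothTransition.one_of_one_le hn, one_mul]
  have hlim2 : Tendsto (fun n => ∫ x in disk, ψ n x) atTop (𝓝 (∫ x in disk, (0 : ℝ))) := by
    refine tendsto_integral_of_dominated_convergence (fun _ => 4 * C * B)
      (fun n => Continuous.aestronglyMeasurable ?_) (integrable_const (μ := diskMeasure) _)
      (fun n => ?_) ?_
    · have hst' : Continuous fun x : ℝ × ℝ =>
        deriv Real.smoothTransition (n * (1 - (x.1 ^ 2 + x.2 ^ 2)) - 1) := hst.comp (by fun_prop)
      have c3 := hgc.continuous
      fun_prop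
    · filter_upwards [ae_diskMeasure_mem] with x hx
      have hgx := hC x hx
      set t := (n : ℝ) * (1 - (x.1 ^ 2 + x.2 ^ 2)) - 1 with ht
      have hbd : 0 ≤ 4 * C * B := by positivity
      rcases le_total t 0 with h0 | h0
      · simp only [hψ]
        rwa [deriv_smoothTransition_of_nonpos h0, mul_zero, norm_zero]
      rcases le_total 1 t with h0' | h0'
      · simp only [hψ]
        rwa [deriv_smoothTransition_of_one_le h0', mul_zero, norm_zero]
      simp only [hψ]
      rw [norm_mul]
      refine mul_le_mul ?_ (hB t ⟨h0, h0'⟩) (norm_nonneg _) (by positivity)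
      rw [norm_mul, Real.norm_eq_abs, Real.norm_eq_abs, abs_of_nonneg (by positivity)]
      calc 2 * n * |g x| ≤ 2 * n * (C * (1 - (x.1 ^ 2 + x.2 ^ 2))) := by gcongr
        _ = 2 * C * (t + 1) := by rw [ht]; ring
        _ ≤ 4 * C := by nlinarith
    · filter_upwards [ae_disk_lt] with x hx
      refine tendsto_const_nhds.congr' ?_
      filter_upwards [hev x hx] with n hn
      simp only [hψ]
      rw [deriv_smoothTransition_of_one_le hn, mul_zero]
  simp only [heq] at hlim1
  rw [tendsto_nhds_unique hlim1 hlim2, integral_zero]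

/-! ### Energies quadratic in a lower order term -/

section QuadraticEnergy

variable {H L Z : Type} [NormedAddCommGroup H] [InnerProductSpace ℝ H]
  [NormedAddCommGroup L] [InnerProductSpace ℝ L] [NormedAddCommGroup Z] [NormedSpace ℝ Z]

/-- The energy `½‖w - f + Q(Kw, Kw)‖² + a⟨e, R(Kw, Kw)⟩ + b‖R(Kw, Kw)‖²`. -/
def quadraticEnergy (K : H →L[ℝ] Z) (Q : Z →L[ℝ] Z →L[ℝ] H) (R : Z →L[ℝ] Z →L[ℝ] L) (f : H)
    (e : L) (a b : ℝ) (w : H) : ℝ :=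
  1 / 2 * ‖w - f + Q (K w) (K w)‖ ^ 2 + a * inner ℝ e (R (K w) (K w))
    + b * ‖R (K w) (K w)‖ ^ 2

/-- The derivative of `quadraticEnergy`. -/
def quadraticEnergyDeriv (K : H →L[ℝ] Z) (Q : Z →L[ℝ] Z →L[ℝ] H) (R : Z →L[ℝ] Z →L[ℝ] L) (f : H)
    (e : L) (a b : ℝ) (w v : H) : ℝ :=
  inner ℝ (w - f + Q (K w) (K w)) (v + (Q (K w) (K v) + Q (K v) (K w)))
    + a * inner ℝ e (R (K w) (K v) + R (K v) (K w))
    + b * (2 * inner ℝ (R (K w) (K w)) (R (K w) (K v) + R (K v) (K w)))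

theorem ContinuousLinearMap.hasFDerivAt_apply_self {Y : Type*} [NormedAddCommGroup Y]
    [NormedSpace ℝ Y] (K : H →L[ℝ] Z) (B : Z →L[ℝ] Z →L[ℝ] Y) (w : H) :
    HasFDerivAt (fun w => B (K w) (K w))
      ((B (K w)).comp K + (B.flip (K w)).comp K) w := by
  refine ((B.comp K).hasFDerivAt.clm_apply K.hasFDerivAt).congr_fderiv ?_
  ext v
  simp

theorem hasFDerivAt_quadraticEnergy (K : H →L[ℝ] Z) (Q : Z →L[ℝ] Z →L[ℝ] H)
    (R : Z →L[ℝ] Z →L[ℝ] L) (f : H) (e : L) (a b : ℝ) (w : H) :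
    ∃ E' : H →L[ℝ] ℝ, HasFDerivAt (quadraticEnergy K Q R f e a b) E' w ∧
      ∀ v, E' v = quadraticEnergyDeriv K Q R f e a b w v := by
  have hQ := ((hasFDerivAt_id w).sub_const f).add (K.hasFDerivAt_apply_self Q w)
  have hR := K.hasFDerivAt_apply_self R w
  refine ⟨_, ((hQ.norm_sq.const_mul (1 / 2)).add
    (((hasFDerivAt_const e w).inner ℝ hR).const_mul a)).add (hR.norm_sq.const_mul b), fun v => ?_⟩
  simp [quadraticEnergyDeriv, inner_add_left, inner_add_right, inner_sub_left]
  ring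

theorem finite_image_quadraticEnergy [CompleteSpace H] [CompleteSpace Z] {K : H →L[ℝ] Z}
    (hK : SmallOnFiniteCodim K) (Q : Z →L[ℝ] Z →L[ℝ] H) (R : Z →L[ℝ] Z →L[ℝ] L) (f : H)
    (e : L) (a b : ℝ) (D : Submodule ℝ H) (r : ℝ) :
    (quadraticEnergy K Q R f e a b '' {w | w ∈ D ∧ ‖w‖ ≤ r ∧
      ∀ v ∈ D, quadraticEnergyDeriv K Q R f e a b w v = 0}).Finite := by
  set X := D.topologicalClosure
  have : CompleteSpace X := D.isClosed_topologicalClosure.completeSpace_coe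
  set N : Z → ℝ := fun z => a * inner ℝ e (R z z) + b * ‖R z z‖ ^ 2
  have hQ : ContDiff ℝ ω fun z => Q z z - f :=
    (Q.contDiff.clm_apply contDiff_id).sub contDiff_const
  have hR : ContDiff ℝ ω fun z => R z z := R.contDiff.clm_apply contDiff_id
  have hfin := finite_image_criticalPoints (X := X) (Z := Z) (K := K.comp X.subtypeL)
    (G := fun z => X.orthogonalProjectionOnto (Q z z - f))
    (M := fun z => 1 / 2 * ‖Q z z - f‖ ^ 2 + N z)
    (E := fun u => quadraticEnergy K Q R f e a b u) (hK.precomp X.subtypeL)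
    (X.orthogonalProjectionOnto.contDiff.comp hQ)
    ((contDiff_const.mul (hQ.norm_sq ℝ)).add
      ((contDiff_const.mul (contDiff_const.inner ℝ hR)).add (contDiff_const.mul (hR.norm_sq ℝ))))
    (fun u => ?_) r
  · refine hfin.subset ?_
    rintro _ ⟨w, ⟨hwD, hwr, hw⟩, rfl⟩
    refine ⟨⟨w, D.le_topologicalClosure hwD⟩, ⟨?_, hwr⟩, rfl⟩
    obtain ⟨E', hE', hE'v⟩ := hasFDerivAt_quadraticEnergy K Q R f e a b w
    have h0 : X ≤ LinearMap.ker (E' : H →ₗ[ℝ] ℝ) :=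
      D.topologicalClosure_minimal (fun v hv => (hE'v v).trans (hw v hv)) E'.isClosed_ker
    have hE'' := HasFDerivAt.comp (⟨w, D.le_topologicalClosure hwD⟩ : X) hE' X.subtypeL.hasFDerivAt
    refine hE''.fderiv.trans ?_
    ext v
    exact h0 v.2
  · have h1 : inner ℝ u (X.orthogonalProjectionOnto (Q (K u) (K u) - f)) =
        inner ℝ (u : H) (Q (K u) (K u) - f) :=
      Submodule.inner_orthogonalProjectionOnto_eq_of_mem_left u _
    have h2 : (u : H) - f + Q (K u) (K u) = u + (Q (K u) (K u) - f) := by abel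
    simp only [quadraticEnergy, ContinuousLinearMap.comp_apply, Submodule.subtypeL_apply, h1, h2,
      norm_add_sq_real, N, Submodule.coe_norm]
    ring

end QuadraticEnergy

/-! ### The Ginzburg–Landau energy as a quadratic energy -/

/-- The space of `C¹` functions on the plane. -/
def C1Functions : Submodule ℝ (ℝ × ℝ → ℝ) where
  carrier := {f | ContDiff ℝ 1 f}
  add_mem' hf hg := by
    rw [Set.mem_ofPred_eq] at *
    exact ContDiff.add hf hg
  zero_mem' := by
    rw [Set.mem_ofPred_eq]
    exact contDiff_const
  smul_mem' c _ hf := by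
    rw [Set.mem_ofPred_eq] at *
    exact contDiff_const.smul hf

theorem contDiff_C1 (f : C1Functions) : ContDiff ℝ 1 (f : ℝ × ℝ → ℝ) := f.2

/-- The inclusion of `C¹` functions in continuous functions. -/
def valC : C1Functions →ₗ[ℝ] C(ℝ × ℝ, ℝ) where
  toFun f := ⟨f, (contDiff_C1 f).continuous⟩
  map_add' _ _ := rfl
  map_smul' _ _ := rfl

/-- The first partial derivative on `C¹` functions. -/
def pd1C : C1Functions →ₗ[ℝ] C(ℝ × ℝ, ℝ) where
  toFun f := ⟨pd1 f, ContDiff.continuous_pd1 (contDiff_C1 f)⟩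
  map_add' f g := by
    ext x
    have h := fderiv_add ((contDiff_C1 f).differentiable one_ne_zero x) ((contDiff_C1 g).differentiable one_ne_zero x)
    exact congrArg (fun L => L (1, 0)) h
  map_smul' c f := by
    ext x
    have h := fderiv_const_smul ((contDiff_C1 f).differentiable one_ne_zero x) c
    exact congrArg (fun L => L (1, 0)) h

/-- The second partial derivative on `C¹` functions. -/
def pd2C : C1Functions →ₗ[ℝ] C(ℝ × ℝ, ℝ) where
  toFun f := ⟨pd2 f, ContDiff.continuous_pd2 (contDiff_C1 f)⟩
  map_add' f g := by
    ext x
    have h := fderiv_add ((contDiff_C1 f).differentiable one_ne_zero x) ((contDiff_C1 g).differentiable one_ne_zero x)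
    exact congrArg (fun L => L (0, 1)) h
  map_smul' c f := by
    ext x
    have h := fderiv_const_smul ((contDiff_C1 f).differentiable one_ne_zero x) c
    exact congrArg (fun L => L (0, 1)) h

/-- Quadruples `(a₁, a₂, Re φ, Im φ)` of `C¹` functions. -/
abbrev C1Fields : Type := C1Functions × C1Functions × C1Functions × C1Functions

/-- The curl of the first two components. -/
def curlC : C1Fields →ₗ[ℝ] C(ℝ × ℝ, ℝ) where
  toFun b := pd1C b.2.1 - pd2C b.1
  map_add' b c := by
    rw [Prod.snd_add, Prod.fst_add, Prod.fst_add, map_add, map_add]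
    abel
  map_smul' r b := by
    rw [Prod.smul_snd, Prod.smul_fst, Prod.smul_fst, map_smul, map_smul, ← smul_sub]
    rfl

/-- The square integrable functions on the disk. -/
abbrev DiskL2 : Type := Lp ℝ 2 diskMeasure

/-- The functions on the disk with integrable fourth power. -/
abbrev DiskL4 : Type := Lp ℝ 4 diskMeasure

/-- The space of curvatures, values and partial derivatives. -/
abbrev JetSpace : Type := PiLp 2 fun _ : Fin 7 => DiskL2

/-- The space of vector potentials and values. -/
abbrev FieldSpace : Type := DiskL4 × DiskL4 × DiskL4 × DiskL4

/-- The list of curl, values and first partial derivatives. -/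
def jet : C1Fields →ₗ[ℝ] JetSpace where
  toFun b := WithLp.toLp 2 fun i => toDiskLp 2 (![curlC b, valC b.2.2.1, valC b.2.2.2,
    pd1C b.2.2.1, pd1C b.2.2.2, pd2C b.2.2.1, pd2C b.2.2.2] i)
  map_add' b c := by
    ext1 i
    fin_cases i <;> simp [map_add]
  map_smul' r b := by
    ext1 i
    fin_cases i <;> simp

/-- The operator given by a segment potential. -/
def segmentOperator (m : C(ℝ, ℝ)) (e : (ℝ × ℝ) →L[ℝ] ℝ) : DiskL2 →L[ℝ] DiskL4 :=
  (exists_segmentPotential_operator m e).choose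

theorem smallOnFiniteCodim_segmentOperator (m : C(ℝ, ℝ)) (e : (ℝ × ℝ) →L[ℝ] ℝ) :
    SmallOnFiniteCodim (segmentOperator m e) :=
  (exists_segmentPotential_operator m e).choose_spec.1

theorem segmentOperator_toDiskLp (m : C(ℝ, ℝ)) (e : (ℝ × ℝ) →L[ℝ] ℝ) (f : C(ℝ × ℝ, ℝ)) :
    segmentOperator m e (toDiskLp 2 f) = toDiskLp 4 (segmentPotential m e f) :=
  (exists_segmentPotential_operator m e).choose_spec.2 f

/-- The operator sending a function to its weighted mean. -/
def meanOperator : DiskL2 →L[ℝ] DiskL4 :=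
  (innerSL ℝ (toDiskLp 2 ⟨diskBump, continuous_diskBump⟩)).smulRight (toDiskLp 4 1)

/-- Recovers a function from its mean and its gradient. -/
def primitiveOperator (i j k : Fin 7) : JetSpace →L[ℝ] DiskL4 :=
  meanOperator.comp (PiLp.proj 2 _ i)
    + ((segmentOperator 1 (ContinuousLinearMap.fst ℝ ℝ ℝ)).comp (PiLp.proj 2 _ j)
      + (segmentOperator 1 (ContinuousLinearMap.snd ℝ ℝ ℝ)).comp (PiLp.proj 2 _ k))

theorem smallOnFiniteCodim_primitiveOperator (i j k : Fin 7) :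
    SmallOnFiniteCodim (primitiveOperator i j k) :=
  ((SmallOnFiniteCodim.smulRight _ _).precomp _).add
    (((smallOnFiniteCodim_segmentOperator _ _).precomp _).add
      ((smallOnFiniteCodim_segmentOperator _ _).precomp _))

theorem primitiveOperator_jet {i j k : Fin 7} {w : JetSpace} (f : C1Functions)
    (hi : w i = toDiskLp 2 (valC f)) (hj : w j = toDiskLp 2 (pd1C f))
    (hk : w k = toDiskLp 2 (pd2C f)) : primitiveOperator i j k w = toDiskLp 4 (valC f) := by
  have h1 : meanOperator (toDiskLp 2 (valC f)) =
      toDiskLp 4 ((∫ y in disk, diskBump y * f.1 y) • (1 : C(ℝ × ℝ, ℝ))) := by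
    rw [meanOperator, ContinuousLinearMap.smulRight_apply, innerSL_apply_apply, inner_toDiskLp,
      map_smul]
    rfl
  have h2 : primitiveOperator i j k w = meanOperator (w i)
      + (segmentOperator 1 (ContinuousLinearMap.fst ℝ ℝ ℝ) (w j)
        + segmentOperator 1 (ContinuousLinearMap.snd ℝ ℝ ℝ) (w k)) := rfl
  rw [h2, hi, hj, hk, h1, segmentOperator_toDiskLp, segmentOperator_toDiskLp, ← map_add, ← map_add]
  congr 1
  ext x
  have h3 := eq_mean_add_segmentPotential (contDiff_C1 f) x
  refine Eq.trans ?_ h3.symm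
  rw [add_assoc]
  simp
  rfl

/-- The vector potential and the values of a jet. -/
def fieldOperator : JetSpace →L[ℝ] FieldSpace :=
  ((-segmentOperator oneSub (ContinuousLinearMap.snd ℝ ℝ ℝ)).comp (PiLp.proj 2 _ 0)).prod
    (((segmentOperator oneSub (ContinuousLinearMap.fst ℝ ℝ ℝ)).comp (PiLp.proj 2 _ 0)).prod
      ((primitiveOperator 1 3 5).prod (primitiveOperator 2 4 6)))

theorem SmallOnFiniteCodim.prod {X Z Z' : Type*} [NormedAddCommGroup X] [InnerProductSpace ℝ X]
    [NormedAddCommGroup Z] [NormedSpace ℝ Z] [NormedAddCommGroup Z'] [NormedSpace ℝ Z']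
    {K : X →L[ℝ] Z} {L : X →L[ℝ] Z'} (hK : SmallOnFiniteCodim K) (hL : SmallOnFiniteCodim L) :
    SmallOnFiniteCodim (K.prod L) := by
  have h := (hK.postcomp (ContinuousLinearMap.inl ℝ Z Z')).add
    (hL.postcomp (ContinuousLinearMap.inr ℝ Z Z'))
  have h1 : K.prod L = (ContinuousLinearMap.inl ℝ Z Z').comp K
      + (ContinuousLinearMap.inr ℝ Z Z').comp L := by
    ext v <;> simp
  rwa [h1]

theorem smallOnFiniteCodim_fieldOperator : SmallOnFiniteCodim fieldOperator := by
  have h1 : SmallOnFiniteCodim (-segmentOperator oneSub (ContinuousLinearMap.snd ℝ ℝ ℝ)) := by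
    have h := (smallOnFiniteCodim_segmentOperator oneSub (ContinuousLinearMap.snd ℝ ℝ ℝ)).smul (-1)
    rwa [neg_one_smul] at h
  exact (h1.precomp _).prod (((smallOnFiniteCodim_segmentOperator _ _).precomp _).prod
    ((smallOnFiniteCodim_primitiveOperator _ _ _).prod
      (smallOnFiniteCodim_primitiveOperator _ _ _)))

/-- First component of the potential of the curl. -/
def potential1 (b : C1Fields) : C(ℝ × ℝ, ℝ) :=
  -segmentPotential oneSub (ContinuousLinearMap.snd ℝ ℝ ℝ) (curlC b)

/-- Second component of the potential of the curl. -/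
def potential2 (b : C1Fields) : C(ℝ × ℝ, ℝ) :=
  segmentPotential oneSub (ContinuousLinearMap.fst ℝ ℝ ℝ) (curlC b)

theorem fieldOperator_jet (b : C1Fields) : fieldOperator (jet b) =
    (toDiskLp 4 (potential1 b), toDiskLp 4 (potential2 b), toDiskLp 4 (valC b.2.2.1),
      toDiskLp 4 (valC b.2.2.2)) := by
  refine Prod.ext ?_ (Prod.ext ?_ (Prod.ext ?_ ?_))
  · have h := segmentOperator_toDiskLp oneSub (ContinuousLinearMap.snd ℝ ℝ ℝ) (curlC b)
    exact (congrArg Neg.neg h).trans (map_neg _ _).symm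
  · exact segmentOperator_toDiskLp _ _ _
  · exact primitiveOperator_jet _ rfl rfl rfl
  · exact primitiveOperator_jet _ rfl rfl rfl

/-- The inclusion of a factor in `JetSpace`. -/
def jetSingle (i : Fin 7) : DiskL2 →L[ℝ] JetSpace :=
  ((PiLp.continuousLinearEquiv 2 ℝ fun _ : Fin 7 => DiskL2).symm :
    (Fin 7 → DiskL2) →L[ℝ] JetSpace).comp (ContinuousLinearMap.single ℝ (fun _ => DiskL2) i)

theorem jetSingle_apply (i j : Fin 7) (f : DiskL2) :
    jetSingle i f j = if j = i then f else 0 := by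
  change (Pi.single i f : Fin 7 → DiskL2) j = _
  rw [Pi.single_apply]

/-- The product of two components of fields, placed in a factor of `JetSpace`. -/
def productInSlot (i : Fin 7) (A B : FieldSpace →L[ℝ] DiskL4) :
    FieldSpace →L[ℝ] FieldSpace →L[ℝ] JetSpace :=
  (ContinuousLinearMap.compL ℝ FieldSpace DiskL2 JetSpace (jetSingle i)).comp
    (mulDiskLp.bilinearComp A B)

/-- A component of `FieldSpace`. -/
def fieldProj1 : FieldSpace →L[ℝ] DiskL4 := ContinuousLinearMap.fst ℝ _ _

/-- A component of `FieldSpace`. -/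
def fieldProj2 : FieldSpace →L[ℝ] DiskL4 :=
  (ContinuousLinearMap.fst ℝ _ _).comp (ContinuousLinearMap.snd ℝ _ _)

/-- A component of `FieldSpace`. -/
def fieldProj3 : FieldSpace →L[ℝ] DiskL4 :=
  (ContinuousLinearMap.fst ℝ _ _).comp
    ((ContinuousLinearMap.snd ℝ _ _).comp (ContinuousLinearMap.snd ℝ _ _))

/-- A component of `FieldSpace`. -/
def fieldProj4 : FieldSpace →L[ℝ] DiskL4 :=
  (ContinuousLinearMap.snd ℝ _ _).comp
    ((ContinuousLinearMap.snd ℝ _ _).comp (ContinuousLinearMap.snd ℝ _ _))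

/-- The products of potentials and values in the covariant derivative. -/
def couplingForm : FieldSpace →L[ℝ] FieldSpace →L[ℝ] JetSpace :=
  productInSlot 4 fieldProj1 fieldProj3 - productInSlot 3 fieldProj1 fieldProj4
    + (productInSlot 6 fieldProj2 fieldProj3 - productInSlot 5 fieldProj2 fieldProj4)

/-- The bilinear form of `|φ|²`. -/
def densityForm : FieldSpace →L[ℝ] FieldSpace →L[ℝ] DiskL2 :=
  mulDiskLp.bilinearComp fieldProj3 fieldProj3 + mulDiskLp.bilinearComp fieldProj4 fieldProj4

theorem densityForm_apply (f1 f2 f3 f4 g1 g2 g3 g4 : C(ℝ × ℝ, ℝ)) :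
    densityForm (toDiskLp 4 f1, toDiskLp 4 f2, toDiskLp 4 f3, toDiskLp 4 f4)
      (toDiskLp 4 g1, toDiskLp 4 g2, toDiskLp 4 g3, toDiskLp 4 g4) =
      toDiskLp 2 (f3 * g3 + f4 * g4) := by
  rw [map_add, ← mulDiskLp_toDiskLp, ← mulDiskLp_toDiskLp]
  rfl

theorem couplingForm_apply (f1 f2 f3 f4 g1 g2 g3 g4 : C(ℝ × ℝ, ℝ)) (i : Fin 7) :
    couplingForm (toDiskLp 4 f1, toDiskLp 4 f2, toDiskLp 4 f3, toDiskLp 4 f4)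
      (toDiskLp 4 g1, toDiskLp 4 g2, toDiskLp 4 g3, toDiskLp 4 g4) i =
      toDiskLp 2 (![0, 0, 0, -(f1 * g4), f1 * g3, -(f2 * g4), f2 * g3] i) := by
  have h : couplingForm (toDiskLp 4 f1, toDiskLp 4 f2, toDiskLp 4 f3, toDiskLp 4 f4)
      (toDiskLp 4 g1, toDiskLp 4 g2, toDiskLp 4 g3, toDiskLp 4 g4) i =
      jetSingle 4 (toDiskLp 2 (f1 * g3)) i - jetSingle 3 (toDiskLp 2 (f1 * g4)) i
      + (jetSingle 6 (toDiskLp 2 (f2 * g3)) i - jetSingle 5 (toDiskLp 2 (f2 * g4)) i) := by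
    simp only [← mulDiskLp_toDiskLp]
    rfl
  rw [h]
  simp only [jetSingle_apply]
  fin_cases i <;> simp

/-! ### Formulas for the energy of a jet -/

/-- Integration over the disk, on continuous functions. -/
def diskIntegral : C(ℝ × ℝ, ℝ) →ₗ[ℝ] ℝ where
  toFun f := ∫ x in disk, f x
  map_add' f g := integral_add f.continuous.integrable_disk g.continuous.integrable_disk
  map_smul' c _ := integral_const_mul c _

theorem inner_toDiskLp_eq (f g : C(ℝ × ℝ, ℝ)) :
    inner ℝ (toDiskLp 2 f) (toDiskLp 2 g) = diskIntegral (f * g) := inner_toDiskLp f g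

/-- The element of `JetSpace` with given continuous components. -/
def jetOf (g : Fin 7 → C(ℝ × ℝ, ℝ)) : JetSpace := WithLp.toLp 2 fun i => toDiskLp 2 (g i)

theorem jetOf_apply (g : Fin 7 → C(ℝ × ℝ, ℝ)) (i : Fin 7) : jetOf g i = toDiskLp 2 (g i) := rfl

theorem inner_jetOf (g h : Fin 7 → C(ℝ × ℝ, ℝ)) :
    inner ℝ (jetOf g) (jetOf h) = diskIntegral (∑ i, g i * h i) := by
  rw [PiLp.inner_apply, map_sum]
  exact Finset.sum_congr rfl fun i _ => inner_toDiskLp_eq _ _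

/-- The components of curvature defect, values and covariant derivatives. -/
def covariantJet (F₀ : C(ℝ × ℝ, ℝ)) (b : C1Fields) : Fin 7 → C(ℝ × ℝ, ℝ) :=
  ![curlC b - F₀, valC b.2.2.1, valC b.2.2.2,
    pd1C b.2.2.1 - potential1 b * valC b.2.2.2, pd1C b.2.2.2 + potential1 b * valC b.2.2.1,
    pd2C b.2.2.1 - potential2 b * valC b.2.2.2, pd2C b.2.2.2 + potential2 b * valC b.2.2.1]

/-- The derivative of `covariantJet` at `b` in direction `c`. -/
def covariantJetDeriv (b c : C1Fields) : Fin 7 → C(ℝ × ℝ, ℝ) :=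
  ![curlC c, valC c.2.2.1, valC c.2.2.2,
    pd1C c.2.2.1 - potential1 b * valC c.2.2.2 - potential1 c * valC b.2.2.2,
    pd1C c.2.2.2 + potential1 b * valC c.2.2.1 + potential1 c * valC b.2.2.1,
    pd2C c.2.2.1 - potential2 b * valC c.2.2.2 - potential2 c * valC b.2.2.2,
    pd2C c.2.2.2 + potential2 b * valC c.2.2.1 + potential2 c * valC b.2.2.1]

/-- The density `|φ|²`. -/
def densityC (b : C1Fields) : C(ℝ × ℝ, ℝ) :=
  valC b.2.2.1 * valC b.2.2.1 + valC b.2.2.2 * valC b.2.2.2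

/-- The polarised density. -/
def densityPairC (b c : C1Fields) : C(ℝ × ℝ, ℝ) :=
  valC b.2.2.1 * valC c.2.2.1 + valC b.2.2.2 * valC c.2.2.2

theorem jet_sub_add_couplingForm (F₀ : C(ℝ × ℝ, ℝ)) (b : C1Fields) :
    jet b - jetSingle 0 (toDiskLp 2 F₀)
      + couplingForm (fieldOperator (jet b)) (fieldOperator (jet b)) =
      jetOf (covariantJet F₀ b) := by
  ext1 i
  have h : jet b i = toDiskLp 2 (![curlC b, valC b.2.2.1, valC b.2.2.2,
    pd1C b.2.2.1, pd1C b.2.2.2, pd2C b.2.2.1, pd2C b.2.2.2] i) := rfl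
  rw [PiLp.add_apply, PiLp.sub_apply, fieldOperator_jet, couplingForm_apply, jetOf_apply,
    jetSingle_apply, h, covariantJet]
  fin_cases i <;> simp [sub_eq_add_neg]

theorem jet_add_couplingForm (b c : C1Fields) :
    jet c + (couplingForm (fieldOperator (jet b)) (fieldOperator (jet c))
      + couplingForm (fieldOperator (jet c)) (fieldOperator (jet b))) =
      jetOf (covariantJetDeriv b c) := by
  ext1 i
  have h : jet c i = toDiskLp 2 (![curlC c, valC c.2.2.1, valC c.2.2.2,
    pd1C c.2.2.1, pd1C c.2.2.2, pd2C c.2.2.1, pd2C c.2.2.2] i) := rfl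
  rw [PiLp.add_apply, PiLp.add_apply, fieldOperator_jet, fieldOperator_jet, couplingForm_apply,
    couplingForm_apply, jetOf_apply, h, covariantJetDeriv]
  fin_cases i <;> simp [sub_eq_add_neg, add_assoc]

/-- The Ginzburg–Landau energy on `JetSpace`. -/
def jetEnergy (α β : ℝ) (F₀ : C(ℝ × ℝ, ℝ)) : JetSpace → ℝ :=
  quadraticEnergy fieldOperator couplingForm densityForm (jetSingle 0 (toDiskLp 2 F₀))
    (toDiskLp 2 1) (-(1 + α) / 2) (β / 4)

/-- The derivative of `jetEnergy`. -/
def jetEnergyDeriv (α β : ℝ) (F₀ : C(ℝ × ℝ, ℝ)) : JetSpace → JetSpace → ℝ :=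
  quadraticEnergyDeriv fieldOperator couplingForm densityForm (jetSingle 0 (toDiskLp 2 F₀))
    (toDiskLp 2 1) (-(1 + α) / 2) (β / 4)

theorem jetEnergy_jet (α β : ℝ) (F₀ : C(ℝ × ℝ, ℝ)) (b : C1Fields) :
    jetEnergy α β F₀ (jet b) = diskIntegral ((1 / 2 : ℝ) • (∑ i, covariantJet F₀ b i ^ 2)
      + (-(1 + α) / 2) • densityC b + (β / 4) • densityC b ^ 2) := by
  rw [jetEnergy, quadraticEnergy, jet_sub_add_couplingForm, fieldOperator_jet, densityForm_apply,
    ← real_inner_self_eq_norm_sq, ← real_inner_self_eq_norm_sq, inner_jetOf, inner_toDiskLp_eq,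
    inner_toDiskLp_eq, map_add, map_add, map_smul, map_smul, map_smul, one_mul, pow_two]
  simp only [pow_two]
  rfl

theorem jetEnergyDeriv_jet (α β : ℝ) (F₀ : C(ℝ × ℝ, ℝ)) (b c : C1Fields) :
    jetEnergyDeriv α β F₀ (jet b) (jet c) =
      diskIntegral ((∑ i, covariantJet F₀ b i * covariantJetDeriv b c i)
        - (1 + α) • densityPairC b c + β • (densityC b * densityPairC b c)) := by
  have h : toDiskLp 2 (valC b.2.2.1 * valC c.2.2.1 + valC b.2.2.2 * valC c.2.2.2)
      + toDiskLp 2 (valC c.2.2.1 * valC b.2.2.1 + valC c.2.2.2 * valC b.2.2.2) =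
      toDiskLp 2 ((2 : ℝ) • densityPairC b c) := by
    rw [← map_add]
    congr 1
    ext x
    simp [densityPairC]
    ring
  rw [jetEnergyDeriv, quadraticEnergyDeriv, jet_sub_add_couplingForm, jet_add_couplingForm,
    fieldOperator_jet, fieldOperator_jet, densityForm_apply, densityForm_apply, densityForm_apply,
    h, inner_jetOf, inner_toDiskLp_eq, inner_toDiskLp_eq, one_mul]
  simp only [mul_smul_comm, map_add, map_sub, map_smul, smul_eq_mul, densityC]
  ring

/-! ### Weak form of the Ginzburg–Landau equations -/

theorem contDiff_pd1 {E : Type*} [NormedAddCommGroup E] [NormedSpace ℝ E] {f : ℝ × ℝ → E}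
    (hf : ContDiff ℝ ∞ f) : ContDiff ℝ ∞ (pd1 f) :=
  (hf.fderiv_right (m := ∞) (by norm_num)).clm_apply contDiff_const

theorem contDiff_pd2 {E : Type*} [NormedAddCommGroup E] [NormedSpace ℝ E] {f : ℝ × ℝ → E}
    (hf : ContDiff ℝ ∞ f) : ContDiff ℝ ∞ (pd2 f) :=
  (hf.fderiv_right (m := ∞) (by norm_num)).clm_apply contDiff_const

theorem contDiff_curv {a1 a2 : ℝ × ℝ → ℝ} (h1 : ContDiff ℝ ∞ a1) (h2 : ContDiff ℝ ∞ a2) :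
    ContDiff ℝ ∞ (curv a1 a2) :=
  (contDiff_pd1 h2).sub (contDiff_pd2 h1)

theorem contDiff_D1 {a : ℝ × ℝ → ℝ} {φ : ℝ × ℝ → ℂ} (ha : ContDiff ℝ ∞ a)
    (hφ : ContDiff ℝ ∞ φ) : ContDiff ℝ ∞ (D1 a φ) :=
  (contDiff_pd1 hφ).add ((contDiff_const.mul (ofRealCLM.contDiff.comp ha)).mul hφ)

theorem contDiff_D2 {a : ℝ × ℝ → ℝ} {φ : ℝ × ℝ → ℂ} (ha : ContDiff ℝ ∞ a)
    (hφ : ContDiff ℝ ∞ φ) : ContDiff ℝ ∞ (D2 a φ) :=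
  (contDiff_pd2 hφ).add ((contDiff_const.mul (ofRealCLM.contDiff.comp ha)).mul hφ)

/-- Real inner product on `ℂ` in coordinates. -/
def reInner (z w : ℂ) : ℝ := z.re * w.re + z.im * w.im

theorem ContDiff.reInner {f g : ℝ × ℝ → ℂ} {n : WithTop ℕ∞} (hf : ContDiff ℝ n f)
    (hg : ContDiff ℝ n g) : ContDiff ℝ n fun x => reInner (f x) (g x) :=
  ((reCLM.contDiff.comp hf).mul (reCLM.contDiff.comp hg)).add
    ((imCLM.contDiff.comp hf).mul (imCLM.contDiff.comp hg))

theorem fderiv_reInner {f g : ℝ × ℝ → ℂ} {x : ℝ × ℝ} (hf : DifferentiableAt ℝ f x)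
    (hg : DifferentiableAt ℝ g x) (v : ℝ × ℝ) :
    fderiv ℝ (fun x => reInner (f x) (g x)) x v =
      reInner (fderiv ℝ f x v) (g x) + reInner (f x) (fderiv ℝ g x v) := by
  have h1 := reCLM.hasFDerivAt.comp x hf.hasFDerivAt
  have h2 := imCLM.hasFDerivAt.comp x hf.hasFDerivAt
  have h3 := reCLM.hasFDerivAt.comp x hg.hasFDerivAt
  have h4 := imCLM.hasFDerivAt.comp x hg.hasFDerivAt
  have h := (h1.mul h3).add (h2.mul h4)
  have h5 : HasFDerivAt (fun x => _root_.reInner (f x) (g x)) _ x := h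
  rw [h5.fderiv]
  simp [_root_.reInner]
  ring

theorem reInner_covariant (a : ℝ) (φ ψ d e : ℂ) :
    reInner (e + I * a * ψ) d + reInner ψ (φ + I * a * d) = reInner e d + reInner ψ φ := by
  simp [reInner]
  ring

theorem IsGLSolutionD.integral_eq_zero {α β : ℝ} {F₀ : ℝ × ℝ → ℝ} {P : DiskPair}
    (hP : IsGLSolutionD α β F₀ P) {ψ : ℝ × ℝ → ℂ} (hψ : ContDiff ℝ 1 ψ) :
    ∫ x in disk, (reInner (D1 P.a1 ψ x) (D1 P.a1 P.φ x) + reInner (D2 P.a2 ψ x) (D2 P.a2 P.φ x)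
      - (α - β * ‖P.φ x‖ ^ 2) * reInner (ψ x) (P.φ x)) = 0 := by
  have c1 := contDiff_D1 P.smooth_a1 P.smooth_φ
  have c2 := contDiff_D2 P.smooth_a2 P.smooth_φ
  have h := integral_divergence_disk (hψ.reInner (c1.of_le (by norm_num)))
    (hψ.reInner (c2.of_le (by norm_num))) (fun x hx => by
      have h1 := (hP.2.2.2 x hx).2
      have h2 := congrArg re h1
      have h3 := congrArg im h1
      simp at h2 h3
      simp only [reInner]
      linear_combination (ψ x).re * h2 + (ψ x).im * h3)
  rw [← h]
  refine setIntegral_congr_fun isClosed_disk.measurableSet fun x hx => ?_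
  have d1 := fderiv_reInner (hψ.differentiable one_ne_zero x)
    (c1.differentiable (by norm_num) x) (1, 0)
  have d2 := fderiv_reInner (hψ.differentiable one_ne_zero x)
    (c2.differentiable (by norm_num) x) (0, 1)
  have e1 := reInner_covariant (P.a1 x) (pd1 (D1 P.a1 P.φ) x) (ψ x) (D1 P.a1 P.φ x) (pd1 ψ x)
  have e2 := reInner_covariant (P.a2 x) (pd2 (D2 P.a2 P.φ) x) (ψ x) (D2 P.a2 P.φ x) (pd2 ψ x)
  have h1 : -(pd1 (D1 P.a1 P.φ) x + I * P.a1 x * D1 P.a1 P.φ x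
      + (pd2 (D2 P.a2 P.φ) x + I * P.a2 x * D2 P.a2 P.φ x)) =
      ((α - β * ‖P.φ x‖ ^ 2 : ℝ) : ℂ) * P.φ x := by
    have h0 := hP.2.2.1 x hx
    push_cast
    rw [sub_mul]
    exact h0
  have h2 : reInner (ψ x) (pd1 (D1 P.a1 P.φ) x + I * P.a1 x * D1 P.a1 P.φ x)
      + reInner (ψ x) (pd2 (D2 P.a2 P.φ) x + I * P.a2 x * D2 P.a2 P.φ x) =
      - ((α - β * ‖P.φ x‖ ^ 2) * reInner (ψ x) (P.φ x)) := by
    have h3 := congrArg re h1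
    have h4 := congrArg im h1
    rw [re_ofReal_mul] at h3
    rw [im_ofReal_mul] at h4
    rw [neg_re, add_re] at h3
    rw [neg_im, add_im] at h4
    simp only [reInner]
    linear_combination -(ψ x).re * h3 - (ψ x).im * h4
  change reInner (pd1 ψ x + I * P.a1 x * ψ x) (D1 P.a1 P.φ x)
    + reInner (pd2 ψ x + I * P.a2 x * ψ x) (D2 P.a2 P.φ x) - _ = fderiv ℝ _ x (1, 0)
      + fderiv ℝ _ x (0, 1)
  rw [d1, d2]
  change _ = reInner (pd1 ψ x) _ + reInner _ (pd1 (D1 P.a1 P.φ) x) +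
    (reInner (pd2 ψ x) _ + reInner _ (pd2 (D2 P.a2 P.φ) x))
  linear_combination e1 + e2 - h2

/-- The supercurrent, in the direction with covariant derivative `d`. -/
def current (φ d : ℂ) : ℝ := φ.re * d.im - φ.im * d.re

theorem IsGLSolutionD.integral_curl_eq_zero {α β : ℝ} {F₀ : ℝ × ℝ → ℝ}
    (hF₀ : ContDiff ℝ ∞ F₀) {P : DiskPair} (hP : IsGLSolutionD α β F₀ P) {c1 c2 : ℝ × ℝ → ℝ}
    (h1 : ContDiff ℝ 1 c1) (h2 : ContDiff ℝ 1 c2) :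
    ∫ x in disk, ((curv P.a1 P.a2 x - F₀ x) * curv c1 c2 x
      + c1 x * current (P.φ x) (D1 P.a1 P.φ x) + c2 x * current (P.φ x) (D2 P.a2 P.φ x)) = 0 := by
  have c0 : ContDiff ℝ ∞ fun x => curv P.a1 P.a2 x - F₀ x :=
    (contDiff_curv P.smooth_a1 P.smooth_a2).sub hF₀
  have c3 := c0.of_le (show (1 : WithTop ℕ∞) ≤ ∞ by norm_num)
  have h := integral_divergence_disk (c3.mul h2) (c3.mul h1).neg (fun x hx => by
      rw [(hP.2.2.2 x hx).1]
      simp)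
  rw [← h]
  refine setIntegral_congr_fun isClosed_disk.measurableSet fun x hx => ?_
  have d0 := c3.differentiable one_ne_zero x
  have d1 := (d0.hasFDerivAt.mul (h2.differentiable one_ne_zero x).hasFDerivAt).fderiv
  have d2 := (d0.hasFDerivAt.mul (h1.differentiable one_ne_zero x).hasFDerivAt).neg.fderiv
  have e1 := hP.1 x hx
  have e2 := hP.2.1 x hx
  change _ = fderiv ℝ _ x (1, 0) + fderiv ℝ _ x (0, 1)
  refine Eq.trans ?_ (congrArg₂ (fun L M => L (1, 0) + M (0, 1)) d1.symm d2.symm)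
  simp only [pd1, pd2, curv, current, _root_.add_apply, _root_.smul_apply, smul_eq_mul,
    _root_.neg_apply, mul_im, conj_re, conj_im] at e1 e2 ⊢
  linear_combination c1 x * e1 + c2 x * e2

/-! ### Solutions of the Ginzburg–Landau equations give critical jets -/

theorem Continuous.current {f g : ℝ × ℝ → ℂ} (hf : Continuous f) (hg : Continuous g) :
    Continuous fun x => current (f x) (g x) := by
  unfold _root_.current
  fun_prop

/-- The covariant derivative in direction `v`. -/
def covD (v : ℝ × ℝ) (a : ℝ × ℝ → ℝ) (φ : ℝ × ℝ → ℂ) (x : ℝ × ℝ) : ℂ :=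
  fderiv ℝ φ x v + I * a x * φ x

/-- The phase factor of a gauge transformation. -/
def phase (χ : ℝ × ℝ → ℝ) (x : ℝ × ℝ) : ℂ := exp (χ x * I)

theorem ContDiff.phase {χ : ℝ × ℝ → ℝ} (hχ : ContDiff ℝ 1 χ) : ContDiff ℝ 1 (phase χ) :=
  ((ofRealCLM.contDiff.comp hχ).mul contDiff_const).cexp

theorem phase_neg_mul_phase (χ : ℝ × ℝ → ℝ) (x : ℝ × ℝ) :
    phase χ x * phase (fun y => -χ y) x = 1 := by
  rw [phase, phase, ← Complex.exp_add]
  simp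

theorem reInner_phase_mul (χ : ℝ × ℝ → ℝ) (x : ℝ × ℝ) (z w : ℂ) :
    reInner (phase χ x * z) (phase χ x * w) = reInner z w := by
  have h : (phase χ x).re ^ 2 + (phase χ x).im ^ 2 = 1 := by
    rw [phase, exp_ofReal_mul_I_re, exp_ofReal_mul_I_im]
    exact Real.cos_sq_add_sin_sq _
  simp only [reInner, mul_re, mul_im]
  linear_combination (z.re * w.re + z.im * w.im) * h

theorem covD_phase_mul {χ : ℝ × ℝ → ℝ} {φ : ℝ × ℝ → ℂ} {x : ℝ × ℝ}
    (hχ : DifferentiableAt ℝ χ x) (hφ : DifferentiableAt ℝ φ x) (a : ℝ × ℝ → ℝ) (v : ℝ × ℝ)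
    {a' : ℝ × ℝ → ℝ} (ha : a' x = a x - fderiv ℝ χ x v) :
    covD v a' (fun y => phase χ y * φ y) x = phase χ x * covD v a φ x := by
  have h1 : HasFDerivAt (fun y => (χ y * I : ℂ)) _ x :=
    (ofRealCLM.hasFDerivAt.comp x hχ.hasFDerivAt).mul_const I
  have h2 : HasFDerivAt (fun y => phase χ y * φ y) _ x := h1.cexp.mul hφ.hasFDerivAt
  rw [covD, covD, h2.fderiv, ha]
  simp [phase]
  ring

/-- The complex function with real and imaginary parts the last two components. -/
def complexField (b : C1Fields) (x : ℝ × ℝ) : ℂ :=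
  valC b.2.2.1 x + valC b.2.2.2 x * I

theorem contDiff_complexField (b : C1Fields) : ContDiff ℝ 1 (complexField b) :=
  (ofRealCLM.contDiff.comp (contDiff_C1 _)).add
    ((ofRealCLM.contDiff.comp (contDiff_C1 _)).mul contDiff_const)

theorem fderiv_complexField (b : C1Fields) (x v : ℝ × ℝ) :
    fderiv ℝ (complexField b) x v =
      fderiv ℝ b.2.2.1.1 x v + fderiv ℝ b.2.2.2.1 x v * I := by
  have h1 := ofRealCLM.hasFDerivAt.comp x
    ((contDiff_C1 b.2.2.1).differentiable one_ne_zero x).hasFDerivAt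
  have h2 := (ofRealCLM.hasFDerivAt.comp x
    ((contDiff_C1 b.2.2.2).differentiable one_ne_zero x).hasFDerivAt).mul_const I
  have h3 : HasFDerivAt (complexField b) _ x := h1.add h2
  rw [h3.fderiv]
  simp [mul_comm]

theorem covariantJet_add_mul_I_1 (F₀ : C(ℝ × ℝ, ℝ)) (b : C1Fields) (x : ℝ × ℝ) :
    (covariantJet F₀ b 3 x + covariantJet F₀ b 4 x * I : ℂ) =
      covD (1, 0) (potential1 b) (complexField b) x := by
  rw [covD, fderiv_complexField]
  simp [covariantJet, complexField, pd1C, pd1]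
  linear_combination -(potential1 b x * valC b.2.2.2 x : ℂ) * I_mul_I

theorem covariantJet_add_mul_I_2 (F₀ : C(ℝ × ℝ, ℝ)) (b : C1Fields) (x : ℝ × ℝ) :
    (covariantJet F₀ b 5 x + covariantJet F₀ b 6 x * I : ℂ) =
      covD (0, 1) (potential2 b) (complexField b) x := by
  rw [covD, fderiv_complexField]
  simp [covariantJet, complexField, pd2C, pd2]
  linear_combination -(potential2 b x * valC b.2.2.2 x : ℂ) * I_mul_I

theorem covariantJetDeriv_add_mul_I_1 (b c : C1Fields) (x : ℝ × ℝ) :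
    (covariantJetDeriv b c 3 x + covariantJetDeriv b c 4 x * I : ℂ) =
      covD (1, 0) (potential1 b) (complexField c) x + I * potential1 c x * complexField b x := by
  rw [covD, fderiv_complexField]
  simp [covariantJetDeriv, complexField, pd1C, pd1]
  linear_combination -(potential1 b x * valC c.2.2.2 x + potential1 c x * valC b.2.2.2 x : ℂ)
    * I_mul_I

theorem covariantJetDeriv_add_mul_I_2 (b c : C1Fields) (x : ℝ × ℝ) :
    (covariantJetDeriv b c 5 x + covariantJetDeriv b c 6 x * I : ℂ) =
      covD (0, 1) (potential2 b) (complexField c) x + I * potential2 c x * complexField b x := by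
  rw [covD, fderiv_complexField]
  simp [covariantJetDeriv, complexField, pd2C, pd2]
  linear_combination -(potential2 b x * valC c.2.2.2 x + potential2 c x * valC b.2.2.2 x : ℂ)
    * I_mul_I

theorem reInner_add_mul_I (a b c d : ℝ) : reInner (a + b * I) (c + d * I) = a * c + b * d := by
  simp [reInner]

theorem norm_sq_eq_reInner (z : ℂ) : ‖z‖ ^ 2 = reInner z z := by
  rw [Complex.sq_norm, normSq_apply]
  rfl

theorem sum_covariantJet_mul (F₀ : C(ℝ × ℝ, ℝ)) (b c : C1Fields) (x : ℝ × ℝ) :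
    (∑ i, covariantJet F₀ b i * covariantJetDeriv b c i) x =
      (curlC b x - F₀ x) * curlC c x + reInner (complexField b x) (complexField c x)
      + reInner (covD (1, 0) (potential1 b) (complexField b) x)
        (covD (1, 0) (potential1 b) (complexField c) x + I * potential1 c x * complexField b x)
      + reInner (covD (0, 1) (potential2 b) (complexField b) x)
        (covD (0, 1) (potential2 b) (complexField c) x
          + I * potential2 c x * complexField b x) := by
  rw [← covariantJet_add_mul_I_1 F₀, ← covariantJet_add_mul_I_2 F₀,
    ← covariantJetDeriv_add_mul_I_1, ← covariantJetDeriv_add_mul_I_2, complexField, complexField,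
    reInner_add_mul_I, reInner_add_mul_I, reInner_add_mul_I, ContinuousMap.sum_apply]
  simp only [Fin.sum_univ_succ, ContinuousMap.mul_apply]
  simp [covariantJet, covariantJetDeriv]
  ring

theorem sum_covariantJet_sq (F₀ : C(ℝ × ℝ, ℝ)) (b : C1Fields) (x : ℝ × ℝ) :
    (∑ i, covariantJet F₀ b i ^ 2) x =
      (curlC b x - F₀ x) ^ 2 + ‖complexField b x‖ ^ 2
      + ‖covD (1, 0) (potential1 b) (complexField b) x‖ ^ 2
      + ‖covD (0, 1) (potential2 b) (complexField b) x‖ ^ 2 := by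
  rw [norm_sq_eq_reInner, norm_sq_eq_reInner, norm_sq_eq_reInner,
    ← covariantJet_add_mul_I_1 F₀, ← covariantJet_add_mul_I_2 F₀, complexField,
    reInner_add_mul_I, reInner_add_mul_I, reInner_add_mul_I, ContinuousMap.sum_apply]
  simp only [Fin.sum_univ_succ, ContinuousMap.pow_apply]
  simp [covariantJet]
  ring

theorem densityC_apply (b : C1Fields) (x : ℝ × ℝ) : densityC b x = ‖complexField b x‖ ^ 2 := by
  rw [norm_sq_eq_reInner, complexField, reInner_add_mul_I]
  rfl

theorem densityPairC_apply (b c : C1Fields) (x : ℝ × ℝ) :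
    densityPairC b c x = reInner (complexField b x) (complexField c x) := by
  rw [complexField, complexField, reInner_add_mul_I]
  rfl

theorem exists_gauge_C1Fields (b : C1Fields) : ∃ χ : ℝ × ℝ → ℝ, ContDiff ℝ 1 χ ∧
    (∀ x, potential1 b x = b.1.1 x - fderiv ℝ χ x (1, 0)) ∧
    ∀ x, potential2 b x = b.2.1.1 x - fderiv ℝ χ x (0, 1) := by
  obtain ⟨χ, h, h1, h2⟩ := exists_gauge (contDiff_C1 b.1) (contDiff_C1 b.2.1) (curlC b).continuous
  refine ⟨χ, h, fun x => ?_, fun x => ?_⟩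
  · have h3 := h1 x
    change fderiv ℝ χ x (1, 0) = _ at h3
    rw [h3]
    change -segmentPotential _ _ _ x = _
    change _ = _ - (_ + segmentPotential oneSub (ContinuousLinearMap.snd ℝ ℝ ℝ) (curlC b) x)
    ring
  · have h3 := h2 x
    change fderiv ℝ χ x (0, 1) = _ at h3
    rw [h3]
    change segmentPotential _ _ _ x = _
    change _ = _ - (_ - segmentPotential oneSub (ContinuousLinearMap.fst ℝ ℝ ℝ) (curlC b) x)
    ring

theorem exists_critical_jet {α β : ℝ} {F₀ : C(ℝ × ℝ, ℝ)} (hF₀ : ContDiff ℝ ∞ F₀) {P : DiskPair}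
    (hP : IsGLSolutionD α β F₀ P) : ∃ b : C1Fields, jetEnergy α β F₀ (jet b) = energyD α β F₀ P ∧
      ∀ c : C1Fields, jetEnergyDeriv α β F₀ (jet b) (jet c) = 0 := by
  have s1 := P.smooth_a1.of_le (show (1 : WithTop ℕ∞) ≤ ∞ by norm_num)
  have s2 := P.smooth_a2.of_le (show (1 : WithTop ℕ∞) ≤ ∞ by norm_num)
  have s3 := P.smooth_φ.of_le (show (1 : WithTop ℕ∞) ≤ ∞ by norm_num)
  obtain ⟨χ, hχ, p1, p2⟩ := exists_gauge_C1Fields (⟨P.a1, s1⟩, ⟨P.a2, s2⟩, 0, 0)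
  have hφ : ContDiff ℝ 1 fun x => phase χ x * P.φ x := hχ.phase.mul s3
  let b : C1Fields := (⟨P.a1, s1⟩, ⟨P.a2, s2⟩,
    ⟨fun x => (phase χ x * P.φ x).re, reCLM.contDiff.comp hφ⟩,
    ⟨fun x => (phase χ x * P.φ x).im, imCLM.contDiff.comp hφ⟩)
  replace p1 : ∀ x, potential1 b x = P.a1 x - fderiv ℝ χ x (1, 0) := p1
  replace p2 : ∀ x, potential2 b x = P.a2 x - fderiv ℝ χ x (0, 1) := p2
  have hb : complexField b = fun x => phase χ x * P.φ x := by
    ext1 x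
    exact re_add_im _
  have hcurl : ∀ x, curlC b x = curv P.a1 P.a2 x := fun x => rfl
  have dχ := fun x => hχ.differentiable one_ne_zero x
  have dφ := fun x => s3.differentiable one_ne_zero x
  have hb1 : ∀ x, covD (1, 0) (potential1 b) (complexField b) x = phase χ x * D1 P.a1 P.φ x := by
    intro x
    rw [hb]
    exact covD_phase_mul (dχ x) (dφ x) P.a1 (1, 0) (p1 x)
  have hb2 : ∀ x, covD (0, 1) (potential2 b) (complexField b) x = phase χ x * D2 P.a2 P.φ x := by
    intro x
    rw [hb]
    exact covD_phase_mul (dχ x) (dφ x) P.a2 (0, 1) (p2 x)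
  refine ⟨b, ?_, fun c => ?_⟩
  · rw [jetEnergy_jet, energyD, ← integral_const_mul]
    refine integral_congr_ae (Eventually.of_forall fun x => ?_)
    change 1 / 2 * (∑ i, covariantJet F₀ b i ^ 2) x + (-(1 + α) / 2) * densityC b x
      + (β / 4) * densityC b x ^ 2 = _
    rw [sum_covariantJet_sq, densityC_apply, hb1, hb2, hb, hcurl]
    simp only [norm_sq_eq_reInner, reInner_phase_mul]
    simp only [← norm_sq_eq_reInner]
    ring
  · obtain ⟨η, hη, q1, q2⟩ := exists_gauge_C1Fields c
    have hχn : ContDiff ℝ 1 fun x => -χ x := hχ.neg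
    set ψ₀ : ℝ × ℝ → ℂ := fun x => phase (fun y => -χ y) x * complexField c x with hψ₀
    have sψ₀ : ContDiff ℝ 1 ψ₀ := hχn.phase.mul (contDiff_complexField c)
    have hc : complexField c = fun x => phase χ x * ψ₀ x := by
      ext1 x
      rw [hψ₀, ← mul_assoc, phase_neg_mul_phase, one_mul]
    have dψ₀ := fun x => sψ₀.differentiable one_ne_zero x
    have hc1 : ∀ x, covD (1, 0) (potential1 b) (complexField c) x =
        phase χ x * D1 P.a1 ψ₀ x := by
      intro x
      rw [hc]
      exact covD_phase_mul (dχ x) (dψ₀ x) P.a1 (1, 0) (p1 x)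
    have hc2 : ∀ x, covD (0, 1) (potential2 b) (complexField c) x =
        phase χ x * D2 P.a2 ψ₀ x := by
      intro x
      rw [hc]
      exact covD_phase_mul (dχ x) (dψ₀ x) P.a2 (0, 1) (p2 x)
    have sη : ContDiff ℝ 1 fun x => (I * η x * P.φ x : ℂ) :=
      (contDiff_const.mul (ofRealCLM.contDiff.comp hη)).mul s3
    have hη' : ∀ x v, fderiv ℝ (fun x => ψ₀ x - (I * η x * P.φ x : ℂ)) x v =
        fderiv ℝ ψ₀ x v - I * (fderiv ℝ η x v * P.φ x + η x * fderiv ℝ P.φ x v) := by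
      intro x v
      have h1 : HasFDerivAt (fun y => (I * η y : ℂ)) _ x := (ofRealCLM.hasFDerivAt.comp x
        (hη.differentiable one_ne_zero x).hasFDerivAt).const_mul I
      have h2 : HasFDerivAt (fun x => ψ₀ x - (I * η x * P.φ x : ℂ)) _ x :=
        (dψ₀ x).hasFDerivAt.sub (h1.mul (dφ x).hasFDerivAt)
      rw [h2.fderiv]
      simp
      ring
    have w1 := hP.integral_eq_zero (sψ₀.sub sη)
    have w2 := hP.integral_curl_eq_zero hF₀ (contDiff_C1 c.1) (contDiff_C1 c.2.1)
    have i2 : Continuous fun x => (curv P.a1 P.a2 x - F₀ x) * curv c.1.1 c.2.1.1 x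
        + c.1.1 x * current (P.φ x) (D1 P.a1 P.φ x)
        + c.2.1.1 x * current (P.φ x) (D2 P.a2 P.φ x) := by
      have k1 := (contDiff_curv P.smooth_a1 P.smooth_a2).continuous
      have k2 : Continuous (curv c.1.1 c.2.1.1) := (curlC c).continuous
      have k3 := (contDiff_D1 P.smooth_a1 P.smooth_φ).continuous
      have k4 := (contDiff_D2 P.smooth_a2 P.smooth_φ).continuous
      have k5 := P.smooth_φ.continuous
      exact (((k1.sub hF₀.continuous).mul k2).add
        ((contDiff_C1 c.1).continuous.mul (k5.current k3))).add
        ((contDiff_C1 c.2.1).continuous.mul (k5.current k4))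
    have key : ∀ x, ((∑ i, covariantJet F₀ b i * covariantJetDeriv b c i)
        - (1 + α) • densityPairC b c + β • (densityC b * densityPairC b c)) x
        - ((curv P.a1 P.a2 x - F₀ x) * curv c.1.1 c.2.1.1 x
        + c.1.1 x * current (P.φ x) (D1 P.a1 P.φ x)
        + c.2.1.1 x * current (P.φ x) (D2 P.a2 P.φ x)) =
        reInner (D1 P.a1 (fun x => ψ₀ x - (I * η x * P.φ x : ℂ)) x) (D1 P.a1 P.φ x)
        + reInner (D2 P.a2 (fun x => ψ₀ x - (I * η x * P.φ x : ℂ)) x) (D2 P.a2 P.φ x)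
        - (α - β * ‖P.φ x‖ ^ 2) * reInner (ψ₀ x - (I * η x * P.φ x : ℂ)) (P.φ x) := by
      intro x
      have l1 : D1 P.a1 (fun x => ψ₀ x - (I * η x * P.φ x : ℂ)) x = D1 P.a1 ψ₀ x
          - I * (fderiv ℝ η x (1, 0) * P.φ x + η x * D1 P.a1 P.φ x) := by
        rw [D1, pd1, hη', D1, D1, pd1, pd1]
        ring
      have l2 : D2 P.a2 (fun x => ψ₀ x - (I * η x * P.φ x : ℂ)) x = D2 P.a2 ψ₀ x
          - I * (fderiv ℝ η x (0, 1) * P.φ x + η x * D2 P.a2 P.φ x) := by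
        rw [D2, pd2, hη', D2, D2, pd2, pd2]
        ring
      change (∑ i, covariantJet F₀ b i * covariantJetDeriv b c i) x
        - (1 + α) * densityPairC b c x + β * (densityC b x * densityPairC b c x) - _ = _
      rw [sum_covariantJet_mul, densityC_apply, densityPairC_apply, hb1, hb2, hc1, hc2, hb, hc,
        hcurl, l1, l2, q1, q2, mul_left_comm, mul_left_comm _ (phase χ x), ← mul_add, ← mul_add]
      simp only [norm_sq_eq_reInner, reInner_phase_mul]
      change (curv P.a1 P.a2 x - F₀ x) * curv c.1.1 c.2.1.1 x + _ + _ + _ - _ + _ - _ = _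
      simp [reInner, current]
      ring
    have i1 := (ContinuousMap.continuous _).sub i2
      |>.congr key
    rw [jetEnergyDeriv_jet]
    refine (integral_congr_ae (Eventually.of_forall fun x => eq_add_of_sub_eq (key x))).trans
      ((integral_add i1.integrable_disk i2.integrable_disk).trans ?_)
    exact (congrArg₂ (· + ·) w1 w2).trans (add_zero 0)

/-! ### A priori bounds for critical jets -/

theorem diskIntegral_mul_self (f : C(ℝ × ℝ, ℝ)) :
    diskIntegral (f * f) = ‖toDiskLp 2 f‖ ^ 2 := by
  rw [← inner_toDiskLp_eq, real_inner_self_eq_norm_sq]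

theorem abs_diskIntegral_mul_le (f g : C(ℝ × ℝ, ℝ)) :
    |diskIntegral (f * g)| ≤ ‖toDiskLp 2 f‖ * ‖toDiskLp 2 g‖ := by
  rw [← inner_toDiskLp_eq]
  exact abs_real_inner_le_norm _ _

theorem diskIntegral_mono {f g : C(ℝ × ℝ, ℝ)} (h : ∀ x, f x ≤ g x) :
    diskIntegral f ≤ diskIntegral g :=
  integral_mono f.continuous.integrable_disk g.continuous.integrable_disk h

theorem norm_toDiskLp_mul_le (f g : C(ℝ × ℝ, ℝ)) :
    ‖toDiskLp 2 (f * g)‖ ≤ ‖mulDiskLp‖ * ‖toDiskLp 4 f‖ * ‖toDiskLp 4 g‖ := by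
  rw [← mulDiskLp_toDiskLp]
  exact mulDiskLp.le_opNorm₂ _ _

theorem norm_toDiskLp_four_sq_le {f g : C(ℝ × ℝ, ℝ)} (h : ∀ x, f x ^ 2 ≤ g x) :
    ‖toDiskLp 4 f‖ ^ 2 ≤ ‖toDiskLp 2 g‖ := by
  have h1 : ‖toDiskLp 4 f‖ ^ 4 = diskIntegral (f ^ 4) := by
    rw [norm_Lp_four_pow]
    refine integral_congr_ae ?_
    filter_upwards [coeFn_toDiskLp 4 f] with x hx
    rw [hx]
    rfl
  have h2 : diskIntegral (f ^ 4) ≤ diskIntegral (g * g) := diskIntegral_mono fun x => by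
    have h3 := h x
    have h4 : f x ^ 4 ≤ g x * g x := by nlinarith [sq_nonneg (f x)]
    exact h4
  rw [diskIntegral_mul_self] at h2
  refine le_of_sq_le_sq ?_ (norm_nonneg _)
  nlinarith

theorem segmentPotential_zero (m : C(ℝ, ℝ)) (e : (ℝ × ℝ) →L[ℝ] ℝ) : segmentPotential m e 0 = 0 := by
  ext x
  simp [segmentPotential, segmentAverage]

theorem norm_jet_sq (b : C1Fields) : ‖jet b‖ ^ 2 = ‖toDiskLp 2 (curlC b)‖ ^ 2
    + ‖toDiskLp 2 (valC b.2.2.1)‖ ^ 2 + ‖toDiskLp 2 (valC b.2.2.2)‖ ^ 2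
    + ‖toDiskLp 2 (pd1C b.2.2.1)‖ ^ 2 + ‖toDiskLp 2 (pd1C b.2.2.2)‖ ^ 2
    + ‖toDiskLp 2 (pd2C b.2.2.1)‖ ^ 2 + ‖toDiskLp 2 (pd2C b.2.2.2)‖ ^ 2 := by
  rw [PiLp.norm_sq_eq_of_L2]
  simp [Fin.sum_univ_succ, jet]
  ring

theorem critical_scaling {α β : ℝ} {F₀ : C(ℝ × ℝ, ℝ)} {b : C1Fields}
    (h : ∀ c, jetEnergyDeriv α β F₀ (jet b) (jet c) = 0) :
    ‖toDiskLp 2 (covariantJet F₀ b 3)‖ ^ 2 + ‖toDiskLp 2 (covariantJet F₀ b 4)‖ ^ 2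
      + ‖toDiskLp 2 (covariantJet F₀ b 5)‖ ^ 2 + ‖toDiskLp 2 (covariantJet F₀ b 6)‖ ^ 2
      + β * ‖toDiskLp 2 (densityC b)‖ ^ 2 = α * diskIntegral (1 * densityC b) := by
  have h1 := h (0, 0, b.2.2.1, b.2.2.2)
  have h2 : curlC (0, 0, b.2.2.1, b.2.2.2) = 0 := by
    change pd1C 0 - pd2C 0 = 0
    rw [map_zero, map_zero, sub_zero]
  have h3 : potential1 (0, 0, b.2.2.1, b.2.2.2) = 0 := by
    rw [potential1, h2, segmentPotential_zero, neg_zero]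
  have h4 : potential2 (0, 0, b.2.2.1, b.2.2.2) = 0 := by
    rw [potential2, h2, segmentPotential_zero]
  rw [jetEnergyDeriv_jet] at h1
  have h5 : densityPairC b (0, 0, b.2.2.1, b.2.2.2) = densityC b := rfl
  have h6 : ∑ i, covariantJet F₀ b i * covariantJetDeriv b (0, 0, b.2.2.1, b.2.2.2) i =
      1 * densityC b + (covariantJet F₀ b 3 * covariantJet F₀ b 3
      + covariantJet F₀ b 4 * covariantJet F₀ b 4 + covariantJet F₀ b 5 * covariantJet F₀ b 5
      + covariantJet F₀ b 6 * covariantJet F₀ b 6) := by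
    simp only [Fin.sum_univ_succ]
    simp [covariantJet, covariantJetDeriv, h2, h3, h4, densityC]
    ring
  rw [h6, h5] at h1
  simp only [map_add, map_sub, map_smul, diskIntegral_mul_self, smul_eq_mul, one_mul] at h1 ⊢
  linear_combination h1

theorem critical_potential {α β : ℝ} {F₀ : C(ℝ × ℝ, ℝ)} {b : C1Fields}
    (h : ∀ c, jetEnergyDeriv α β F₀ (jet b) (jet c) = 0) :
    ‖toDiskLp 2 (curlC b)‖ ^ 2 = diskIntegral (F₀ * curlC b)
      + diskIntegral (covariantJet F₀ b 3 * (potential1 b * valC b.2.2.2))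
      - diskIntegral (covariantJet F₀ b 4 * (potential1 b * valC b.2.2.1))
      + diskIntegral (covariantJet F₀ b 5 * (potential2 b * valC b.2.2.2))
      - diskIntegral (covariantJet F₀ b 6 * (potential2 b * valC b.2.2.1)) := by
  have h1 := h (b.1, b.2.1, 0, 0)
  have h2 : curlC (b.1, b.2.1, 0, 0) = curlC b := rfl
  have h3 : potential1 (b.1, b.2.1, 0, 0) = potential1 b := rfl
  have h4 : potential2 (b.1, b.2.1, 0, 0) = potential2 b := rfl
  rw [jetEnergyDeriv_jet] at h1
  have h5 : densityPairC b (b.1, b.2.1, 0, 0) = 0 := by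
    simp [densityPairC]
  have h6 : ∑ i, covariantJet F₀ b i * covariantJetDeriv b (b.1, b.2.1, 0, 0) i =
      curlC b * curlC b - F₀ * curlC b - covariantJet F₀ b 3 * (potential1 b * valC b.2.2.2)
      + covariantJet F₀ b 4 * (potential1 b * valC b.2.2.1)
      - covariantJet F₀ b 5 * (potential2 b * valC b.2.2.2)
      + covariantJet F₀ b 6 * (potential2 b * valC b.2.2.1) := by
    simp only [Fin.sum_univ_succ]
    simp [covariantJet, covariantJetDeriv, h2, h3, h4]
    ring
  rw [h6, h5, mul_zero, smul_zero, smul_zero, sub_zero, add_zero] at h1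
  simp only [map_add, map_sub, diskIntegral_mul_self] at h1
  linear_combination h1

theorem exists_bound_critical_values {α β : ℝ} (hα : 0 < α) (hβ : 0 < β) (F₀ : C(ℝ × ℝ, ℝ)) :
    ∃ C, 0 ≤ C ∧ ∀ b : C1Fields, (∀ c, jetEnergyDeriv α β F₀ (jet b) (jet c) = 0) →
      ‖toDiskLp 2 (covariantJet F₀ b 3)‖ ≤ C ∧ ‖toDiskLp 2 (covariantJet F₀ b 4)‖ ≤ C ∧
      ‖toDiskLp 2 (covariantJet F₀ b 5)‖ ≤ C ∧ ‖toDiskLp 2 (covariantJet F₀ b 6)‖ ≤ C ∧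
      ‖toDiskLp 2 (valC b.2.2.1)‖ ≤ C ∧ ‖toDiskLp 2 (valC b.2.2.2)‖ ≤ C ∧
      ‖toDiskLp 4 (valC b.2.2.1)‖ ≤ C ∧ ‖toDiskLp 4 (valC b.2.2.2)‖ ≤ C := by
  set n : ℝ := ‖toDiskLp 2 1‖ with hn
  have hn0 : 0 ≤ n := norm_nonneg _
  set m : ℝ := α * n / β with hm
  have hm0 : 0 ≤ m := by positivity
  have hα0 : 0 ≤ α * n * m := by positivity
  have hnm : 0 ≤ n * m := by positivity
  refine ⟨1 + m + n * m + α * n * m, by positivity, fun b h => ?_⟩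
  have h1 := critical_scaling h
  have h2 := (le_abs_self _).trans (abs_diskIntegral_mul_le 1 (densityC b))
  have hs0 : 0 ≤ ‖toDiskLp 2 (densityC b)‖ := norm_nonneg _
  have h3 : ‖toDiskLp 2 (densityC b)‖ ≤ m := by
    rw [hm, le_div_iff₀ hβ]
    rcases hs0.eq_or_lt with h0 | h0
    · rw [← h0, zero_mul]
      positivity
    · refine le_of_mul_le_mul_right ?_ h0
      nlinarith [sq_nonneg ‖toDiskLp 2 (covariantJet F₀ b 3)‖,
        sq_nonneg ‖toDiskLp 2 (covariantJet F₀ b 4)‖,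
        sq_nonneg ‖toDiskLp 2 (covariantJet F₀ b 5)‖,
        sq_nonneg ‖toDiskLp 2 (covariantJet F₀ b 6)‖, mul_le_mul_of_nonneg_left h2 hα.le]
  have h4 : diskIntegral (1 * densityC b) ≤ n * m := h2.trans (by gcongr)
  have h5 : α * diskIntegral (1 * densityC b) ≤ α * n * m := by
    rw [mul_assoc]
    gcongr
  have h6 : diskIntegral (1 * densityC b) =
      ‖toDiskLp 2 (valC b.2.2.1)‖ ^ 2 + ‖toDiskLp 2 (valC b.2.2.2)‖ ^ 2 := by
    rw [← diskIntegral_mul_self, ← diskIntegral_mul_self, ← map_add, one_mul]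
    rfl
  have h7 : ‖toDiskLp 4 (valC b.2.2.1)‖ ^ 2 ≤ m :=
    (norm_toDiskLp_four_sq_le fun x => by
      change _ ≤ valC b.2.2.1 x * valC b.2.2.1 x + valC b.2.2.2 x * valC b.2.2.2 x
      nlinarith [mul_self_nonneg (valC b.2.2.2 x)]).trans h3
  have h8 : ‖toDiskLp 4 (valC b.2.2.2)‖ ^ 2 ≤ m :=
    (norm_toDiskLp_four_sq_le fun x => by
      change _ ≤ valC b.2.2.1 x * valC b.2.2.1 x + valC b.2.2.2 x * valC b.2.2.2 x
      nlinarith [mul_self_nonneg (valC b.2.2.1 x)]).trans h3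
  have h9 : ∀ t : ℝ, t ^ 2 ≤ m + n * m + α * n * m → t ≤ 1 + m + n * m + α * n * m := by
    intro t ht
    nlinarith [sq_nonneg (t - 1)]
  have h10 : 0 ≤ β * ‖toDiskLp 2 (densityC b)‖ ^ 2 := by positivity
  have q3 := sq_nonneg ‖toDiskLp 2 (covariantJet F₀ b 3)‖
  have q4 := sq_nonneg ‖toDiskLp 2 (covariantJet F₀ b 4)‖
  have q5 := sq_nonneg ‖toDiskLp 2 (covariantJet F₀ b 5)‖
  have q6 := sq_nonneg ‖toDiskLp 2 (covariantJet F₀ b 6)‖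
  have q7 := sq_nonneg ‖toDiskLp 2 (valC b.2.2.1)‖
  have q8 := sq_nonneg ‖toDiskLp 2 (valC b.2.2.2)‖
  refine ⟨h9 _ ?_, h9 _ ?_, h9 _ ?_, h9 _ ?_, h9 _ ?_, h9 _ ?_, h9 _ ?_, h9 _ ?_⟩ <;> linarith

theorem exists_bound_critical_curl {α β : ℝ} (hα : 0 < α) (hβ : 0 < β) (F₀ : C(ℝ × ℝ, ℝ)) :
    ∃ A, 0 ≤ A ∧ ∀ b : C1Fields, (∀ c, jetEnergyDeriv α β F₀ (jet b) (jet c) = 0) →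
      ‖toDiskLp 2 (curlC b)‖ ≤ A ∧
      ‖toDiskLp 2 (potential1 b * valC b.2.2.1)‖ ≤ A ∧
      ‖toDiskLp 2 (potential1 b * valC b.2.2.2)‖ ≤ A ∧
      ‖toDiskLp 2 (potential2 b * valC b.2.2.1)‖ ≤ A ∧
      ‖toDiskLp 2 (potential2 b * valC b.2.2.2)‖ ≤ A := by
  obtain ⟨C, hC, hb⟩ := exists_bound_critical_values hα hβ F₀
  set T1 := segmentOperator oneSub (ContinuousLinearMap.snd ℝ ℝ ℝ) with hT1
  set T2 := segmentOperator oneSub (ContinuousLinearMap.fst ℝ ℝ ℝ) with hT2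
  set M : ℝ := ‖mulDiskLp‖ * (‖T1‖ + ‖T2‖) * C with hM
  have hM0 : 0 ≤ M := by positivity
  set A : ℝ := ‖toDiskLp 2 F₀‖ + 4 * (C * M) with hA
  have hA0 : 0 ≤ A := by positivity
  refine ⟨A + M * A, by positivity, fun b h => ?_⟩
  obtain ⟨c3, c4, c5, c6, v1, v2, w1, w2⟩ := hb b h
  set F : ℝ := ‖toDiskLp 2 (curlC b)‖ with hF
  have hF0 : 0 ≤ F := norm_nonneg _
  have a1 : ‖toDiskLp 4 (potential1 b)‖ ≤ (‖T1‖ + ‖T2‖) * F := by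
    rw [potential1, map_neg, norm_neg, ← segmentOperator_toDiskLp]
    refine (T1.le_opNorm _).trans ?_
    gcongr
    exact le_add_of_nonneg_right (norm_nonneg _)
  have a2 : ‖toDiskLp 4 (potential2 b)‖ ≤ (‖T1‖ + ‖T2‖) * F := by
    rw [potential2, ← segmentOperator_toDiskLp]
    refine (T2.le_opNorm _).trans ?_
    gcongr
    exact le_add_of_nonneg_left (norm_nonneg _)
  have prod : ∀ f g : C(ℝ × ℝ, ℝ), ‖toDiskLp 4 f‖ ≤ (‖T1‖ + ‖T2‖) * F → ‖toDiskLp 4 g‖ ≤ C →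
      ‖toDiskLp 2 (f * g)‖ ≤ M * F := by
    intro f g hf hg
    refine (norm_toDiskLp_mul_le f g).trans ?_
    calc ‖mulDiskLp‖ * ‖toDiskLp 4 f‖ * ‖toDiskLp 4 g‖
        ≤ ‖mulDiskLp‖ * ((‖T1‖ + ‖T2‖) * F) * C := by gcongr
      _ = M * F := by rw [hM]; ring
  have p1 := prod _ _ a1 w1
  have p2 := prod _ _ a1 w2
  have p3 := prod _ _ a2 w1
  have p4 := prod _ _ a2 w2
  have pair : ∀ f g : C(ℝ × ℝ, ℝ), ‖toDiskLp 2 f‖ ≤ C → ‖toDiskLp 2 g‖ ≤ M * F →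
      |diskIntegral (f * g)| ≤ C * M * F := by
    intro f g hf hg
    refine (abs_diskIntegral_mul_le f g).trans ?_
    rw [mul_assoc]
    gcongr
  have hFA : F ≤ A := by
    have e1 := critical_potential h
    have e2 := abs_le.1 (abs_diskIntegral_mul_le F₀ (curlC b))
    have e3 := abs_le.1 (pair _ _ c3 p2)
    have e4 := abs_le.1 (pair _ _ c4 p1)
    have e5 := abs_le.1 (pair _ _ c5 p4)
    have e6 := abs_le.1 (pair _ _ c6 p3)
    have e7 : F * F ≤ A * F := by
      have e8 : A * F = ‖toDiskLp 2 F₀‖ * F + 4 * (C * M * F) := by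
        rw [hA]
        ring
      rw [e8, ← pow_two, e1]
      linarith [e2.2, e3.2, e4.1, e5.2, e6.1]
    rcases hF0.eq_or_lt with h0 | h0
    · rwa [← h0]
    · exact le_of_mul_le_mul_right e7 h0
  have hMF : M * F ≤ A + M * A := (mul_le_mul_of_nonneg_left hFA hM0).trans
    (le_add_of_nonneg_left hA0)
  exact ⟨hFA.trans (le_add_of_nonneg_right (mul_nonneg hM0 hA0)), p1.trans hMF, p2.trans hMF,
    p3.trans hMF, p4.trans hMF⟩

theorem exists_bound_critical_jet {α β : ℝ} (hα : 0 < α) (hβ : 0 < β) (F₀ : C(ℝ × ℝ, ℝ)) :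
    ∃ r, ∀ b : C1Fields, (∀ c, jetEnergyDeriv α β F₀ (jet b) (jet c) = 0) → ‖jet b‖ ≤ r := by
  obtain ⟨C, hC, hb⟩ := exists_bound_critical_values hα hβ F₀
  obtain ⟨A, hA, hb'⟩ := exists_bound_critical_curl hα hβ F₀
  refine ⟨A + 2 * C + 4 * (C + A), fun b h => ?_⟩
  obtain ⟨c3, c4, c5, c6, v1, v2, -, -⟩ := hb b h
  obtain ⟨hF, p1, p2, p3, p4⟩ := hb' b h
  have d1 : ‖toDiskLp 2 (pd1C b.2.2.1)‖ ≤ C + A := by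
    have e : pd1C b.2.2.1 = covariantJet F₀ b 3 + potential1 b * valC b.2.2.2 :=
      (sub_add_cancel _ _).symm
    rw [e, map_add]
    exact (norm_add_le _ _).trans (add_le_add c3 p2)
  have d2 : ‖toDiskLp 2 (pd1C b.2.2.2)‖ ≤ C + A := by
    have e : pd1C b.2.2.2 = covariantJet F₀ b 4 - potential1 b * valC b.2.2.1 :=
      (add_sub_cancel_right _ _).symm
    rw [e, map_sub]
    exact (norm_sub_le _ _).trans (add_le_add c4 p1)
  have d3 : ‖toDiskLp 2 (pd2C b.2.2.1)‖ ≤ C + A := by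
    have e : pd2C b.2.2.1 = covariantJet F₀ b 5 + potential2 b * valC b.2.2.2 :=
      (sub_add_cancel _ _).symm
    rw [e, map_add]
    exact (norm_add_le _ _).trans (add_le_add c5 p4)
  have d4 : ‖toDiskLp 2 (pd2C b.2.2.2)‖ ≤ C + A := by
    have e : pd2C b.2.2.2 = covariantJet F₀ b 6 - potential2 b * valC b.2.2.1 :=
      (add_sub_cancel_right _ _).symm
    rw [e, map_sub]
    exact (norm_sub_le _ _).trans (add_le_add c6 p3)
  refine le_of_sq_le_sq ?_ (by positivity)
  rw [norm_jet_sq]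
  calc _ ≤ A ^ 2 + C ^ 2 + C ^ 2 + (C + A) ^ 2 + (C + A) ^ 2 + (C + A) ^ 2 + (C + A) ^ 2 := by gcongr
    _ ≤ _ := by nlinarith [mul_nonneg hA hC]

end

/-- the set of critical values of the Ginzburg–Landau energy on the
disk is finite. -/
theorem statement19 (α β : ℝ) (hα : 0 < α) (hβ : 0 < β) (F₀ : ℝ × ℝ → ℝ)
    (hF₀ : ContDiff ℝ (⊤ : ℕ∞) F₀) :
    { t : ℝ | ∃ P : DiskPair, IsGLSolutionD α β F₀ P ∧ t = energyD α β F₀ P }.Finite := by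
  set G : C(ℝ × ℝ, ℝ) := ⟨F₀, hF₀.continuous⟩
  obtain ⟨r, hr⟩ := exists_bound_critical_jet hα hβ G
  refine (finite_image_quadraticEnergy smallOnFiniteCodim_fieldOperator couplingForm densityForm
    (jetSingle 0 (toDiskLp 2 G)) (toDiskLp 2 1) (-(1 + α) / 2) (β / 4) (LinearMap.range jet)
    r).subset ?_
  rintro t ⟨P, hP, rfl⟩
  obtain ⟨b, hb, hc⟩ := exists_critical_jet (F₀ := G) hF₀ hP
  refine ⟨jet b, ⟨⟨b, rfl⟩, hr b hc, ?_⟩, hb⟩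
  rintro _ ⟨c, rfl⟩
  exact hc c
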